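/- Let (u_p)_{p>1} be a family of low energy nodal solutions of (P_p). For any δ ∈ (0,1) there exist p_δ > p₀ and C_δ > 0 such that for i = 1,2, |1 + v_{i,p}(z)/p|^p ≤ C_δ/(1 + |z|^{4−δ}) whenever |z| ≤ ϱ₀/ε_{i,p} and p > p_δ. -/

import Mathlib

open Real MeasureTheory Metric Filter Topology Bornology

noncomputable section

abbrev E2 : Type := EuclideanSpace ℝ (Fin 2)

/-- Laplacian of `u : ℝ² → ℝ` via coordinate second derivatives. -/
def lap (u : E2 → ℝ) (x : E2) : ℝ :=
  ∑ i : Fin 2,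
    fderiv ℝ (fun y => fderiv ℝ u y (EuclideanSpace.single i 1)) x (EuclideanSpace.single i 1)

/-- `u` is a (classical) solution of the Lane–Emden problem `(P_p)` on `Ω`. -/
def IsSolution (Ω : Set E2) (p : ℝ) (u : E2 → ℝ) : Prop :=
  ContDiffOn ℝ 2 u Ω ∧ ContinuousOn u (closure Ω) ∧
    (∀ x ∈ Ω, -lap u x = |u x| ^ (p - 1) * u x) ∧
    (∀ x ∈ frontier Ω, u x = 0)

/-- `u` is a nodal (sign-changing) function on `Ω`. -/
def IsNodal (Ω : Set E2) (u : E2 → ℝ) : Prop :=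
  (∃ x ∈ Ω, 0 < u x) ∧ (∃ x ∈ Ω, u x < 0)

/-- The Green function of `-Δ` on `Ω` with Dirichlet boundary conditions, together with
its regular part `H`, so that `G(x,y) = -(1/2π) log|x-y| + H(x,y)`. -/
structure GreenData (Ω : Set E2) where
  G : E2 → E2 → ℝ
  H : E2 → E2 → ℝ
  decomp : ∀ x y, G x y = -(1 / (2 * π)) * Real.log ‖x - y‖ + H x y
  bdry : ∀ x ∈ Ω, ∀ y ∈ frontier Ω, G x y = 0
  symm : ∀ x y, G x y = G y x
  smoothH : ContDiffOn ℝ (⊤ : ℕ∞) (fun q : E2 × E2 => H q.1 q.2) (Ω ×ˢ Ω)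
  contH : ∀ x ∈ Ω, ContinuousOn (H x) (closure Ω)
  harmH : ∀ x ∈ Ω, ∀ y ∈ Ω, lap (H x) y = 0

/-- The Kirchhoff–Routh type function `Ψ(a₁,a₂) = 2G(a₁,a₂) − R(a₁) − R(a₂)`. -/
def KR {Ω : Set E2} (gd : GreenData Ω) (q : E2 × E2) : ℝ :=
  2 * gd.G q.1 q.2 - gd.H q.1 q.1 - gd.H q.2 q.2

/-- `q` is a non-degenerate critical point of `F`. -/
def NondegCrit (F : E2 × E2 → ℝ) (q : E2 × E2) : Prop :=
  fderiv ℝ F q = 0 ∧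
    ∀ v : E2 × E2, (∀ w : E2 × E2, fderiv ℝ (fun r => fderiv ℝ F r) q v w = 0) → v = 0

/-- Convergence in `C²_loc(S)`: uniform convergence of all derivatives of order `≤ 2`
on compact subsets of `S`. -/
def TendstoC2LocOn (S : Set E2) (F : ℕ → E2 → ℝ) (g : E2 → ℝ) : Prop :=
  ∀ K : Set E2, K ⊆ S → IsCompact K → ∀ k : ℕ, k ≤ 2 →
    TendstoUniformlyOn (fun n x => iteratedFDeriv ℝ k (F n) x)
      (fun x => iteratedFDeriv ℝ k g x) atTop K

/-- `‖u⁺‖_∞` on `closure Ω`. -/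
def supPos (Ω : Set E2) (u : E2 → ℝ) : ℝ := sSup ((fun x => max (u x) 0) '' closure Ω)

/-- `‖u⁻‖_∞` on `closure Ω`. -/
def supNeg (Ω : Set E2) (u : E2 → ℝ) : ℝ := sSup ((fun x => max (-u x) 0) '' closure Ω)

/-- The energy functional `J_p`. -/
def energy (Ω : Set E2) (p : ℝ) (u : E2 → ℝ) : ℝ :=
  (1 / 2) * (∫ x in Ω, ‖fderiv ℝ u x‖ ^ 2) - (1 / (p + 1)) * ∫ x in Ω, |u x| ^ (p + 1)

/-- The standard bubble `U(z) = −2 log(1 + |z|²/8)`. -/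
def Ustd (z : E2) : ℝ := -2 * Real.log (1 + ‖z‖ ^ 2 / 8)

/-- Unit vector at angle `θ`. -/
def circDir (θ : ℝ) : E2 :=
  EuclideanSpace.single 0 (Real.cos θ) + EuclideanSpace.single 1 (Real.sin θ)

/-- Surface integral over the circle `∂B_r(c)`; the integrand may depend on the
outer unit normal (first argument) and on the point (second argument). -/
def surfInt (c : E2) (r : ℝ) (F : E2 → E2 → ℝ) : ℝ :=
  ∫ θ in (0:ℝ)..(2 * π), r * F (circDir θ) (c + r • circDir θ)

/-- Inner product of gradients `⟨∇f, ∇g⟩`. -/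
def gradInner (f g : E2 → ℝ) (x : E2) : ℝ :=
  ∑ j : Fin 2, fderiv ℝ f x (EuclideanSpace.single j 1) *
    fderiv ℝ g x (EuclideanSpace.single j 1)

/-- The quadratic form `P_i` (centred at `c`, radius `r`). -/
def Pform (c : E2) (r : ℝ) (f g : E2 → ℝ) : ℝ :=
  -2 * r * surfInt c r (fun ν x => fderiv ℝ f x ν * fderiv ℝ g x ν) +
    r * surfInt c r (fun _ x => gradInner f g x)

/-- The quadratic form `Q_{ij}` (centred at `c`, radius `r`). -/
def Qform (c : E2) (r : ℝ) (j : Fin 2) (f g : E2 → ℝ) : ℝ :=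
  surfInt c r (fun ν x =>
    -(fderiv ℝ f x (EuclideanSpace.single j 1)) * fderiv ℝ g x ν -
      fderiv ℝ f x ν * fderiv ℝ g x (EuclideanSpace.single j 1) +
      gradInner f g x * ν j)


section
open scoped Pointwise in
lemma bm1 {A B C : Set ℝ} (hA : MeasurableSet A) (hB : MeasurableSet B)
    (hAn : A.Nonempty) (hBn : B.Nonempty) (hC : A + B ⊆ C) :
    volume A + volume B ≤ volume C := by
  have key : ∀ K L : Set ℝ, IsCompact K → IsCompact L → K.Nonempty → L.Nonempty → K ⊆ A → L ⊆ B →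
      volume K + volume L ≤ volume C := by
    intro K L hK hL hKn hLn hKA hLB
    obtain ⟨k, hk, hkmax⟩ := hK.exists_isGreatest hKn
    obtain ⟨l, hl, hlmin⟩ := hL.exists_isLeast hLn
    have h1 : volume ((fun x => x + l) '' K) = volume K := by
      rw [Set.image_add_right]; exact measure_preimage_add_right volume (-l) K
    have h2 : volume ((fun x => k + x) '' L) = volume L := by
      rw [Set.image_add_left]; exact measure_preimage_add volume (-k) L
    have h3 : AEDisjoint volume ((fun x => x + l) '' K) ((fun x => k + x) '' L) := by
      refine measure_mono_null (t := {k + l}) ?_ (by simp)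
      rintro z ⟨⟨a, ha, rfl⟩, ⟨b, hb, hab⟩⟩
      have := hkmax ha
      have := hlmin hb
      simp only at hab
      simp only [Set.mem_singleton_iff]
      linarith
    have hm : MeasurableSet ((fun x => k + x) '' L) := by
      exact (hL.image (by fun_prop)).measurableSet
    rw [← h1, ← h2, ← measure_union₀ hm.nullMeasurableSet h3]
    apply measure_mono
    rintro z (⟨a, ha, rfl⟩ | ⟨b, hb, rfl⟩)
    · exact hC (Set.add_mem_add (hKA ha) (hLB hl))
    · exact hC (Set.add_mem_add (hKA hk) (hLB hb))
  have reg : ∀ S : Set ℝ, MeasurableSet S → S.Nonempty →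
      Nonempty {K : Set ℝ // K ⊆ S ∧ IsCompact K ∧ K.Nonempty} ∧
      volume S ≤ ⨆ K : {K : Set ℝ // K ⊆ S ∧ IsCompact K ∧ K.Nonempty}, volume K.1 := by
    intro S hS hSn
    obtain ⟨a0, ha0⟩ := hSn
    refine ⟨⟨⟨{a0}, by simpa using ha0, isCompact_singleton, by simp⟩⟩, ?_⟩
    apply le_of_forall_lt
    intro c hc
    obtain ⟨K, hKS, hK, hcK⟩ := hS.exists_lt_isCompact hc
    refine hcK.trans_le ((measure_mono (Set.subset_insert a0 K)).trans ?_)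
    exact le_iSup (fun K : {K : Set ℝ // K ⊆ S ∧ IsCompact K ∧ K.Nonempty} => volume K.1)
      ⟨insert a0 K, Set.insert_subset ha0 hKS, hK.insert a0, ⟨_, Set.mem_insert _ _⟩⟩
  obtain ⟨n1, h1⟩ := reg A hA hAn
  obtain ⟨n2, h2⟩ := reg B hB hBn
  exact (add_le_add h1 h2).trans (ENNReal.iSup_add_iSup_le fun K L =>
    key K.1 L.1 K.2.2.1 L.2.2.1 K.2.2.2 L.2.2.2 K.2.1 L.2.1)

lemma bm_fun {f g h : ℝ → ℝ} (hf : Measurable f) (hg : Measurable g) (hh : Measurable h)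
    (hf0 : ∀ s, 0 ≤ f s) (hg0 : ∀ s, 0 ≤ g s) (hh0 : ∀ s, 0 ≤ h s)
    (hf1 : ∀ s, f s ≤ 1) (hg1 : ∀ s, g s ≤ 1)
    (hfs : ∀ l < 1, ∃ s, l < f s) (hgs : ∀ l < 1, ∃ s, l < g s)
    (hm : ∀ s s', min (f s) (g s') ≤ h (s + s')) :
    (∫⁻ s, ENNReal.ofReal (f s)) + ∫⁻ s, ENNReal.ofReal (g s) ≤ ∫⁻ s, ENNReal.ofReal (h s) := by
  have aux : ∀ q : ℝ → ℝ, (∀ s, q s ≤ 1) → Measurable q → (∀ s, 0 ≤ q s) →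
      ∫⁻ s, ENNReal.ofReal (q s) = ∫⁻ l in Set.Ioo 0 1, volume {s | l < q s} := by
    intro q hq1 hq hq0
    rw [lintegral_eq_lintegral_meas_lt volume (Eventually.of_forall hq0) hq.aemeasurable]
    have : Set.Ioi (0:ℝ) = Set.Ioo 0 1 ∪ Set.Ici 1 := by
      ext x; simp only [Set.mem_Ioi, Set.mem_union, Set.mem_Ioo, Set.mem_Ici]
      constructor
      · intro hx; rcases lt_or_ge x 1 with h | h <;> simp [*]
      · rintro (h | h) <;> linarith
    rw [this, lintegral_union measurableSet_Ici]
    · have : ∫⁻ l in Set.Ici 1, volume {s | l < q s} = 0 := by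
        rw [setLIntegral_congr_fun (g := fun _ => 0) measurableSet_Ici]
        · simp
        · intro l hl
          have : {s | l < q s} = ∅ := by
            ext s; simp only [Set.mem_ofPred_eq, Set.mem_empty_iff_false, iff_false, not_lt]
            exact (hq1 s).trans hl
          simp [this]
      rw [this, add_zero]
    · rw [Set.disjoint_left]; intro x hx hx'; exact absurd hx.2 (not_lt.mpr hx')
  rw [aux f hf1 hf hf0, aux g hg1 hg hg0,
    lintegral_eq_lintegral_meas_lt volume (Eventually.of_forall hh0) hh.aemeasurable]
  refine le_trans ?_ (lintegral_mono_set (s := Set.Ioo 0 1) (fun x hx => hx.1))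
  rw [← lintegral_add_left']
  · apply setLIntegral_mono' measurableSet_Ioo
    intro l hl
    apply bm1 (measurableSet_lt measurable_const hf) (measurableSet_lt measurable_const hg)
      (hfs l hl.2) (hgs l hl.2)
    rintro z ⟨a, ha, b, hb, rfl⟩
    exact lt_of_lt_of_le (lt_min ha hb) (hm a b)
  · apply Measurable.aemeasurable
    apply Antitone.measurable
    intro a b hab
    exact measure_mono (fun s hs => lt_of_le_of_lt hab hs)

open scoped Pointwise in
/-- Brunn-Minkowski in the plane. -/
lemma bm2 {A B C : Set (ℝ × ℝ)} (hA : MeasurableSet A) (hB : MeasurableSet B) (hC : MeasurableSet C)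
    (hAb : IsBounded A) (hBb : IsBounded B) (hCb : IsBounded C) (hABC : A + B ⊆ C)
    (hA0 : 0 < volume.real A) (hB0 : 0 < volume.real B) :
    (√(volume.real A) + √(volume.real B)) ^ 2 ≤ volume.real C := by
  -- slices
  have slice : ∀ S : Set (ℝ × ℝ), MeasurableSet S → IsBounded S →
      ∃ F : ℝ → ℝ, Measurable F ∧ (∀ s, 0 ≤ F s) ∧
        (∀ s, ENNReal.ofReal (F s) = volume (Prod.mk s ⁻¹' S)) ∧
        BddAbove (Set.range F) ∧
        ∫⁻ s, ENNReal.ofReal (F s) = volume S := by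
    intro S hS hSb
    obtain ⟨R, hR⟩ := hSb.subset_closedBall 0
    have hle : ∀ s, volume (Prod.mk s ⁻¹' S) ≤ ENNReal.ofReal (2 * R) := by
      intro s
      have : Prod.mk s ⁻¹' S ⊆ closedBall (0:ℝ) R := by
        intro y hy
        have := hR hy
        simp only [mem_closedBall, dist_zero_right] at this ⊢
        exact (norm_snd_le (s, y)).trans this
      refine (measure_mono this).trans ?_
      rw [Real.volume_closedBall]
    have hfin : ∀ s, volume (Prod.mk s ⁻¹' S) ≠ ⊤ := fun s => ne_top_of_le_ne_top ENNReal.ofReal_ne_top (hle s)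
    refine ⟨fun s => (volume (Prod.mk s ⁻¹' S)).toReal, ?_, ?_, ?_, ?_, ?_⟩
    · exact (measurable_measure_prodMk_left hS).ennreal_toReal
    · intro s; positivity
    · intro s; exact ENNReal.ofReal_toReal (hfin s)
    · refine ⟨max (2 * R) 0, ?_⟩
      rintro _ ⟨s, rfl⟩
      have := ENNReal.toReal_mono ENNReal.ofReal_ne_top (hle s)
      rwa [ENNReal.toReal_ofReal'] at this
    · rw [Measure.volume_eq_prod, Measure.prod_apply hS]
      exact lintegral_congr fun s => ENNReal.ofReal_toReal (hfin s)
  obtain ⟨F, hFm, hF0, hFs, hFb, hFi⟩ := slice A hA hAb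
  obtain ⟨G, hGm, hG0, hGs, hGb, hGi⟩ := slice B hB hBb
  obtain ⟨H, hHm, hH0, hHs, hHb, hHi⟩ := slice C hC hCb
  have supp : ∀ (S : Set (ℝ × ℝ)) (F : ℝ → ℝ), 0 < volume.real S → (∀ s, 0 ≤ F s) → BddAbove (Set.range F) →
      ∫⁻ s, ENNReal.ofReal (F s) = volume S → 0 < ⨆ s, F s := by
    intro S F hS hF0 hFb hFi
    by_contra hcon
    have : ∀ s, F s = 0 := fun s => le_antisymm ((le_ciSup hFb s).trans (not_lt.mp hcon)) (hF0 s)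
    simp only [this, ENNReal.ofReal_zero, lintegral_zero] at hFi
    simp [Measure.real, ← hFi] at hS
  have hMF := supp A F hA0 hF0 hFb hFi
  have hMG := supp B G hB0 hG0 hGb hGi
  set a := ⨆ s, F s
  set b := ⨆ s, G s
  have hFG : ∀ s s', 0 < F s → 0 < G s' → F s + G s' ≤ H (s + s') := by
    intro s s' h1 h2
    rw [← ENNReal.ofReal_le_ofReal_iff (hH0 _), ENNReal.ofReal_add h1.le h2.le, hFs, hGs, hHs]
    apply bm1 (measurable_prodMk_left hA) (measurable_prodMk_left hB)
    · apply nonempty_of_measure_ne_zero (μ := volume); rw [← hFs]; simpa using h1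
    · apply nonempty_of_measure_ne_zero (μ := volume); rw [← hGs]; simpa using h2
    · rintro z ⟨x, hx, y, hy, rfl⟩
      exact hABC ⟨_, hx, _, hy, rfl⟩
  have := bm_fun (f := fun s => F s / a) (g := fun s => G s / b) (h := fun s => H s / (a + b))
    (by fun_prop) (by fun_prop) (by fun_prop) (fun s => div_nonneg (hF0 s) hMF.le)
    (fun s => div_nonneg (hG0 s) hMG.le) (fun s => div_nonneg (hH0 s) (by positivity))
    (fun s => (div_le_one hMF).mpr (le_ciSup hFb s)) (fun s => (div_le_one hMG).mpr (le_ciSup hGb s))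
    (fun l hl => by
      obtain ⟨s, hs⟩ := exists_lt_of_lt_ciSup (show l * a < a by nlinarith)
      exact ⟨s, (lt_div_iff₀ hMF).mpr hs⟩)
    (fun l hl => by
      obtain ⟨s, hs⟩ := exists_lt_of_lt_ciSup (show l * b < b by nlinarith)
      exact ⟨s, (lt_div_iff₀ hMG).mpr hs⟩)
    (fun s s' => by
      rcases (hF0 s).eq_or_lt with h1 | h1
      · refine (min_le_left _ _).trans ?_
        rw [← h1, zero_div]; exact div_nonneg (hH0 _) (by positivity)
      rcases (hG0 s').eq_or_lt with h2 | h2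
      · refine (min_le_right _ _).trans ?_
        rw [← h2, zero_div]; exact div_nonneg (hH0 _) (by positivity)
      rw [le_div_iff₀ (by positivity)]
      refine le_trans ?_ (hFG s s' h1 h2)
      have e1 : min (F s / a) (G s' / b) * a ≤ F s := by
        rw [← le_div_iff₀ hMF]; exact min_le_left _ _
      have e2 : min (F s / a) (G s' / b) * b ≤ G s' := by
        rw [← le_div_iff₀ hMG]; exact min_le_right _ _
      linarith)
  have sc : ∀ (F : ℝ → ℝ) (S : Set (ℝ × ℝ)) (c : ℝ), 0 < c → Measurable F → (∫⁻ s, ENNReal.ofReal (F s) = volume S) →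
      ∫⁻ s, ENNReal.ofReal (F s / c) = ENNReal.ofReal c⁻¹ * volume S := by
    intro F S c hc hF hFi
    rw [← hFi, ← lintegral_const_mul _ (by fun_prop)]
    congr 1; ext s
    rw [← ENNReal.ofReal_mul (by positivity)]; congr 1; field_simp
  rw [sc F A a hMF hFm hFi, sc G B b hMG hGm hGi, sc H C (a + b) (by positivity) hHm hHi] at this
  have hAf := hAb.measure_lt_top (μ := volume) |>.ne
  have hBf := hBb.measure_lt_top (μ := volume) |>.ne
  have hCf := hCb.measure_lt_top (μ := volume) |>.ne
  have h3 := ENNReal.toReal_mono (ENNReal.mul_ne_top ENNReal.ofReal_ne_top hCf) this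
  rw [ENNReal.toReal_add (ENNReal.mul_ne_top ENNReal.ofReal_ne_top hAf) (ENNReal.mul_ne_top ENNReal.ofReal_ne_top hBf)] at h3
  simp only [ENNReal.toReal_mul] at h3
  rw [ENNReal.toReal_ofReal (by positivity), ENNReal.toReal_ofReal (by positivity), ENNReal.toReal_ofReal (by positivity)] at h3
  change a⁻¹ * volume.real A + b⁻¹ * volume.real B ≤ (a + b)⁻¹ * volume.real C at h3
  have hx := Real.sq_sqrt hA0.le
  have hy := Real.sq_sqrt hB0.le
  set x := √(volume.real A)
  set y := √(volume.real B)
  rw [← hx, ← hy, ← div_eq_inv_mul, ← div_eq_inv_mul, ← div_eq_inv_mul, le_div_iff₀ (by positivity)] at h3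
  refine le_trans ?_ h3
  have : (x ^ 2 / a + y ^ 2 / b) * (a + b) - (x + y) ^ 2 = (b * x - a * y) ^ 2 / (a * b) := by
    field_simp; ring
  have h5 : 0 ≤ (b * x - a * y) ^ 2 / (a * b) := by positivity
  linarith
end

section
open scoped Pointwise in
lemma bm3 {A : Set E2} (hA : MeasurableSet A) (hAb : IsBounded A) {r : ℝ} (hr : 0 < r) :
    volume.real A + 2 * √π * r * √(volume.real A) ≤ volume.real (thickening r A) := by
  rcases (measureReal_nonneg (μ := volume) (s := A)).eq_or_lt with h0 | h0
  · rw [← h0]; simp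
  let e : E2 → ℝ × ℝ := fun x => (x 0, x 1)
  have he : MeasurePreserving e volume volume := by
    have h1 := (volume_preserving_finTwoArrow ℝ).comp (PiLp.volume_preserving_ofLp (Fin 2))
    exact h1
  let e' : ℝ × ℝ → E2 := fun z => !₂[z.1, z.2]
  have hee : ∀ x, e' (e x) = x := by
    intro x; ext i; fin_cases i <;> simp [e, e']
  have hee' : ∀ x, e (e' x) = x := by
    intro x; simp [e, e']
  have hem : Measurable e' := by
    have : Continuous e' := by
      apply (PiLp.continuous_toLp 2 (fun _ : Fin 2 => ℝ)).comp
      refine continuous_pi fun i => ?_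
      fin_cases i <;> simp <;> fun_prop
    exact this.measurable
  have hadd : ∀ x y, e (x + y) = e x + e y := by intro x y; simp [e]
  have hadd' : ∀ x y, e' (x + y) = e' x + e' y := by
    intro x y; ext i; fin_cases i <;> simp [e']
  have vol : ∀ S : Set E2, MeasurableSet S → volume.real (e' ⁻¹' S) = volume.real S := by
    intro S hS
    have h1 := he.measure_preimage (s := e' ⁻¹' S) (hem hS).nullMeasurableSet
    have h2 : e ⁻¹' (e' ⁻¹' S) = S := by ext x; simp [hee]
    rw [h2] at h1
    simp only [Measure.real, h1]
  have bdd : ∀ S : Set E2, IsBounded S → IsBounded (e' ⁻¹' S) := by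
    intro S hS
    obtain ⟨R, hR⟩ := hS.subset_closedBall 0
    refine (isBounded_closedBall (x := (0 : ℝ × ℝ)) (r := R)).subset ?_
    intro z hz
    have := hR hz
    simp only [mem_closedBall, dist_zero_right] at this ⊢
    rw [Prod.norm_def]
    refine max_le ?_ ?_
    · exact (PiLp.norm_apply_le (e' z) 0).trans this
    · exact (PiLp.norm_apply_le (e' z) 1).trans this
  have hball : volume.real (ball (0 : E2) r) = π * r ^ 2 := by
    simp only [Measure.real, EuclideanSpace.volume_ball_fin_two]
    rw [ENNReal.toReal_mul, ENNReal.toReal_pow, ENNReal.toReal_ofReal hr.le]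
    simp [mul_comm, pi_pos.le]
  have := bm2 (A := e' ⁻¹' A) (B := e' ⁻¹' (ball 0 r)) (C := e' ⁻¹' (thickening r A))
    (hem hA) (hem measurableSet_ball) (hem isOpen_thickening.measurableSet)
    (bdd _ hAb) (bdd _ isBounded_ball) (bdd _ hAb.thickening)
    (by
      rintro _ ⟨x, hx, y, hy, rfl⟩
      rw [Set.mem_preimage, hadd', ← add_ball_zero]
      exact Set.add_mem_add hx hy)
    (by rw [vol _ hA]; exact h0)
    (by rw [vol _ measurableSet_ball, hball]; positivity)
  rw [vol _ hA, vol _ measurableSet_ball, vol _ isOpen_thickening.measurableSet, hball,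
    Real.sqrt_mul pi_pos.le, Real.sqrt_sq hr.le] at this
  refine le_trans ?_ this
  have hx := Real.sq_sqrt h0.le
  nlinarith [sq_nonneg (√π * r)]

lemma iso_fun {g : E2 → ℝ} (hg : ContDiff ℝ 1 g) (hgc : HasCompactSupport g) (hg0 : ∀ x, 0 ≤ g x)
    {c : ℝ} (hc : 0 < c) {S : Set E2} (hS : ∀ x ∈ S, c ≤ g x) :
    2 * √π * c * √(volume.real S) ≤ ∫ x, ‖fderiv ℝ g x‖ := by
  have hD : Continuous (fun x => fderiv ℝ g x) := hg.continuous_fderiv (by norm_num)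
  have hDc : HasCompactSupport (fun x => fderiv ℝ g x) := hgc.fderiv (𝕜 := ℝ)
  have hDu : UniformContinuous (fun x => fderiv ℝ g x) := hDc.uniformContinuous_of_continuous hD
  have hDi : Integrable (fun x => ‖fderiv ℝ g x‖) := (hD.integrable_of_hasCompactSupport hDc).norm
  have hgi : Integrable g := hg.continuous.integrable_of_hasCompactSupport hgc
  set K1 : Set E2 := cthickening 1 (tsupport g) with hK1
  have hK1c : IsCompact K1 := hgc.isCompact.cthickening
  have hK1m : MeasurableSet K1 := hK1c.measurableSet
  have main : ∀ ω > 0, 2 * √π * c * √(volume.real S) ≤ (∫ x, ‖fderiv ℝ g x‖) + ω * volume.real K1 := by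
    intro ω hω
    obtain ⟨r0, hr0, hr⟩ := Metric.uniformContinuous_iff.mp hDu ω hω
    set r := min r0 1
    have hrp : 0 < r := lt_min hr0 one_pos
    have hr1 : r ≤ 1 := min_le_right _ _
    let G : E2 → ℝ := fun x => g x + r * (‖fderiv ℝ g x‖ + K1.indicator (fun _ => ω) x)
    have hindi : Integrable (K1.indicator (fun _ => ω)) volume :=
      (integrable_indicator_iff hK1m).mpr (integrableOn_const hK1c.measure_lt_top.ne)
    have hGi : Integrable G := hgi.add ((hDi.add hindi).const_mul r)
    have hGint : ∫ x, G x = (∫ x, g x) + r * ((∫ x, ‖fderiv ℝ g x‖) + ω * volume.real K1) := by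
      have e1 : ∫ x, G x = (∫ x, g x) + ∫ x, r * (‖fderiv ℝ g x‖ + K1.indicator (fun _ => ω) x) :=
        integral_add hgi ((hDi.add hindi).const_mul r)
      rw [e1, integral_const_mul, integral_add hDi hindi,
        integral_indicator hK1m, setIntegral_const, smul_eq_mul, mul_comm ω]
    have hG0 : ∀ x, 0 ≤ G x := by
      intro x
      have : 0 ≤ K1.indicator (fun _ => ω) x := Set.indicator_nonneg (fun _ _ => hω.le) _
      have := hg0 x
      positivity
    have hgG : ∀ x, g x ≤ G x := by
      intro x
      have : 0 ≤ K1.indicator (fun _ => ω) x := Set.indicator_nonneg (fun _ _ => hω.le) _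
      have : 0 ≤ r * (‖fderiv ℝ g x‖ + K1.indicator (fun _ => ω) x) := by positivity
      simp only [G]; linarith
    have hthick : ∀ s ≥ 0, thickening r {x | s < g x} ⊆ {x | s < G x} := by
      intro s hs x hx
      rw [mem_thickening_iff] at hx
      obtain ⟨y, hy, hxy⟩ := hx
      have hy' : s < g y := hy
      have hyt : y ∈ tsupport g := subset_tsupport _ (by rw [Function.mem_support]; linarith)
      have hxK : x ∈ K1 := by
        apply mem_cthickening_of_dist_le x y 1 _ hyt
        linarith
      have hmv : ‖g y - g x‖ ≤ (‖fderiv ℝ g x‖ + ω) * ‖y - x‖ := by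
        apply (convex_ball x r).norm_image_sub_le_of_norm_fderiv_le (𝕜 := ℝ)
          (fun z _ => (hg.differentiable (by norm_num)).differentiableAt) _ (mem_ball_self hrp)
          (by rw [mem_ball, dist_comm]; exact hxy)
        intro z hz
        have h1 : dist (fderiv ℝ g z) (fderiv ℝ g x) < ω := hr (lt_of_lt_of_le hz (min_le_left _ _))
        rw [dist_eq_norm] at h1
        calc ‖fderiv ℝ g z‖ = ‖fderiv ℝ g x + (fderiv ℝ g z - fderiv ℝ g x)‖ := by congr 1; abel
          _ ≤ _ := (norm_add_le _ _).trans (by linarith)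
      have h2 : ‖y - x‖ ≤ r := by rw [← dist_eq_norm, dist_comm]; exact hxy.le
      have h3 : g y - g x ≤ (‖fderiv ℝ g x‖ + ω) * r :=
        (le_abs_self _).trans (hmv.trans (by gcongr))
      show s < G x
      simp only [G, Set.indicator_of_mem hxK]
      linarith
    have hgm : Measurable g := hg.continuous.measurable
    have hbd : ∀ s ≥ 0, IsBounded {x | s < g x} := fun s hs =>
      hgc.isCompact.isBounded.subset (fun x hx => subset_tsupport _ (by
        have : s < g x := hx
        rw [Function.mem_support]; linarith))
    set κ := 2 * √π * r * √(volume.real S)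
    have hκ : 0 ≤ κ := by positivity
    have hlev : ∀ s ∈ Set.Ioi (0:ℝ), volume {x | s < g x} + (Set.Ioo 0 c).indicator (fun _ => ENNReal.ofReal κ) s
        ≤ volume {x | s < G x} := by
      intro s hs
      have hs0 : (0:ℝ) ≤ s := le_of_lt hs
      by_cases hsc : s < c
      · rw [Set.indicator_of_mem (show s ∈ Set.Ioo 0 c from ⟨hs, hsc⟩)]
        refine le_trans ?_ (measure_mono (hthick s hs0))
        have hb := bm3 (measurableSet_lt measurable_const hgm) (hbd s hs0) hrp
        have hf1 := (hbd s hs0).measure_lt_top (μ := volume) |>.ne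
        have hf2 := (hbd s hs0).thickening (δ := r) |>.measure_lt_top (μ := volume) |>.ne
        rw [← ENNReal.ofReal_toReal hf1, ← ENNReal.ofReal_toReal hf2, ← ENNReal.ofReal_add (by positivity) hκ]
        apply ENNReal.ofReal_le_ofReal
        refine le_trans ?_ hb
        change volume.real _ + _ ≤ volume.real _ + _
        have : volume.real S ≤ volume.real {x | s < g x} :=
          measureReal_mono (fun x hx => lt_of_lt_of_le hsc (hS x hx)) hf1
        have h5 : κ ≤ 2 * √π * r * √(volume.real {x | s < g x}) := by
          simp only [κ]; gcongr
        exact add_le_add le_rfl h5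
      · rw [Set.indicator_of_notMem (fun h : s ∈ Set.Ioo 0 c => hsc h.2), add_zero]
        exact measure_mono (fun x hx => lt_of_lt_of_le hx (hgG x))
    have h1 : ENNReal.ofReal ((∫ x, g x) + c * κ) ≤ ENNReal.ofReal (∫ x, G x) := by
      rw [ENNReal.ofReal_add (integral_nonneg hg0) (by positivity),
        ofReal_integral_eq_lintegral_ofReal hgi (Eventually.of_forall hg0),
        ofReal_integral_eq_lintegral_ofReal hGi (Eventually.of_forall hG0),
        lintegral_eq_lintegral_meas_lt volume (Eventually.of_forall hg0) hgm.aemeasurable,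
        lintegral_eq_lintegral_meas_lt volume (Eventually.of_forall hG0) hGi.1.aemeasurable]
      refine le_trans ?_ (setLIntegral_mono' measurableSet_Ioi hlev)
      rw [lintegral_add_right _ (by measurability)]
      gcongr
      rw [lintegral_indicator measurableSet_Ioo, Measure.restrict_restrict measurableSet_Ioo,
        Set.inter_eq_left.mpr (fun x hx => hx.1), setLIntegral_const, Real.volume_Ioo, sub_zero,
        mul_comm c, ENNReal.ofReal_mul hκ]
    rw [ENNReal.ofReal_le_ofReal_iff (integral_nonneg hG0), hGint] at h1
    have h2 : r * (2 * √π * c * √(volume.real S)) ≤ r * ((∫ x, ‖fderiv ℝ g x‖) + ω * volume.real K1) := by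
      have : c * κ = r * (2 * √π * c * √(volume.real S)) := by simp only [κ]; ring
      linarith
    exact le_of_mul_le_mul_left h2 hrp
  by_contra hcon
  push Not at hcon
  set V := volume.real K1
  have hV : 0 ≤ V := measureReal_nonneg
  have := main ((2 * √π * c * √(volume.real S) - ∫ x, ‖fderiv ℝ g x‖) / (2 * (V + 1))) (by
    apply div_pos (by linarith) (by positivity))
  set q := 2 * √π * c * √(volume.real S)
  set I := ∫ x, ‖fderiv ℝ g x‖
  have h2 : (q - I) / (2 * (V + 1)) * V ≤ (q - I) / 2 := by
    rw [div_mul_eq_mul_div, div_le_div_iff₀ (by positivity) (by norm_num)]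
    nlinarith
  linarith
end

section
lemma ext_c1 {D K : Set E2} (hD : IsOpen D) (hK : IsCompact K) (hKD : K ⊆ D) {X : E2 → ℝ} {n : WithTop ℕ∞}
    (hX : ContDiffOn ℝ n X D) (hX0 : ∀ x ∈ D, x ∉ K → X x = 0) :
    ContDiff ℝ n (D.indicator X) ∧ HasCompactSupport (D.indicator X) ∧
      (∀ x ∈ D, fderiv ℝ (D.indicator X) x = fderiv ℝ X x) ∧
      (∀ x, x ∉ D → fderiv ℝ (D.indicator X) x = 0) := by
  have h0 : ∀ x, x ∉ K → D.indicator X x = 0 := by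
    intro x hx
    by_cases hxD : x ∈ D
    · rw [Set.indicator_of_mem hxD]; exact hX0 x hxD hx
    · rw [Set.indicator_of_notMem hxD]
  have e1 : ∀ x ∈ D, D.indicator X =ᶠ[𝓝 x] X := by
    intro x hx
    filter_upwards [hD.mem_nhds hx] with y hy
    exact Set.indicator_of_mem hy X
  have e2 : ∀ x, x ∉ K → D.indicator X =ᶠ[𝓝 x] fun _ => 0 := by
    intro x hx
    filter_upwards [hK.isClosed.isOpen_compl.mem_nhds hx] with y hy
    exact h0 y hy
  refine ⟨?_, HasCompactSupport.intro hK h0, fun x hx => (e1 x hx).fderiv_eq, ?_⟩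
  · rw [contDiff_iff_contDiffAt]
    intro x
    by_cases hx : x ∈ D
    · exact (hX.contDiffAt (hD.mem_nhds hx)).congr_of_eventuallyEq (e1 x hx)
    · exact contDiffAt_const.congr_of_eventuallyEq (e2 x (fun h => hx (hKD h)))
  · intro x hx
    rw [(e2 x (fun h => hx (hKD h))).fderiv_eq]; simp

lemma intOn_of_supp {D K : Set E2} (hD : IsOpen D) (hK : IsCompact K) (hKD : K ⊆ D) {X : E2 → ℝ}
    (hX : ContinuousOn X D) (hX0 : ∀ x ∈ D, x ∉ K → X x = 0) : IntegrableOn X D := by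
  have h1 : IntegrableOn X K := (hX.mono hKD).integrableOn_compact hK
  have := h1.integrable_indicator hK.measurableSet
  refine this.integrableOn.congr_fun ?_ hD.measurableSet
  intro x hx
  by_cases hxK : x ∈ K
  · simp [hxK]
  · simp [hxK, hX0 x hx hxK]

lemma divg_zero0 {Y : E2 → ℝ} (hY : ContDiff ℝ 1 Y) (hYc : HasCompactSupport Y) (v : E2) :
    ∫ x, fderiv ℝ Y x v = 0 := by
  have hc : Continuous (fun x => fderiv ℝ Y x v) := (hY.continuous_fderiv (by norm_num)).clm_apply continuous_const
  have hs : HasCompactSupport (fun x => fderiv ℝ Y x v) := hYc.fderiv_apply (𝕜 := ℝ) v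
  have := integral_mul_fderiv_eq_neg_fderiv_mul_of_integrable (μ := volume) (f := fun _ : E2 => (1:ℝ)) (g := Y) (v := v)
    (by simp) (by simpa using hc.integrable_of_hasCompactSupport hs)
    (by simpa using hY.continuous.integrable_of_hasCompactSupport hYc)
    (fun x _ => by fun_prop) (fun x _ => (hY.differentiable (by norm_num)).differentiableAt)
  simpa using this

lemma divg_zero {D K : Set E2} (hD : IsOpen D) (hK : IsCompact K) (hKD : K ⊆ D) {X : E2 → ℝ}
    (hX : ContDiffOn ℝ 1 X D) (hX0 : ∀ x ∈ D, x ∉ K → X x = 0) (v : E2) :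
    ∫ x in D, fderiv ℝ X x v = 0 := by
  obtain ⟨h1, h2, h3, h4⟩ := ext_c1 hD hK hKD hX hX0
  rw [← divg_zero0 h1 h2 v, ← integral_indicator hD.measurableSet]
  congr 1; ext x
  by_cases hx : x ∈ D
  · rw [Set.indicator_of_mem hx, h3 x hx]
  · rw [Set.indicator_of_notMem hx, h4 x hx]; simp

/-- basis vector -/
abbrev bv (i : Fin 2) : E2 := EuclideanSpace.single i 1

/-- squared gradient -/
def gsq (u : E2 → ℝ) (x : E2) : ℝ := ∑ i : Fin 2, (fderiv ℝ u x (bv i)) ^ 2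

lemma norm_fderiv_sq_le (u : E2 → ℝ) (x : E2) : ‖fderiv ℝ u x‖ ≤ √(gsq u x) := by
  apply ContinuousLinearMap.opNorm_le_bound _ (by positivity)
  intro z
  have hz : z = z 0 • bv 0 + z 1 • bv 1 := by
    ext i; fin_cases i <;> simp [bv]
  have h1 : fderiv ℝ u x z = z 0 * fderiv ℝ u x (bv 0) + z 1 * fderiv ℝ u x (bv 1) := by
    conv_lhs => rw [hz]
    simp only [map_add, map_smul, smul_eq_mul]
  rw [h1, Real.norm_eq_abs, EuclideanSpace.norm_eq, ← Real.sqrt_mul (by unfold gsq; positivity)]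
  apply Real.abs_le_sqrt
  simp only [gsq, Fin.sum_univ_two, Real.norm_eq_abs, sq_abs]
  nlinarith [sq_nonneg (z 0 * fderiv ℝ u x (bv 1) - z 1 * fderiv ℝ u x (bv 0))]

lemma c1_partial {D : Set E2} (hD : IsOpen D) {u : E2 → ℝ} (hu : ContDiffOn ℝ 2 u D) (v : E2) :
    ContDiffOn ℝ 1 (fun x => fderiv ℝ u x v) D :=
  (hu.fderiv_of_isOpen hD (m := 1) (by norm_num)).clm_apply contDiffOn_const

lemma cont_gsq {D : Set E2} (hD : IsOpen D) {u : E2 → ℝ} (hu : ContDiffOn ℝ 2 u D) :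
    ContinuousOn (gsq u) D := by
  unfold gsq
  exact continuousOn_finsetSum _ fun i _ => ((c1_partial hD hu (bv i)).continuousOn).pow 2

lemma cont_lap {D : Set E2} (hD : IsOpen D) {u : E2 → ℝ} (hu : ContDiffOn ℝ 2 u D) :
    ContinuousOn (lap u) D := by
  unfold lap
  refine continuousOn_finsetSum _ fun i _ => ?_
  exact ((c1_partial hD hu (bv i)).continuousOn_fderiv_of_isOpen hD (by norm_num)).clm_apply continuousOn_const

/-- Green formula with test function `χ(u) ψ`. -/
lemma green {D : Set E2} (hD : IsOpen D) {u : E2 → ℝ} (hu : ContDiffOn ℝ 2 u D) {t : ℝ}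
    (hK : IsCompact {x | x ∈ D ∧ t ≤ u x}) {χ : ℝ → ℝ} (hχ : ContDiff ℝ 1 χ) (hχ0 : ∀ s ≤ t, χ s = 0)
    {ψ : E2 → ℝ} (hψ : ContDiff ℝ 1 ψ) :
    ∫ x in D, χ (u x) * ψ x * (-lap u x) =
      (∫ x in D, deriv χ (u x) * gsq u x * ψ x) +
        ∫ x in D, χ (u x) * (∑ i : Fin 2, fderiv ℝ u x (bv i) * fderiv ℝ ψ x (bv i)) := by
  set K := {x | x ∈ D ∧ t ≤ u x} with hKdef
  have hKD : K ⊆ D := fun x hx => hx.1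
  have hoff : ∀ x ∈ D, x ∉ K → u x < t := by
    intro x hx hxK; by_contra h; exact hxK ⟨hx, not_lt.mp h⟩
  have hχd0 : ∀ s < t, deriv χ s = 0 := by
    intro s hs
    have : χ =ᶠ[𝓝 s] fun _ => 0 := by
      filter_upwards [Iio_mem_nhds hs] with y hy using hχ0 y (le_of_lt hy)
    rw [this.deriv_eq]; simp
  have hcu : ContinuousOn u D := hu.continuousOn
  have hcχ : ContinuousOn (fun x => χ (u x)) D := hχ.continuous.comp_continuousOn hcu
  have hcχ' : ContinuousOn (fun x => deriv χ (u x)) D :=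
    (hχ.continuous_deriv (by norm_num)).comp_continuousOn hcu
  have hcψ : ContinuousOn ψ D := hψ.continuous.continuousOn
  have hcψ' : ∀ i, ContinuousOn (fun x => fderiv ℝ ψ x (bv i)) D := fun i =>
    ((hψ.continuous_fderiv (by norm_num)).clm_apply continuous_const).continuousOn
  have hcu' : ∀ i, ContinuousOn (fun x => fderiv ℝ u x (bv i)) D := fun i =>
    (c1_partial hD hu (bv i)).continuousOn
  have hcl := cont_lap hD hu
  have hcg := cont_gsq hD hu
  let X : Fin 2 → E2 → ℝ := fun i x => χ (u x) * ψ x * fderiv ℝ u x (bv i)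
  have hX : ∀ i, ContDiffOn ℝ 1 (X i) D := fun i =>
    ((hχ.comp_contDiffOn (hu.of_le (by norm_num))).mul hψ.contDiffOn).mul (c1_partial hD hu (bv i))
  have hX0 : ∀ i, ∀ x ∈ D, x ∉ K → X i x = 0 := by
    intro i x hx hxK; simp [X, hχ0 _ (hoff x hx hxK).le]
  have hder : ∀ i, ∀ x ∈ D, fderiv ℝ (X i) x (bv i) =
      deriv χ (u x) * (fderiv ℝ u x (bv i)) ^ 2 * ψ x + χ (u x) * (fderiv ℝ u x (bv i) * fderiv ℝ ψ x (bv i))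
        + χ (u x) * ψ x * fderiv ℝ (fun y => fderiv ℝ u y (bv i)) x (bv i) := by
    intro i x hx
    have d1 : HasFDerivAt u (fderiv ℝ u x) x :=
      ((hu.differentiableOn (by norm_num)).differentiableAt (hD.mem_nhds hx)).hasFDerivAt
    have d2 : HasFDerivAt (fun y => fderiv ℝ u y (bv i)) (fderiv ℝ (fun y => fderiv ℝ u y (bv i)) x) x :=
      (((c1_partial hD hu (bv i)).differentiableOn (by norm_num)).differentiableAt (hD.mem_nhds hx)).hasFDerivAt
    have d3 : HasFDerivAt ψ (fderiv ℝ ψ x) x := ((hψ.differentiable (by norm_num)) x).hasFDerivAt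
    have d4 : HasDerivAt χ (deriv χ (u x)) (u x) := ((hχ.differentiable (by norm_num)) (u x)).hasDerivAt
    have d5 := d4.comp_hasFDerivAt x d1
    have := (d5.mul d3).mul d2
    rw [show X i = (χ ∘ u * ψ) * fun y => fderiv ℝ u y (bv i) from rfl, this.fderiv]
    simp only [add_apply, smul_apply, smul_eq_mul, Function.comp,
      Pi.mul_apply]
    ring
  have i1 : IntegrableOn (fun x => χ (u x) * ψ x * (-lap u x)) D :=
    intOn_of_supp hD hK hKD ((hcχ.mul hcψ).mul hcl.neg)
      (by intro x hx hxK; simp [hχ0 _ (hoff x hx hxK).le])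
  have i2 : IntegrableOn (fun x => deriv χ (u x) * gsq u x * ψ x) D :=
    intOn_of_supp hD hK hKD ((hcχ'.mul hcg).mul hcψ)
      (by intro x hx hxK; simp [hχd0 _ (hoff x hx hxK)])
  have i3 : IntegrableOn (fun x => χ (u x) * (∑ i : Fin 2, fderiv ℝ u x (bv i) * fderiv ℝ ψ x (bv i))) D :=
    intOn_of_supp hD hK hKD (hcχ.mul (continuousOn_finsetSum _ fun i _ => (hcu' i).mul (hcψ' i)))
      (by intro x hx hxK; simp [hχ0 _ (hoff x hx hxK).le])
  have iX : ∀ i, IntegrableOn (fun x => fderiv ℝ (X i) x (bv i)) D := fun i => by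
    refine intOn_of_supp hD hK hKD
      (((hX i).continuousOn_fderiv_of_isOpen hD (by norm_num)).clm_apply continuousOn_const) ?_
    intro x hx hxK
    rw [hder i x hx]; simp [hχ0 _ (hoff x hx hxK).le, hχd0 _ (hoff x hx hxK)]
  have hsum : ∫ x in D, (deriv χ (u x) * gsq u x * ψ x +
      χ (u x) * (∑ i : Fin 2, fderiv ℝ u x (bv i) * fderiv ℝ ψ x (bv i))) - χ (u x) * ψ x * (-lap u x) = 0 := by
    have e : ∀ x ∈ D, (deriv χ (u x) * gsq u x * ψ x +
      χ (u x) * (∑ i : Fin 2, fderiv ℝ u x (bv i) * fderiv ℝ ψ x (bv i))) - χ (u x) * ψ x * (-lap u x)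
      = fderiv ℝ (X 0) x (bv 0) + fderiv ℝ (X 1) x (bv 1) := by
      intro x hx
      rw [hder 0 x hx, hder 1 x hx]
      simp only [gsq, lap, Fin.sum_univ_two]
      ring
    rw [setIntegral_congr_fun hD.measurableSet e, integral_add (iX 0) (iX 1),
      divg_zero hD hK hKD (hX 0) (hX0 0), divg_zero hD hK hKD (hX 1) (hX0 1), add_zero]
  rw [integral_sub (by exact i2.add i3) i1, integral_add i2 i3] at hsum
  linarith
end

section
/-- Standing assumptions for level set arguments. -/
structure LES (D : Set E2) (u : E2 → ℝ) (p t0 M : ℝ) : Prop where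
  op : IsOpen D
  bdd : IsBounded D
  c2 : ContDiffOn ℝ 2 u D
  cpt : ∀ t > t0, IsCompact {x | x ∈ D ∧ t ≤ u x}
  eqn : ∀ x ∈ D, t0 < u x → -lap u x = (u x) ^ p
  t0nn : 0 ≤ t0
  hp : 1 < p
  leM : ∀ x ∈ D, u x ≤ M

/-- superlevel set -/
def sl (D : Set E2) (u : E2 → ℝ) (t : ℝ) : Set E2 := {x | x ∈ D ∧ t < u x}

/-- distribution function -/
def mu (D : Set E2) (u : E2 → ℝ) (t : ℝ) : ℝ := volume.real (sl D u t)

/-- mass of superlevel sets -/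
def mm (D : Set E2) (u : E2 → ℝ) (p t : ℝ) : ℝ := ∫ x in sl D u t, (u x) ^ p

lemma LES.isOpen_sl {D : Set E2} {u : E2 → ℝ} {p t0 M : ℝ} (H : LES D u p t0 M) (t : ℝ) : IsOpen (sl D u t) :=
  H.c2.continuousOn.isOpen_inter_preimage H.op isOpen_Ioi

lemma LES.fin_sl {D : Set E2} {u : E2 → ℝ} {p t0 M : ℝ} (H : LES D u p t0 M) (t : ℝ) : volume (sl D u t) ≠ ⊤ :=
  (H.bdd.subset (fun _ hx => hx.1)).measure_lt_top.ne

lemma sl_anti (D : Set E2) (u : E2 → ℝ) {s t : ℝ} (h : s ≤ t) : sl D u t ⊆ sl D u s :=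
  fun _ hx => ⟨hx.1, lt_of_le_of_lt h hx.2⟩

/-- powers are integrable on nonnegative superlevel sets -/
lemma LES.intpow {D : Set E2} {u : E2 → ℝ} {p t0 M : ℝ} (H : LES D u p t0 M) {t : ℝ} (ht : 0 ≤ t) {q : ℝ} (hq : 0 ≤ q) :
    IntegrableOn (fun x => (u x) ^ q) (sl D u t) := by
  refine IntegrableOn.of_bound (H.fin_sl t).lt_top ?_ (M ^ q) ?_
  · have hc : ContinuousOn (fun x => (u x) ^ q) (sl D u t) :=
      (H.c2.continuousOn.mono (fun x hx => hx.1)).rpow_const (fun x hx => Or.inr hq)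
    exact hc.aestronglyMeasurable (H.isOpen_sl t).measurableSet
  · refine (ae_restrict_mem (H.isOpen_sl t).measurableSet).mono ?_
    intro x hx
    have h0 : 0 ≤ u x := ht.trans hx.2.le
    rw [Real.norm_eq_abs, abs_of_nonneg (by positivity)]
    exact Real.rpow_le_rpow h0 (H.leM x hx.1) hq

lemma sq_le_amgm {I G P : ℝ} (hI : 0 ≤ I) (hG : 0 ≤ G) (hP : 0 ≤ P) (h : ∀ l > 0, 2 * I ≤ l * G + P / l) :
    I ^ 2 ≤ G * P := by
  rcases hI.eq_or_lt with rfl | hI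
  · simpa using mul_nonneg hG hP
  rcases hG.eq_or_lt with rfl | hG
  · exfalso
    have := h ((P + 1) / I) (by positivity)
    have h2 : P / ((P + 1) / I) ≤ I := by
      rw [div_div_eq_mul_div, div_le_iff₀ (by positivity)]; nlinarith
    linarith
  · have := h (I / G) (by positivity)
    have e1 : I / G * G = I := by field_simp
    have e2 : P / (I / G) = G * P / I := by field_simp
    rw [e1, e2] at this
    have h3 : I ≤ G * P / I := by linarith
    rw [le_div_iff₀ hI] at h3
    nlinarith

/-- trapezoid -/
def trap (t h η r : ℝ) : ℝ := max 0 (min 1 (min ((r - t) / η) ((t + h - r) / η)))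

lemma trap_cont (t h η : ℝ) : Continuous (trap t h η) := by unfold trap; fun_prop

lemma trap_nonneg (t h η r : ℝ) : 0 ≤ trap t h η r := le_max_left _ _

lemma trap_le_one (t h η r : ℝ) : trap t h η r ≤ 1 := max_le zero_le_one (min_le_left _ _)

lemma trap_left {t h η r : ℝ} (hη : 0 < η) (hr : r ≤ t) : trap t h η r = 0 := by
  refine max_eq_left ((min_le_right _ _).trans ((min_le_left _ _).trans ?_))
  exact div_nonpos_of_nonpos_of_nonneg (by linarith) hη.le

lemma trap_right {t h η r : ℝ} (hη : 0 < η) (hr : t + h ≤ r) : trap t h η r = 0 := by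
  refine max_eq_left ((min_le_right _ _).trans ((min_le_right _ _).trans ?_))
  exact div_nonpos_of_nonpos_of_nonneg (by linarith) hη.le

lemma trap_mid {t h η r : ℝ} (hη : 0 < η) (h1 : t + η ≤ r) (h2 : r ≤ t + h - η) : trap t h η r = 1 := by
  unfold trap
  rw [min_eq_left, max_eq_right zero_le_one]
  refine le_min ?_ ?_ <;> rw [le_div_iff₀ hη] <;> linarith

/-- primitive of the trapezoid -/
def tphi (t h η s : ℝ) : ℝ := ∫ r in t..s, trap t h η r

lemma tphi_deriv (t h η s : ℝ) : HasDerivAt (tphi t h η) (trap t h η s) s :=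
  intervalIntegral.integral_hasDerivAt_right ((trap_cont t h η).intervalIntegrable _ _)
    ((trap_cont t h η).stronglyMeasurableAtFilter _ _) (trap_cont t h η).continuousAt

lemma tphi_c1 (t h η : ℝ) : ContDiff ℝ 1 (tphi t h η) := by
  rw [contDiff_one_iff_deriv]
  refine ⟨fun s => (tphi_deriv t h η s).differentiableAt, ?_⟩
  rw [show deriv (tphi t h η) = trap t h η from funext fun s => (tphi_deriv t h η s).deriv]
  exact trap_cont t h η

lemma tphi_mono (t h η : ℝ) : Monotone (tphi t h η) :=
  monotone_of_deriv_nonneg (fun s => (tphi_deriv t h η s).differentiableAt)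
    (fun s => by rw [(tphi_deriv t h η s).deriv]; exact trap_nonneg t h η s)

lemma tphi_left {t h η s : ℝ} (hη : 0 < η) (hs : s ≤ t) : tphi t h η s = 0 := by
  unfold tphi
  rw [intervalIntegral.integral_congr (g := fun _ => 0)]
  · simp
  · intro r hr
    rw [Set.uIcc_of_ge hs] at hr
    exact trap_left hη hr.2

lemma tphi_right {t h η s : ℝ} (hη : 0 < η) (hs : t + h ≤ s) : tphi t h η s = tphi t h η (t + h) := by
  unfold tphi
  rw [← intervalIntegral.integral_add_adjacent_intervals (b := t + h) ((trap_cont t h η).intervalIntegrable _ _)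
    ((trap_cont t h η).intervalIntegrable _ _), add_eq_left]
  rw [intervalIntegral.integral_congr (g := fun _ => 0)]
  · simp
  · intro r hr
    rw [Set.uIcc_of_le hs] at hr
    exact trap_right hη hr.1

lemma tphi_nonneg {t h η : ℝ} (hη : 0 < η) (s : ℝ) : 0 ≤ tphi t h η s := by
  rcases le_total s t with hs | hs
  · rw [tphi_left hη hs]
  · rw [← tphi_left (h := h) hη (le_refl t)]; exact tphi_mono t h η hs

lemma tphi_le {t h η : ℝ} (hh : 0 ≤ h) (hη : 0 < η) (s : ℝ) : tphi t h η s ≤ h := by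
  have h1 : tphi t h η (t + h) ≤ h := by
    unfold tphi
    calc _ ≤ ∫ r in t..(t+h), (1:ℝ) := intervalIntegral.integral_mono_on (by linarith)
          ((trap_cont t h η).intervalIntegrable _ _) (by simp) (fun r _ => trap_le_one t h η r)
      _ = h := by simp
  rcases le_total s (t + h) with hs | hs
  · exact (tphi_mono t h η hs).trans h1
  · rw [tphi_right hη hs]; exact h1

lemma tphi_ge {t h η s : ℝ} (hη : 0 < η) (hηh : 2 * η < h) (hs : t + h ≤ s) : h - 2 * η ≤ tphi t h η s := by
  have h0 : tphi t h η (t + h - η) ≤ tphi t h η s := tphi_mono t h η (by linarith)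
  refine le_trans ?_ h0
  have h1 : tphi t h η (t + h - η) = tphi t h η (t + η) + ∫ r in (t+η)..(t+h-η), trap t h η r := by
    unfold tphi
    rw [intervalIntegral.integral_add_adjacent_intervals ((trap_cont t h η).intervalIntegrable _ _)
      ((trap_cont t h η).intervalIntegrable _ _)]
  rw [h1, intervalIntegral.integral_congr (g := fun _ => 1)]
  · have := tphi_nonneg (t := t) (h := h) hη (t + η)
    simp only [intervalIntegral.integral_const, smul_eq_mul, mul_one]; linarith
  · intro r hr
    rw [Set.uIcc_of_le (by linarith)] at hr
    exact trap_mid hη hr.1 hr.2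

lemma levelA0 {D : Set E2} {u : E2 → ℝ} {p t0 M : ℝ} (H : LES D u p t0 M) {t h η : ℝ} (ht : t0 < t) (hη : 0 < η)
    (hηh : 2 * η < h) :
    4 * π * (h - 2 * η) ^ 2 * mu D u (t + h) ≤ h * mm D u p t * (mu D u t - mu D u (t + h)) := by
  have hh : 0 < h := by linarith
  have ht0 : 0 < t := lt_of_le_of_lt H.t0nn ht
  set Φ := tphi t h η
  set ψ := trap t h η
  set K := {x | x ∈ D ∧ t ≤ u x} with hKdef
  have hK : IsCompact K := H.cpt t ht
  have hKD : K ⊆ D := fun x hx => hx.1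
  have hoff : ∀ x ∈ D, x ∉ K → u x < t := by
    intro x hx hxK; by_contra hc; exact hxK ⟨hx, not_lt.mp hc⟩
  have hcu := H.c2.continuousOn
  have hX : ContDiffOn ℝ 1 (fun x => Φ (u x)) D := (tphi_c1 t h η).comp_contDiffOn (H.c2.of_le (by norm_num))
  obtain ⟨g1, g2, g3, g4⟩ := ext_c1 H.op hK hKD hX (fun x hx hxK => tphi_left hη (hoff x hx hxK).le)
  set g := D.indicator (fun x => Φ (u x)) with hg
  have hcψ : ContinuousOn (fun x => ψ (u x)) D := (trap_cont t h η).comp_continuousOn hcu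
  have iG : IntegrableOn (fun x => ψ (u x) * gsq u x) D :=
    intOn_of_supp H.op hK hKD (hcψ.mul (cont_gsq H.op H.c2))
      (by intro x hx hxK; simp [ψ, trap_left hη (hoff x hx hxK).le])
  have iP : IntegrableOn (fun x => ψ (u x)) D :=
    intOn_of_supp H.op hK hKD hcψ (by intro x hx hxK; simp [ψ, trap_left hη (hoff x hx hxK).le])
  have hgs : ∀ x, 0 ≤ gsq u x := fun x => by unfold gsq; positivity
  have iI : IntegrableOn (fun x => ψ (u x) * √(gsq u x)) D :=
    intOn_of_supp H.op hK hKD (hcψ.mul (cont_gsq H.op H.c2).sqrt)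
      (by intro x hx hxK; simp [ψ, trap_left hη (hoff x hx hxK).le])
  -- isoperimetry
  have h1 : 2 * √π * (h - 2 * η) * √(mu D u (t + h)) ≤ ∫ x in D, ψ (u x) * √(gsq u x) := by
    refine (iso_fun g1 g2 ?_ (by linarith : 0 < h - 2 * η) (S := sl D u (t + h)) ?_).trans ?_
    · intro x; exact Set.indicator_nonneg (fun y _ => tphi_nonneg hη _) x
    · intro x hx
      rw [hg, Set.indicator_of_mem hx.1]
      exact tphi_ge hη hηh hx.2.le
    · rw [← integral_indicator H.op.measurableSet]
      refine integral_mono ?_ (iI.integrable_indicator H.op.measurableSet) ?_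
      · exact ((g1.continuous_fderiv (by norm_num)).norm).integrable_of_hasCompactSupport
          ((g2.fderiv (𝕜 := ℝ)).norm)
      · intro x
        by_cases hx : x ∈ D
        · simp only [Set.indicator_of_mem hx]
          rw [g3 x hx]
          have d1 : HasFDerivAt u (fderiv ℝ u x) x :=
            ((H.c2.differentiableOn (by norm_num)).differentiableAt (H.op.mem_nhds hx)).hasFDerivAt
          have := (tphi_deriv t h η (u x)).comp_hasFDerivAt x d1
          rw [show (fun x => Φ (u x)) = tphi t h η ∘ u from rfl, this.fderiv, norm_smul, Real.norm_eq_abs,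
            abs_of_nonneg (trap_nonneg _ _ _ _)]
          exact mul_le_mul_of_nonneg_left (norm_fderiv_sq_le u x) (trap_nonneg _ _ _ _)
        · simp only [Set.indicator_of_notMem hx]
          rw [g4 x hx]; simp
  have hI0 : 0 ≤ ∫ x in D, ψ (u x) * √(gsq u x) :=
    integral_nonneg fun x => mul_nonneg (trap_nonneg _ _ _ _) (Real.sqrt_nonneg _)
  have hG0 : 0 ≤ ∫ x in D, ψ (u x) * gsq u x :=
    integral_nonneg fun x => mul_nonneg (trap_nonneg _ _ _ _) (hgs x)
  have hP0 : 0 ≤ ∫ x in D, ψ (u x) := integral_nonneg fun x => trap_nonneg _ _ _ _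
  have h2 : (∫ x in D, ψ (u x) * √(gsq u x)) ^ 2 ≤ (∫ x in D, ψ (u x) * gsq u x) * ∫ x in D, ψ (u x) := by
    apply sq_le_amgm hI0 hG0 hP0
    intro l hl
    rw [← integral_const_mul, ← integral_const_mul, div_eq_inv_mul, ← integral_const_mul,
      ← integral_add (iG.const_mul l) (iP.const_mul l⁻¹)]
    refine integral_mono (iI.const_mul 2) ((iG.const_mul l).add (iP.const_mul l⁻¹)) ?_
    intro x
    have hs := Real.sq_sqrt (hgs x)
    set q := √(gsq u x)
    change 2 * (ψ (u x) * q) ≤ l * (ψ (u x) * gsq u x) + l⁻¹ * ψ (u x)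
    rw [← hs]
    have hψ0 : 0 ≤ ψ (u x) := trap_nonneg _ _ _ _
    have e : l * (ψ (u x) * q ^ 2) + l⁻¹ * ψ (u x) - 2 * (ψ (u x) * q) = l⁻¹ * ψ (u x) * (l * q - 1) ^ 2 := by
      field_simp; ring
    have : 0 ≤ l⁻¹ * ψ (u x) * (l * q - 1) ^ 2 := by positivity
    linarith
  have hsub : sl D u t ⊆ D := fun x hx => hx.1
  have h3 : (∫ x in D, ψ (u x) * gsq u x) ≤ h * mm D u p t := by
    have hgr := green H.op H.c2 hK (tphi_c1 t h η) (fun s hs => tphi_left hη hs) (ψ := fun _ => 1) contDiff_const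
    simp only [mul_one, fderiv_fun_const, Pi.zero_apply, zero_apply, mul_zero,
      Finset.sum_const_zero, integral_zero, add_zero] at hgr
    have : (∫ x in D, ψ (u x) * gsq u x) = ∫ x in D, deriv (tphi t h η) (u x) * gsq u x := by
      congr 1; ext x; rw [(tphi_deriv t h η _).deriv]
    rw [this, ← hgr]
    unfold mm
    rw [← integral_const_mul, ← integral_indicator H.op.measurableSet, ← integral_indicator (H.isOpen_sl t).measurableSet]
    refine integral_mono ?_ ?_ ?_
    · refine IntegrableOn.integrable_indicator ?_ H.op.measurableSet
      exact intOn_of_supp H.op hK hKD (((tphi_c1 t h η).continuous.comp_continuousOn hcu).mul (cont_lap H.op H.c2).neg)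
        (by intro x hx hxK; simp [tphi_left hη (hoff x hx hxK).le])
    · have hip : IntegrableOn (fun x => h * (u x) ^ p) (sl D u t) :=
        (H.intpow ht0.le (by linarith [H.hp])).const_mul h
      exact hip.integrable_indicator (H.isOpen_sl t).measurableSet
    · intro x
      by_cases hx : x ∈ D
      · by_cases hxt : t < u x
        · have hxs : x ∈ sl D u t := ⟨hx, hxt⟩
          simp only [Set.indicator_of_mem hx, Set.indicator_of_mem hxs]
          rw [H.eqn x hx (ht.trans hxt)]
          exact mul_le_mul_of_nonneg_right (tphi_le hh.le hη _) (Real.rpow_nonneg (ht0.trans hxt).le _)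
        · have hxs : x ∉ sl D u t := fun h' => hxt h'.2
          simp only [Set.indicator_of_mem hx, Set.indicator_of_notMem hxs]
          rw [tphi_left hη (not_lt.mp hxt)]; simp
      · have hxs : x ∉ sl D u t := fun h' => hx h'.1
        simp only [Set.indicator_of_notMem hx, Set.indicator_of_notMem hxs]; exact le_rfl
  have h4 : (∫ x in D, ψ (u x)) ≤ mu D u t - mu D u (t + h) := by
    unfold mu
    rw [← measureReal_sdiff (sl_anti D u (by linarith)) (H.isOpen_sl _).measurableSet (H.fin_sl _)]
    have hm : MeasurableSet (sl D u t \ sl D u (t + h)) := (H.isOpen_sl _).measurableSet.diff (H.isOpen_sl _).measurableSet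
    rw [← integral_indicator_one hm, ← integral_indicator H.op.measurableSet]
    refine integral_mono (iP.integrable_indicator H.op.measurableSet) ?_ ?_
    · refine (integrable_indicator_iff hm).mpr ?_
      exact integrableOn_const (((measure_mono Set.sdiff_subset).trans_lt (H.fin_sl t).lt_top).ne)
    · intro x
      by_cases hx : x ∈ D
      · rw [Set.indicator_of_mem hx]
        by_cases hxt : x ∈ sl D u t \ sl D u (t + h)
        · rw [Set.indicator_of_mem hxt]; exact trap_le_one _ _ _ _
        · rw [Set.indicator_of_notMem hxt]
          by_cases hxs : t < u x
          · have : t + h < u x := by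
              by_contra hc; exact hxt ⟨⟨hx, hxs⟩, fun h' => hc h'.2⟩
            exact (trap_right hη this.le).le
          · exact (trap_left hη (not_lt.mp hxs)).le
      · rw [Set.indicator_of_notMem hx]
        exact Set.indicator_nonneg (fun _ _ => zero_le_one) x
  have h5 : (2 * √π * (h - 2 * η) * √(mu D u (t + h))) ^ 2 ≤ (∫ x in D, ψ (u x) * √(gsq u x)) ^ 2 := by
    have : 0 ≤ h - 2 * η := by linarith
    exact pow_le_pow_left₀ (by positivity) h1 2
  have h6 : (2 * √π * (h - 2 * η) * √(mu D u (t + h))) ^ 2 = 4 * π * (h - 2 * η) ^ 2 * mu D u (t + h) := by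
    rw [mul_pow, mul_pow, mul_pow, Real.sq_sqrt Real.pi_pos.le, Real.sq_sqrt (show 0 ≤ mu D u (t + h) from measureReal_nonneg)]; ring
  rw [h6] at h5
  refine h5.trans (h2.trans ?_)
  exact mul_le_mul h3 h4 hP0 (hG0.trans h3)

lemma levelA {D : Set E2} {u : E2 → ℝ} {p t0 M : ℝ} (H : LES D u p t0 M) {t h : ℝ} (ht : t0 < t) (hh : 0 < h) :
    4 * π * h * mu D u (t + h) ≤ mm D u p t * (mu D u t - mu D u (t + h)) := by
  have key : 4 * π * (h - 2 * 0) ^ 2 * mu D u (t + h) ≤ h * mm D u p t * (mu D u t - mu D u (t + h)) := by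
    have hc : Continuous fun η : ℝ => 4 * π * (h - 2 * η) ^ 2 * mu D u (t + h) := by fun_prop
    refine le_of_tendsto (x := 𝓝[>] (0:ℝ)) ((hc.tendsto 0).mono_left nhdsWithin_le_nhds) ?_
    filter_upwards [Ioo_mem_nhdsGT (show (0:ℝ) < h / 2 by linarith)] with η hη
    exact levelA0 H ht hη.1 (by linarith [hη.2])
  refine le_of_mul_le_mul_left ?_ hh
  nlinarith [key]
end

section
lemma mono_int {f g : ℝ → ℝ} {a b : ℝ} (hab : a ≤ b) (hf : MonotoneOn f (Set.Icc a b))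
    (hg : IntervalIntegrable g volume a b)
    (h : ∀ᵐ τ, τ ∈ Set.Ioo a b → ∀ d, HasDerivAt f d τ → g τ ≤ d) :
    ∫ τ in a..b, g τ ≤ f b - f a := by
  have hf' : MonotoneOn f (Set.uIcc a b) := by rwa [Set.uIcc_of_le hab]
  have h1 := hf'.intervalIntegral_deriv_mem_uIcc
  have hfab : f a ≤ f b := hf (by simp [hab]) (by simp [hab]) hab
  rw [Set.uIcc_of_le (by linarith)] at h1
  refine le_trans ?_ h1.2
  refine intervalIntegral.integral_mono_ae_restrict hab hg hf'.intervalIntegrable_deriv ?_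
  have h2 := hf.ae_differentiableWithinAt measurableSet_Icc
  rw [ae_restrict_iff' measurableSet_Icc] at h2
  have h3 : ∀ᵐ τ : ℝ, τ ≠ a := by simp [ae_iff]
  have h4 : ∀ᵐ τ : ℝ, τ ≠ b := by simp [ae_iff]
  filter_upwards [ae_restrict_of_ae (s := Set.Icc a b) h2, ae_restrict_of_ae (s := Set.Icc a b) h3, ae_restrict_of_ae (s := Set.Icc a b) h4,
    ae_restrict_of_ae (s := Set.Icc a b) h, ae_restrict_mem measurableSet_Icc] with τ e2 e3 e4 e5 e6
  have hτ : τ ∈ Set.Ioo a b := ⟨lt_of_le_of_ne e6.1 (Ne.symm e3), lt_of_le_of_ne e6.2 e4⟩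
  have hd : DifferentiableAt ℝ f τ := (e2 e6).differentiableAt (Icc_mem_nhds hτ.1 hτ.2)
  exact e5 hτ _ hd.hasDerivAt

section
variable {D : Set E2} {u : E2 → ℝ} {p t0 M : ℝ}

lemma LES.mu_anti (H : LES D u p t0 M) : Antitone (mu D u) := fun s t hst =>
  measureReal_mono (sl_anti D u hst) (H.fin_sl s)

lemma mu_nonneg (t : ℝ) : 0 ≤ mu D u t := measureReal_nonneg

lemma mm_nonneg {t : ℝ} (H : LES D u p t0 M) (ht : 0 ≤ t) : 0 ≤ mm D u p t :=
  setIntegral_nonneg (H.isOpen_sl t).measurableSet fun _ hx => Real.rpow_nonneg (ht.trans hx.2.le) _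

lemma LES.mm_diff (H : LES D u p t0 M) {s t : ℝ} (hs : 0 ≤ s) (hst : s ≤ t) :
    s ^ p * (mu D u s - mu D u t) ≤ mm D u p s - mm D u p t := by
  have hp := H.hp
  have hms := (H.isOpen_sl s).measurableSet
  have hmt := (H.isOpen_sl t).measurableSet
  have h1 : mm D u p s - mm D u p t = ∫ x in sl D u s \ sl D u t, (u x) ^ p := by
    unfold mm
    rw [setIntegral_sdiff hmt (H.intpow hs (by linarith)) (sl_anti D u hst)]
  have h2 : mu D u s - mu D u t = volume.real (sl D u s \ sl D u t) := by
    unfold mu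
    rw [measureReal_sdiff (sl_anti D u hst) hmt (H.fin_sl _)]
  have hfin : volume (sl D u s \ sl D u t) ≠ ⊤ := ((measure_mono Set.sdiff_subset).trans_lt (H.fin_sl s).lt_top).ne
  rw [h1, h2]
  have h3 : s ^ p * volume.real (sl D u s \ sl D u t) = ∫ x in sl D u s \ sl D u t, s ^ p := by
    rw [setIntegral_const, smul_eq_mul, mul_comm]
  rw [h3]
  refine setIntegral_mono_on (integrableOn_const hfin) ((H.intpow hs (by linarith)).mono_set Set.sdiff_subset)
    (hms.diff hmt) ?_
  intro x hx
  exact Real.rpow_le_rpow hs hx.1.2.le (by linarith)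

lemma LES.mm_anti (H : LES D u p t0 M) {s t : ℝ} (hs : 0 ≤ s) (hst : s ≤ t) : mm D u p t ≤ mm D u p s := by
  have h1 := H.mm_diff hs hst
  have h2 := H.mu_anti hst
  have h3 : 0 ≤ s ^ p * (mu D u s - mu D u t) := mul_nonneg (Real.rpow_nonneg hs _) (by linarith)
  linarith

lemma LES.sl_top (H : LES D u p t0 M) {t : ℝ} (ht : M ≤ t) : sl D u t = ∅ := by
  ext x; simp only [sl, Set.mem_ofPred_eq, Set.mem_empty_iff_false, iff_false, not_and, not_lt]
  exact fun hx => (H.leM x hx).trans ht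

lemma LES.mm_ge (H : LES D u p t0 M) {s : ℝ} (hs : 0 ≤ s) : s ^ p * mu D u s ≤ mm D u p s := by
  have h1 := H.mm_diff hs (le_max_left s M)
  have h2 : sl D u (max s M) = ∅ := H.sl_top (le_max_right _ _)
  simpa [mu, mm, h2] using h1

lemma LES.B1 (H : LES D u p t0 M) {s t : ℝ} (hs : t0 < s) (hst : s < t) (hmu : 0 < mu D u t) :
    4 * π * (t - s) ^ 2 ≤ (Real.log (mu D u s) - Real.log (mu D u t)) * ∫ τ in s..t, mm D u p τ := by
  have hs0 : 0 < s := lt_of_le_of_lt H.t0nn hs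
  have hmt : 0 < mm D u p t := lt_of_lt_of_le (mul_pos (Real.rpow_pos_of_pos (hs0.trans hst) p) hmu) (H.mm_ge (hs0.trans hst).le)
  have hanti : AntitoneOn (mm D u p) (Set.uIcc s t) := by
    rw [Set.uIcc_of_le hst.le]
    intro a ha b hb hab
    exact H.mm_anti (hs0.le.trans ha.1) hab
  have hmi : IntervalIntegrable (mm D u p) volume s t := hanti.intervalIntegrable
  set I := ∫ τ in s..t, mm D u p τ with hI
  have hIpos : 0 < I := by
    have : ∫ τ in s..t, mm D u p t ≤ I := by
      refine intervalIntegral.integral_mono_on hst.le (by simp) hmi ?_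
      intro τ hτ
      exact H.mm_anti (hs0.le.trans hτ.1) hτ.2
    simp only [intervalIntegral.integral_const, smul_eq_mul] at this
    nlinarith [mul_pos (sub_pos.mpr hst) hmt]
  have key : ∀ l : ℝ, ∫ τ in s..t, 4 * π * (2 * l - l ^ 2 * mm D u p τ) ≤
      (-Real.log (mu D u t)) - (-Real.log (mu D u s)) := by
    intro l
    refine mono_int (f := fun τ => -Real.log (mu D u τ)) hst.le ?_ ?_ ?_
    · intro a ha b hb hab
      have : 0 < mu D u b := lt_of_lt_of_le hmu (H.mu_anti hb.2)
      exact neg_le_neg (Real.log_le_log this (H.mu_anti hab))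
    · exact ((intervalIntegrable_const).sub (hmi.const_mul _)).const_mul _
    · refine Eventually.of_forall ?_
      intro τ hτ d hd
      have hτ0 : 0 < τ := hs0.trans hτ.1
      have hm : 0 < mm D u p τ := lt_of_lt_of_le hmt (H.mm_anti hτ0.le hτ.2.le)
      have hd1 := hd.tendsto_slope_zero_right
      have hc : Continuous fun h : ℝ => 4 * π * (mm D u p τ + 0) := by fun_prop
      have hlim : Tendsto (fun h : ℝ => 4 * π / (mm D u p τ + 4 * π * h)) (𝓝[>] 0) (𝓝 (4 * π / (mm D u p τ + 4 * π * 0))) := by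
        refine Tendsto.mono_left (ContinuousAt.tendsto ?_) nhdsWithin_le_nhds
        have : mm D u p τ + 4 * π * 0 ≠ 0 := by simpa using hm.ne'
        fun_prop (disch := assumption)
      have hle : 4 * π / (mm D u p τ + 4 * π * 0) ≤ d := by
        refine le_of_tendsto_of_tendsto hlim hd1 ?_
        filter_upwards [Ioo_mem_nhdsGT (show (0:ℝ) < t - τ by linarith [hτ.2])] with h hh
        have hA := levelA H (hs.trans hτ.1) hh.1
        have m1 : 0 < mu D u (τ + h) := lt_of_lt_of_le hmu (H.mu_anti (by linarith [hh.2]))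
        have m2 : mu D u (τ + h) ≤ mu D u τ := H.mu_anti (by linarith [hh.1])
        set a := mu D u τ
        set b := mu D u (τ + h)
        set m := mm D u p τ
        have ha : 0 < a := m1.trans_le m2
        have hl1 : Real.log (b / a) ≤ b / a - 1 := Real.log_le_sub_one_of_pos (by positivity)
        rw [Real.log_div m1.ne' ha.ne'] at hl1
        rw [smul_eq_mul, inv_mul_eq_div, div_le_div_iff₀ (by have := hh.1; positivity) hh.1]
        have h2 : 4 * π * h * a ≤ (a - b) * (m + 4 * π * h) := by nlinarith
        have h3 : 4 * π * h / (m + 4 * π * h) ≤ (a - b) / a := by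
          rw [div_le_div_iff₀ (by have := hh.1; positivity) ha]; exact h2
        have h4 : (a - b) / a = 1 - b / a := by field_simp
        have h5 : 4 * π * h / (m + 4 * π * h) ≤ -Real.log b - -Real.log a := by linarith
        rwa [div_le_iff₀ (by have := hh.1; positivity)] at h5
      refine le_trans ?_ hle
      rw [mul_zero, add_zero, le_div_iff₀ hm]
      have := Real.pi_pos
      nlinarith [sq_nonneg (1 - l * mm D u p τ)]
  have := key ((t - s) / I)
  rw [intervalIntegral.integral_const_mul, intervalIntegral.integral_sub (by simp) (hmi.const_mul _),
    show (∫ τ in s..t, ((t - s) / I) ^ 2 * mm D u p τ) = ((t - s) / I) ^ 2 * I from intervalIntegral.integral_const_mul _ _] at this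
  simp only [intervalIntegral.integral_const, smul_eq_mul] at this
  have e : 4 * π * ((t - s) * (2 * ((t - s) / I)) - ((t - s) / I) ^ 2 * I) = 4 * π * (t - s) ^ 2 / I := by
    field_simp; ring
  rw [e, div_le_iff₀ hIpos] at this
  linarith

lemma LES.C1 (H : LES D u p t0 M) {t : ℝ} (ht : t0 < t) (htM : t ≤ M) :
    4 * π * ∫ τ in t..M, τ ^ p * mu D u τ ≤ (mm D u p t) ^ 2 / 2 := by
  have ht00 : 0 < t := lt_of_le_of_lt H.t0nn ht
  have hmM : mm D u p M = 0 := by simp [mm, H.sl_top le_rfl]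
  have key : ∫ τ in t..M, 4 * π * (τ ^ p * mu D u τ) ≤ (-(mm D u p M) ^ 2 / 2) - (-(mm D u p t) ^ 2 / 2) := by
    refine mono_int (f := fun τ => -(mm D u p τ) ^ 2 / 2) htM ?_ ?_ ?_
    · intro a ha b hb hab
      have h1 := H.mm_anti (ht00.le.trans ha.1) hab
      have h2 := mm_nonneg H (ht00.le.trans hb.1)
      have := pow_le_pow_left₀ h2 h1 2
      dsimp only
      linarith
    · refine IntervalIntegrable.const_mul ?_ _
      refine IntervalIntegrable.continuousOn_mul (H.mu_anti.antitoneOn _).intervalIntegrable ?_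
      intro x hx
      exact (Real.continuousAt_rpow_const x p (Or.inr (by linarith [H.hp]))).continuousWithinAt
    · have hc : ∀ᵐ τ : ℝ, ContinuousAt (mu D u) τ := by
        rw [ae_iff]; exact H.mu_anti.countable_not_continuousAt.measure_zero _
      filter_upwards [hc] with τ hcτ hτ d hd
      have hτ0 : 0 < τ := ht00.trans hτ.1
      have hm0 := mm_nonneg H hτ0.le
      rcases hm0.eq_or_lt with hm | hm
      · have h1 := H.mm_ge hτ0.le
        have h2 : 0 ≤ τ ^ p * mu D u τ := mul_nonneg (Real.rpow_nonneg hτ0.le _) (mu_nonneg _)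
        have h3 : τ ^ p * mu D u τ = 0 := by linarith
        rw [h3, mul_zero]
        have hd1 := hd.tendsto_slope_zero_right
        refine ge_of_tendsto hd1 ?_
        filter_upwards [self_mem_nhdsWithin] with h hh
        have hh' : 0 < h := hh
        have h4 := H.mm_anti hτ0.le (show τ ≤ τ + h by linarith)
        have h5 := mm_nonneg H (show 0 ≤ τ + h by linarith)
        have h6 : mm D u p (τ + h) = 0 := by linarith
        rw [h6, ← hm]; simp
      · have hd1 := hd.tendsto_slope_zero_right
        have hmc : Tendsto (fun h => mm D u p (τ + h)) (𝓝[>] 0) (𝓝 (mm D u p τ)) := by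
          have h1 : Tendsto (fun h : ℝ => -(mm D u p (τ + h)) ^ 2 / 2) (𝓝[>] 0) (𝓝 (-(mm D u p τ) ^ 2 / 2)) := by
            have h2 : Tendsto (fun h : ℝ => τ + h) (𝓝[>] 0) (𝓝 τ) := by
              have : Tendsto (fun h : ℝ => τ + h) (𝓝 0) (𝓝 (τ + 0)) := (continuous_const.add continuous_id).tendsto 0
              rw [add_zero] at this
              exact this.mono_left nhdsWithin_le_nhds
            exact hd.continuousAt.tendsto.comp h2
          have h3 := (h1.const_mul (-2)).sqrt
          have e1 : √(-2 * (-(mm D u p τ) ^ 2 / 2)) = mm D u p τ := by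
            rw [show -2 * (-(mm D u p τ) ^ 2 / 2) = (mm D u p τ) ^ 2 by ring, Real.sqrt_sq hm0]
          rw [e1] at h3
          refine h3.congr' ?_
          filter_upwards [self_mem_nhdsWithin] with h hh
          have hh' : 0 < h := hh
          rw [show -2 * (-(mm D u p (τ + h)) ^ 2 / 2) = (mm D u p (τ + h)) ^ 2 by ring, Real.sqrt_sq (mm_nonneg H (by linarith))]
        have hmuc : Tendsto (fun h => mu D u (τ + h)) (𝓝[>] 0) (𝓝 (mu D u τ)) := by
          have h2 : Tendsto (fun h : ℝ => τ + h) (𝓝[>] 0) (𝓝 τ) := by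
            have : Tendsto (fun h : ℝ => τ + h) (𝓝 0) (𝓝 (τ + 0)) := (continuous_const.add continuous_id).tendsto 0
            rw [add_zero] at this
            exact this.mono_left nhdsWithin_le_nhds
          exact hcτ.tendsto.comp h2
        have hl : Tendsto (fun h => (mm D u p τ + mm D u p (τ + h)) / 2 * (4 * π * (τ ^ p * mu D u (τ + h)))) (𝓝[>] 0)
            (𝓝 ((mm D u p τ + mm D u p τ) / 2 * (4 * π * (τ ^ p * mu D u τ)))) :=
          ((tendsto_const_nhds.add hmc).div_const 2).mul ((hmuc.const_mul _).const_mul _)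
        have hle : (mm D u p τ + mm D u p τ) / 2 * (4 * π * (τ ^ p * mu D u τ)) ≤ mm D u p τ * d := by
          refine le_of_tendsto_of_tendsto hl (hd1.const_mul (mm D u p τ)) ?_
          filter_upwards [self_mem_nhdsWithin] with h hh
          have hh' : 0 < h := hh
          have hA := levelA H (ht.trans hτ.1) hh'
          have hB := H.mm_diff hτ0.le (show τ ≤ τ + h by linarith)
          have h4 := H.mm_anti hτ0.le (show τ ≤ τ + h by linarith)
          have h5 := mm_nonneg H (show 0 ≤ τ + h by linarith)
          have hT : 0 ≤ τ ^ p := Real.rpow_nonneg hτ0.le _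
          set a := mm D u p τ
          set b := mm D u p (τ + h)
          have h6 : τ ^ p * (4 * π * h * mu D u (τ + h)) ≤ τ ^ p * (a * (mu D u τ - mu D u (τ + h))) :=
            mul_le_mul_of_nonneg_left hA hT
          have h7 : a * (τ ^ p * (mu D u τ - mu D u (τ + h))) ≤ a * (a - b) := mul_le_mul_of_nonneg_left hB hm0
          have h8 : h * (4 * π * (τ ^ p * mu D u (τ + h))) ≤ a * (a - b) := by nlinarith
          have h9 : (a + b) / 2 * (h * (4 * π * (τ ^ p * mu D u (τ + h)))) ≤ (a + b) / 2 * (a * (a - b)) :=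
            mul_le_mul_of_nonneg_left h8 (by linarith)
          rw [smul_eq_mul, inv_mul_eq_div, ← mul_div_assoc, le_div_iff₀ hh']
          nlinarith
        have : mm D u p τ * (4 * π * (τ ^ p * mu D u τ)) ≤ mm D u p τ * d := by
          refine le_trans (le_of_eq ?_) hle; ring
        exact le_of_mul_le_mul_left this hm
  rw [intervalIntegral.integral_const_mul, hmM] at key
  linarith

lemma LES.fub (H : LES D u p t0 M) {a : ℝ} (ha : 0 ≤ a) (haM : a ≤ M) {w : ℝ → ℝ} (hw : ContinuousOn w (Set.Icc a M))
    {f : E2 → ℝ} (hf : IntegrableOn f (sl D u a)) :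
    ∫ τ in a..M, w τ * ∫ x in sl D u τ, f x = ∫ x in sl D u a, f x * ∫ τ in a..(u x), w τ := by
  classical
  set U : E2 → ℝ := D.piecewise u (fun _ => 0)
  have hU : Measurable U := H.c2.continuousOn.measurable_piecewise continuousOn_const H.op.measurableSet
  have hUD : ∀ x ∈ D, U x = u x := fun x hx => Set.piecewise_eq_of_mem _ _ _ hx
  have hwi : IntegrableOn w (Set.Ioc a M) := (hw.integrableOn_compact isCompact_Icc).mono_set Set.Ioc_subset_Icc_self
  set S : Set (ℝ × E2) := {z | z.1 < U z.2}
  have hS : MeasurableSet S := measurableSet_lt measurable_fst (hU.comp measurable_snd)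
  have hIntg : Integrable (Function.uncurry fun τ x => S.indicator (fun z => w z.1 * f z.2) (τ, x))
      ((volume.restrict (Set.Ioc a M)).prod (volume.restrict (sl D u a))) := by
    have h1 : Integrable (fun z : ℝ × E2 => w z.1 * f z.2) ((volume.restrict (Set.Ioc a M)).prod (volume.restrict (sl D u a))) :=
      Integrable.mul_prod hwi hf
    exact h1.indicator hS
  have hsw := integral_integral_swap hIntg
  rw [intervalIntegral.integral_of_le haM]
  have hL : ∀ τ ∈ Set.Ioc a M, w τ * ∫ x in sl D u τ, f x =
      ∫ x in sl D u a, S.indicator (fun z => w z.1 * f z.2) (τ, x) := by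
    intro τ hτ
    rw [← integral_const_mul, ← integral_indicator (H.isOpen_sl _).measurableSet, ← integral_indicator (H.isOpen_sl _).measurableSet]
    congr 1; ext x
    by_cases hx : x ∈ D
    · by_cases h1 : τ < u x
      · have m1 : x ∈ sl D u τ := ⟨hx, h1⟩
        have m2 : x ∈ sl D u a := ⟨hx, hτ.1.trans h1⟩
        have m3 : (τ, x) ∈ S := by simp only [S, Set.mem_ofPred_eq, hUD x hx]; exact h1
        rw [Set.indicator_of_mem m1, Set.indicator_of_mem m2, Set.indicator_of_mem m3]
      · have m1 : x ∉ sl D u τ := fun h => h1 h.2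
        have m3 : (τ, x) ∉ S := by simp only [S, Set.mem_ofPred_eq, hUD x hx]; exact h1
        rw [Set.indicator_of_notMem m1]
        rw [Set.indicator_apply, Set.indicator_of_notMem m3]; simp
    · have m1 : x ∉ sl D u τ := fun h => hx h.1
      have m2 : x ∉ sl D u a := fun h => hx h.1
      rw [Set.indicator_of_notMem m1, Set.indicator_of_notMem m2]
  rw [setIntegral_congr_fun measurableSet_Ioc hL, hsw]
  refine setIntegral_congr_fun (H.isOpen_sl a).measurableSet ?_
  intro x hx
  dsimp only
  rw [intervalIntegral.integral_of_le hx.2.le, ← integral_const_mul, ← integral_indicator measurableSet_Ioc,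
    ← integral_indicator measurableSet_Ioc]
  refine integral_congr_ae ?_
  have h3 : ∀ᵐ τ : ℝ, τ ≠ u x := by simp [ae_iff]
  filter_upwards [h3] with τ hτ
  by_cases h1 : τ ∈ Set.Ioc a M
  · rw [Set.indicator_of_mem h1]
    by_cases h2 : τ < u x
    · have m1 : τ ∈ Set.Ioc a (u x) := ⟨h1.1, h2.le⟩
      have m3 : (τ, x) ∈ S := by simp only [S, Set.mem_ofPred_eq, hUD x hx.1]; exact h2
      rw [Set.indicator_of_mem m1, Set.indicator_of_mem m3]; ring
    · have m1 : τ ∉ Set.Ioc a (u x) := fun h => h2 (lt_of_le_of_ne h.2 hτ)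
      have m3 : (τ, x) ∉ S := by simp only [S, Set.mem_ofPred_eq, hUD x hx.1]; exact h2
      rw [Set.indicator_of_notMem m1, Set.indicator_of_notMem m3]
  · have m1 : τ ∉ Set.Ioc a (u x) := fun h => h1 ⟨h.1, h.2.trans (H.leM x hx.1)⟩
    rw [Set.indicator_of_notMem h1, Set.indicator_of_notMem m1]
end
end

section
section
variable {D : Set E2} {u : E2 → ℝ} {p t0 M : ℝ}

/-- superlevel energy -/
def ee (D : Set E2) (u : E2 → ℝ) (p t : ℝ) : ℝ := ∫ x in sl D u t, (u x) ^ (p + 1)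

lemma LES.fub_m (H : LES D u p t0 M) {a : ℝ} (ha : 0 ≤ a) (haM : a ≤ M) :
    ∫ τ in a..M, mm D u p τ ≤ ee D u p a := by
  have h := H.fub ha haM (w := fun _ => 1) continuousOn_const (H.intpow ha (by linarith [H.hp] : 0 ≤ p))
  simp only [one_mul, intervalIntegral.integral_const, smul_eq_mul, mul_one] at h
  unfold mm
  rw [h]
  have e1 : ∀ x ∈ sl D u a, (u x) ^ p * (u x - a) ≤ (u x) ^ (p + 1) := by
    intro x hx
    have h0 : 0 < u x := lt_of_le_of_lt ha hx.2
    rw [Real.rpow_add h0, Real.rpow_one]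
    exact mul_le_mul_of_nonneg_left (by linarith) (Real.rpow_nonneg h0.le _)
  have e2 : ∀ x ∈ sl D u a, (u x) ^ p * (u x - a) = (u x) ^ (p + 1) - a * (u x) ^ p := by
    intro x hx
    have h0 : 0 < u x := lt_of_le_of_lt ha hx.2
    rw [Real.rpow_add h0, Real.rpow_one]; ring
  have i1 : IntegrableOn (fun x => (u x) ^ (p + 1)) (sl D u a) := H.intpow ha (by linarith [H.hp])
  have i2 : IntegrableOn (fun x => (u x) ^ p) (sl D u a) := H.intpow ha (by linarith [H.hp])
  refine setIntegral_mono_on ?_ i1 (H.isOpen_sl a).measurableSet e1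
  exact IntegrableOn.congr_fun (i1.sub (i2.const_mul a)) (fun x hx => (e2 x hx).symm) (H.isOpen_sl a).measurableSet

lemma LES.fub_mu (H : LES D u p t0 M) {a : ℝ} (ha : 0 ≤ a) (haM : a ≤ M) :
    (p + 1) * ∫ τ in a..M, τ ^ p * mu D u τ = ee D u p a - a ^ (p + 1) * mu D u a := by
  have hp := H.hp
  have i0 : IntegrableOn (fun _ => (1:ℝ)) (sl D u a) := integrableOn_const (H.fin_sl a)
  have h := H.fub ha haM (w := fun τ => τ ^ p)
    (fun x _ => (Real.continuousAt_rpow_const x p (Or.inr (by linarith))).continuousWithinAt) i0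
  have e0 : ∀ τ, (∫ x in sl D u τ, (1:ℝ)) = mu D u τ := by
    intro τ; simp [mu]
  simp only [e0, one_mul] at h
  rw [h, ← integral_const_mul]
  have i1 : IntegrableOn (fun x => (u x) ^ (p + 1)) (sl D u a) := H.intpow ha (by linarith [H.hp])
  have e1 : ∀ x ∈ sl D u a, (p + 1) * ∫ τ in a..(u x), τ ^ p = (u x) ^ (p + 1) - a ^ (p + 1) := by
    intro x hx
    rw [integral_rpow (Or.inl (by linarith))]; field_simp
  rw [setIntegral_congr_fun (H.isOpen_sl a).measurableSet e1, integral_sub i1 (integrableOn_const (H.fin_sl a)),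
    setIntegral_const, smul_eq_mul, mul_comm]
  rfl

lemma ee_nonneg (H : LES D u p t0 M) {t : ℝ} (ht : 0 ≤ t) : 0 ≤ ee D u p t :=
  setIntegral_nonneg (H.isOpen_sl t).measurableSet fun _ hx => Real.rpow_nonneg (ht.trans hx.2.le) _

lemma LES.B2 (H : LES D u p 0 M) {t : ℝ} (ht : 0 < t) (hmu : 0 < mu D u t) :
    4 * π * t ^ 2 ≤ (Real.log (volume.real D) - Real.log (mu D u t)) * ee D u p 0 := by
  have htM : t < M := by
    by_contra h
    rw [mu, H.sl_top (not_lt.mp h)] at hmu; simp at hmu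
  have hc : Continuous fun s : ℝ => 4 * π * (t - s) ^ 2 := by fun_prop
  have : 4 * π * (t - 0) ^ 2 ≤ (Real.log (volume.real D) - Real.log (mu D u t)) * ee D u p 0 := by
    refine le_of_tendsto (x := 𝓝[>] (0:ℝ)) ((hc.tendsto 0).mono_left nhdsWithin_le_nhds) ?_
    filter_upwards [Ioo_mem_nhdsGT ht] with s hs
    refine (H.B1 hs.1 hs.2 hmu).trans ?_
    have m1 : 0 < mu D u s := hmu.trans_le (H.mu_anti hs.2.le)
    have m2 : mu D u s ≤ volume.real D := measureReal_mono (fun x hx => hx.1) H.bdd.measure_lt_top.ne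
    have anti : ∀ a b : ℝ, 0 ≤ a → a ≤ b → IntervalIntegrable (mm D u p) volume a b := by
      intro a b ha hab
      have : AntitoneOn (mm D u p) (Set.uIcc a b) := by
        rw [Set.uIcc_of_le hab]
        intro c hc d _ hcd
        exact H.mm_anti (ha.trans hc.1) hcd
      exact this.intervalIntegrable
    have h1 : ∫ τ in s..t, mm D u p τ ≤ ee D u p 0 := by
      refine le_trans ?_ (H.fub_m le_rfl (ht.trans htM).le)
      refine intervalIntegral.integral_mono_interval hs.1.le hs.2.le htM.le ?_ (anti 0 M le_rfl (ht.trans htM).le)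
      refine (ae_restrict_mem measurableSet_Ioc).mono ?_
      intro τ hτ; exact mm_nonneg H hτ.1.le
    refine mul_le_mul ?_ h1 ?_ ?_
    · have := Real.log_le_log m1 m2; linarith
    · exact intervalIntegral.integral_nonneg hs.2.le (fun τ hτ => mm_nonneg H (hs.1.le.trans hτ.1))
    · have := Real.log_le_log hmu ((H.mu_anti hs.2.le).trans m2); linarith
  simpa using this

lemma LES.mu_pos (H : LES D u p t0 M) {x : E2} (hx : x ∈ D) {t : ℝ} (ht : t < u x) : 0 < mu D u t := by
  have h := (H.isOpen_sl t).measure_pos volume ⟨x, hx, ht⟩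
  exact ENNReal.toReal_pos h.ne' (H.fin_sl t)

lemma LES.ee_pos (H : LES D u p 0 M) {x : E2} (hx : x ∈ D) (hux : 0 < u x) : 0 < ee D u p 0 := by
  have h1 := H.B2 (half_pos hux) (H.mu_pos hx (half_lt_self hux))
  rcases (ee_nonneg H le_rfl).eq_or_lt with h | h
  · rw [← h, mul_zero] at h1
    have : 0 < 4 * π * (u x / 2) ^ 2 := by positivity
    linarith
  · exact h

lemma LES.mu_le (H : LES D u p 0 M) {x : E2} (hx : x ∈ D) (hux : 0 < u x) {t : ℝ} (ht : 0 < t) :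
    mu D u t ≤ volume.real D * Real.exp (-(4 * π * t ^ 2 / ee D u p 0)) := by
  have hI := H.ee_pos hx hux
  rcases (mu_nonneg (D := D) (u := u) t).eq_or_lt with h | h
  · rw [← h]; have : 0 ≤ volume.real D := measureReal_nonneg
    positivity
  · have h1 := H.B2 ht h
    have hV : 0 < volume.real D := h.trans_le (measureReal_mono (fun x hx => hx.1) H.bdd.measure_lt_top.ne)
    have h2 : 4 * π * t ^ 2 / ee D u p 0 ≤ Real.log (volume.real D) - Real.log (mu D u t) := by
      rwa [div_le_iff₀ hI]
    rw [← Real.log_le_log_iff h (by positivity), Real.log_mul hV.ne' (Real.exp_pos _).ne', Real.log_exp]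
    linarith

lemma gauss_int {b M : ℝ} (hb : 0 < b) : ∫ t in (0:ℝ)..M, t * Real.exp (-(4 * π * t ^ 2 / b)) ≤ b / (8 * π) := by
  have hpi := Real.pi_pos
  have hd : ∀ t ∈ Set.uIcc 0 M, HasDerivAt (fun t => -(b / (8 * π)) * Real.exp (-(4 * π * t ^ 2 / b)))
      (t * Real.exp (-(4 * π * t ^ 2 / b))) t := by
    intro t _
    have h1 : HasDerivAt (fun t : ℝ => -(4 * π * t ^ 2 / b)) (-(4 * π * (2 * t) / b)) t := by
      have := ((((hasDerivAt_pow 2 t).const_mul (4 * π)).div_const b).fun_neg)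
      simpa using this
    refine ((h1.exp).const_mul (-(b / (8 * π)))).congr_deriv ?_
    field_simp; ring
  rw [intervalIntegral.integral_eq_sub_of_hasDerivAt hd (Continuous.intervalIntegrable (by fun_prop) _ _)]
  have h1 : 0 < Real.exp (-(4 * π * M ^ 2 / b)) := Real.exp_pos _
  have h2 : 0 < b / (8 * π) := by positivity
  simp only [ne_eq, OfNat.ofNat_ne_zero, not_false_eq_true, zero_pow, mul_zero, zero_div, neg_zero, Real.exp_zero, mul_one]
  nlinarith

lemma LES.Bcore (H : LES D u p 0 M) {x : E2} (hx : x ∈ D) (hux : 0 < u x) {Y : ℝ} (hY : 0 < Y)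
    (hY2 : ∀ t, 0 < t → t ≤ M → t * Real.exp (-(4 * π * t ^ 2 / (p * ee D u p 0))) ≤ Y) :
    1 ≤ p * (p + 1) * volume.real D / (8 * π) * Y ^ (p - 1) := by
  have hp := H.hp
  have hI := H.ee_pos hx hux
  have hM : 0 < M := hux.trans_le (H.leM x hx)
  have hV : 0 ≤ volume.real D := measureReal_nonneg
  set I := ee D u p 0 with hIdef
  have h1 := H.fub_mu le_rfl hM.le
  rw [Real.zero_rpow (by linarith), zero_mul, sub_zero] at h1
  have hYp : 0 < Y ^ (p - 1) := Real.rpow_pos_of_pos hY _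
  have h2 : ∫ τ in (0:ℝ)..M, τ ^ p * mu D u τ ≤
      ∫ τ in (0:ℝ)..M, volume.real D * Y ^ (p - 1) * (τ * Real.exp (-(4 * π * τ ^ 2 / (p * I)))) := by
    refine intervalIntegral.integral_mono_ae_restrict hM.le ?_ (Continuous.intervalIntegrable (by fun_prop) _ _) ?_
    · refine IntervalIntegrable.continuousOn_mul (H.mu_anti.antitoneOn _).intervalIntegrable ?_
      intro x hx
      exact (Real.continuousAt_rpow_const x p (Or.inr (by linarith [H.hp]))).continuousWithinAt
    · have h3 : ∀ᵐ τ : ℝ, τ ≠ 0 := by simp [ae_iff]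
      filter_upwards [ae_restrict_mem measurableSet_Icc, ae_restrict_of_ae h3] with τ hτ hτ0
      have hτp : 0 < τ := lt_of_le_of_ne hτ.1 (Ne.symm hτ0)
      have e1 := H.mu_le hx hux hτp
      set E := Real.exp (-(4 * π * τ ^ 2 / (p * I))) with hE
      have hEp : 0 < E := Real.exp_pos _
      have e2 : Real.exp (-(4 * π * τ ^ 2 / I)) = E ^ p := by
        rw [hE, ← Real.exp_mul]; congr 1; field_simp
      have e3 : τ ^ p * E ^ p = (τ * E) ^ (p - 1) * (τ * E) := by
        rw [← Real.mul_rpow hτp.le hEp.le]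
        nth_rw 1 [show p = (p - 1) + 1 by ring]
        rw [Real.rpow_add (by positivity), Real.rpow_one]
      have e4 : (τ * E) ^ (p - 1) ≤ Y ^ (p - 1) := Real.rpow_le_rpow (by positivity) (hY2 τ hτp hτ.2) (by linarith)
      rw [← hIdef, e2] at e1
      calc τ ^ p * mu D u τ ≤ τ ^ p * (volume.real D * E ^ p) := by gcongr
        _ = volume.real D * ((τ * E) ^ (p - 1) * (τ * E)) := by rw [← e3]; ring
        _ ≤ volume.real D * (Y ^ (p - 1) * (τ * E)) := by gcongr
        _ = _ := by ring
  rw [intervalIntegral.integral_const_mul] at h2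
  have h4 := gauss_int (b := p * I) (M := M) (by positivity)
  have h5 : I ≤ (p + 1) * (volume.real D * Y ^ (p - 1) * (p * I / (8 * π))) := by
    refine (hIdef.trans h1.symm).le.trans ?_
    refine mul_le_mul_of_nonneg_left (h2.trans ?_) (by linarith)
    exact mul_le_mul_of_nonneg_left h4 (by positivity)
  have h6 : I * 1 ≤ I * (p * (p + 1) * volume.real D / (8 * π) * Y ^ (p - 1)) := by
    refine le_trans (by linarith) (h5.trans (le_of_eq ?_)); ring
  exact le_of_mul_le_mul_left h6 hI

end
end

section
lemma decay_q {q : ℝ} (hq : 0 < q) (hq1 : q < 1) (C : ℝ) :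
    ∀ᶠ P : ℝ in atTop, P * (P + 1) * C / (8 * π) * q ^ (P - 1) < 1 := by
  have hb : 0 < -Real.log q := by have := Real.log_neg hq hq1; linarith
  have h2 := tendsto_rpow_mul_exp_neg_mul_atTop_nhds_zero 2 _ hb
  have h1 := tendsto_rpow_mul_exp_neg_mul_atTop_nhds_zero 1 _ hb
  have h3 : Tendsto (fun P : ℝ => (C / (8 * π) * q⁻¹) * (P ^ (2:ℝ) * Real.exp (-(-Real.log q) * P) + P ^ (1:ℝ) * Real.exp (-(-Real.log q) * P)))
      atTop (𝓝 ((C / (8 * π) * q⁻¹) * (0 + 0))) := (h2.add h1).const_mul _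
  rw [add_zero, mul_zero] at h3
  filter_upwards [h3.eventually (gt_mem_nhds zero_lt_one), eventually_gt_atTop 0] with P hP hP0
  refine lt_of_eq_of_lt ?_ hP
  have e : q ^ (P - 1) = Real.exp (-(-Real.log q) * P) * q⁻¹ := by
    rw [Real.rpow_sub hq, Real.rpow_one, Real.rpow_def_of_pos hq, neg_neg]; rfl
  rw [e, Real.rpow_two, Real.rpow_one]
  ring

section
variable {D : Set E2} {u : E2 → ℝ} {p t0 M : ℝ}

lemma LES.low1 (H : LES D u p 0 M) {x : E2} (hx : x ∈ D) (hux : 0 < u x) {q : ℝ} (hq : 0 < q)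
    (hE : p * (p + 1) * volume.real D / (8 * π) * q ^ (p - 1) < 1) :
    8 * π * Real.exp 1 * q ^ 2 ≤ p * ee D u p 0 := by
  by_contra hcon
  push Not at hcon
  have hI := H.ee_pos hx hux
  have hp := H.hp
  have hb : 0 < p * ee D u p 0 := by positivity
  refine absurd (H.Bcore hx hux hq ?_) (not_le.mpr hE)
  intro t ht _
  set b := p * ee D u p 0
  refine le_of_sq_le_sq ?_ hq.le
  set s := 8 * π * t ^ 2 / b with hs
  have h1 : s ≤ Real.exp (s - 1) := by have := Real.add_one_le_exp (s - 1); linarith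
  have h2 : (t * Real.exp (-(4 * π * t ^ 2 / b))) ^ 2 = b / (8 * π) * (s * Real.exp (-s)) := by
    rw [mul_pow, ← Real.exp_nat_mul, show ((2:ℕ):ℝ) * -(4 * π * t ^ 2 / b) = -s by rw [hs]; push_cast; ring]
    rw [hs]; field_simp
  rw [h2]
  have h3 : s * Real.exp (-s) ≤ Real.exp (-1) := by
    calc s * Real.exp (-s) ≤ Real.exp (s - 1) * Real.exp (-s) := by gcongr
      _ = Real.exp (-1) := by rw [← Real.exp_add]; congr 1; ring
  have h4 : b / (8 * π) * (s * Real.exp (-s)) ≤ b / (8 * π) * Real.exp (-1) := by gcongr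
  refine h4.trans ?_
  rw [Real.exp_neg, ← div_eq_mul_inv, div_div, div_le_iff₀ (by positivity)]
  linarith

lemma LES.low2 (H : LES D u p 0 M) {x : E2} (hx : x ∈ D) (hux : 0 < u x) {σ : ℝ} (hσ : 0 < σ)
    (hE : p * (p + 1) * volume.real D / (8 * π) * (Real.exp (-(σ ^ 2 / 4))) ^ (p - 1) < 1)
    (hb : p * ee D u p 0 ≤ 8 * π * Real.exp 1 * (1 + σ ^ 2 / 2)) :
    Real.exp (1 / 2) * (1 - σ) ≤ M := by
  by_contra hcon
  push Not at hcon
  have hI := H.ee_pos hx hux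
  have hp := H.hp
  have hb0 : 0 < p * ee D u p 0 := by positivity
  refine absurd (H.Bcore hx hux (Real.exp_pos _) ?_) (not_le.mpr hE)
  intro t ht htM
  set b := p * ee D u p 0
  set e := Real.exp (1 / 2) with he
  have hepos : 0 < e := Real.exp_pos _
  have hee : e ^ 2 = Real.exp 1 := by rw [he, ← Real.exp_nat_mul]; congr 1; norm_num
  set r := t / e with hr
  have hrpos : 0 < r := by positivity
  have hr1 : r < 1 - σ := by rw [hr, div_lt_iff₀ hepos]; linarith
  have ht' : t = e * r := by rw [hr]; field_simp
  have h1 : r ≤ Real.exp (r - 1) := by have := Real.add_one_le_exp (r - 1); linarith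
  have h2 : r ^ 2 / 2 * (1 - σ ^ 2 / 2) ≤ 4 * π * t ^ 2 / b := by
    rw [le_div_iff₀ hb0, ht', mul_pow, hee]
    have : b * (1 - σ ^ 2 / 2) ≤ 8 * π * Real.exp 1 := by
      by_cases hs : 1 - σ ^ 2 / 2 ≤ 0
      · have h0 : b * (1 - σ ^ 2 / 2) ≤ 0 := mul_nonpos_of_nonneg_of_nonpos hb0.le hs
        have : 0 < 8 * π * Real.exp 1 := by positivity
        linarith
      · push Not at hs
        have h0 := mul_le_mul_of_nonneg_right hb hs.le
        have : 0 < 8 * π * Real.exp 1 := by positivity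
        nlinarith [mul_nonneg this.le (sq_nonneg (σ ^ 2))]
    nlinarith [sq_nonneg r, mul_le_mul_of_nonneg_left this (sq_nonneg r)]
  calc t * Real.exp (-(4 * π * t ^ 2 / b)) ≤ (e * Real.exp (r - 1)) * Real.exp (-(r ^ 2 / 2 * (1 - σ ^ 2 / 2))) := by
        rw [ht'] at h2 ⊢; gcongr
    _ = Real.exp (1 / 2 + (r - 1) - r ^ 2 / 2 * (1 - σ ^ 2 / 2)) := by
        rw [he, ← Real.exp_add, ← Real.exp_add]; congr 1
    _ ≤ Real.exp (-(σ ^ 2 / 4)) := by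
        apply Real.exp_le_exp.mpr
        have h3 : r ^ 2 ≤ 1 := by nlinarith
        nlinarith [mul_nonneg (sq_nonneg σ) (sub_nonneg.mpr h3)]
end

lemma les_of_sol {Ω : Set E2} (hΩo : IsOpen Ω) (hΩb : IsBounded Ω) {p : ℝ} (hp : 1 < p) {u : E2 → ℝ}
    (h : IsSolution Ω p u) {x : E2} (hmax : ∀ y ∈ closure Ω, u y ≤ u x) : LES Ω u p 0 (u x) := by
  obtain ⟨h1, h2, h3, h4⟩ := h
  refine ⟨hΩo, hΩb, h1, ?_, ?_, le_rfl, hp, fun y hy => hmax y (subset_closure hy)⟩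
  · intro t ht
    have e : {x | x ∈ Ω ∧ t ≤ u x} = closure Ω ∩ u ⁻¹' Set.Ici t := by
      ext y
      simp only [Set.mem_ofPred_eq, Set.mem_inter_iff, Set.mem_preimage, Set.mem_Ici]
      constructor
      · exact fun h => ⟨subset_closure h.1, h.2⟩
      · intro h
        refine ⟨?_, h.2⟩
        by_contra hy
        have := h4 y (by rw [frontier, hΩo.interior_eq]; exact ⟨h.1, hy⟩)
        linarith [h.2]
    rw [e]
    exact Metric.isCompact_of_isClosed_isBounded (h2.preimage_isClosed_of_isClosed isClosed_closure isClosed_Ici)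
      (hΩb.closure.subset Set.inter_subset_left)
  · intro y hy huy
    rw [h3 y hy, abs_of_pos huy]
    nth_rw 2 [← Real.rpow_one (u y)]
    rw [← Real.rpow_add huy]; congr 1; ring

lemma lap_neg' (u : E2 → ℝ) (x : E2) : lap (fun y => -u y) x = -lap u x := by
  unfold lap
  rw [← Finset.sum_neg_distrib]
  refine Finset.sum_congr rfl fun i _ => ?_
  have : (fun y => fderiv ℝ (fun y => -u y) y (EuclideanSpace.single i 1)) =
      fun y => -(fderiv ℝ u y (EuclideanSpace.single i 1)) := by
    ext y; rw [fderiv_fun_neg]; rfl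
  rw [this, fderiv_fun_neg]; rfl

lemma sol_neg {Ω : Set E2} {p : ℝ} {u : E2 → ℝ} (h : IsSolution Ω p u) : IsSolution Ω p (fun y => -u y) := by
  obtain ⟨h1, h2, h3, h4⟩ := h
  refine ⟨h1.neg, h2.neg, ?_, ?_⟩
  · intro x hx
    have := h3 x hx
    simp only [lap_neg', abs_neg, mul_neg]; linarith
  · intro x hx; simp [h4 x hx]

lemma energy_split {Ω : Set E2} {p M M' : ℝ} {u : E2 → ℝ} (H : LES Ω u p 0 M) (H' : LES Ω (fun y => -u y) p 0 M') :
    ∫ x in Ω, |u x| ^ (p + 1) = ee Ω u p 0 + ee Ω (fun y => -u y) p 0 := by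
  have hp := H.hp
  have i1 : IntegrableOn (fun x => (u x) ^ (p + 1)) (sl Ω u 0) := H.intpow le_rfl (by linarith)
  have i2 : IntegrableOn (fun x => (-u x) ^ (p + 1)) (sl Ω (fun y => -u y) 0) := H'.intpow le_rfl (by linarith)
  unfold ee
  rw [← integral_indicator (H.isOpen_sl 0).measurableSet, ← integral_indicator (H'.isOpen_sl 0).measurableSet,
    ← integral_add (i1.integrable_indicator (H.isOpen_sl 0).measurableSet) (i2.integrable_indicator (H'.isOpen_sl 0).measurableSet),
    ← integral_indicator H.op.measurableSet]
  congr 1; ext x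
  by_cases hx : x ∈ Ω
  · rw [Set.indicator_of_mem hx]
    rcases lt_trichotomy (u x) 0 with h | h | h
    · have m1 : x ∉ sl Ω u 0 := fun h' => lt_asymm h h'.2
      have m2 : x ∈ sl Ω (fun y => -u y) 0 := ⟨hx, by simpa using h⟩
      rw [Set.indicator_of_notMem m1, Set.indicator_of_mem m2, abs_of_neg h, zero_add]
    · have m1 : x ∉ sl Ω u 0 := fun h' => by have := h'.2; linarith
      have m2 : x ∉ sl Ω (fun y => -u y) 0 := fun h' => by have := h'.2; simp only at this; linarith
      rw [Set.indicator_of_notMem m1, Set.indicator_of_notMem m2, h, abs_zero, Real.zero_rpow (by linarith), add_zero]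
    · have m1 : x ∈ sl Ω u 0 := ⟨hx, h⟩
      have m2 : x ∉ sl Ω (fun y => -u y) 0 := fun h' => by have := h'.2; simp only at this; linarith
      rw [Set.indicator_of_mem m1, Set.indicator_of_notMem m2, abs_of_pos h, add_zero]
  · have m1 : x ∉ sl Ω u 0 := fun h' => hx h'.1
    have m2 : x ∉ sl Ω (fun y => -u y) 0 := fun h' => hx h'.1
    rw [Set.indicator_of_notMem hx, Set.indicator_of_notMem m1, Set.indicator_of_notMem m2, add_zero]
end

section
lemma hasDerivAt_mx3 (s : ℝ) : HasDerivAt (fun s : ℝ => (max 0 s) ^ 3) (3 * (max 0 s) ^ 2) s := by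
  rcases lt_trichotomy s 0 with h | h | h
  · have : (fun s : ℝ => (max 0 s) ^ 3) =ᶠ[𝓝 s] fun _ => 0 := by
      filter_upwards [Iio_mem_nhds h] with y hy
      rw [max_eq_left (le_of_lt hy)]; norm_num
    rw [max_eq_left h.le]
    simpa using (hasDerivAt_const s (0:ℝ)).congr_of_eventuallyEq this
  · subst h
    rw [max_self]
    have h1 : HasDerivAt (fun s : ℝ => s ^ 3) (3 * 0 ^ 2) (0:ℝ) := by simpa using hasDerivAt_pow 3 (0:ℝ)
    rw [hasDerivAt_iff_isLittleO] at h1 ⊢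
    refine Asymptotics.IsBigO.trans_isLittleO ?_ h1
    refine Asymptotics.IsBigO.of_bound 1 (Filter.Eventually.of_forall fun x => ?_)
    simp only [max_self]
    norm_num
    apply pow_le_pow_left₀ (abs_nonneg _)
    rw [abs_of_nonneg (le_max_left _ _)]
    exact max_le (abs_nonneg _) (le_abs_self _)
  · have : (fun s : ℝ => (max 0 s) ^ 3) =ᶠ[𝓝 s] fun s => s ^ 3 := by
      filter_upwards [Ioi_mem_nhds h] with y hy
      rw [max_eq_right (le_of_lt hy)]
    rw [max_eq_right h.le]
    simpa using (hasDerivAt_pow 3 s).congr_of_eventuallyEq this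

/-- the bump kernel -/
def kk (y : E2) : ℝ := (max 0 (1 - ‖y‖ ^ 2)) ^ 3
/-- its companion -/
def k2 (y : E2) : ℝ := (max 0 (1 - ‖y‖ ^ 2)) ^ 2

lemma kk_nonneg (y : E2) : 0 ≤ kk y := by unfold kk; positivity
lemma k2_nonneg (y : E2) : 0 ≤ k2 y := by unfold k2; positivity
lemma kk_le (y : E2) : kk y ≤ 1 := by
  unfold kk
  apply pow_le_one₀ (le_max_left _ _)
  apply max_le (by norm_num); nlinarith [sq_nonneg ‖y‖]
lemma k2_le (y : E2) : k2 y ≤ 1 := by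
  unfold k2
  apply pow_le_one₀ (le_max_left _ _)
  apply max_le (by norm_num); nlinarith [sq_nonneg ‖y‖]
lemma kk_zero {y : E2} (h : 1 ≤ ‖y‖) : kk y = 0 := by
  unfold kk; rw [max_eq_left (by nlinarith)]; norm_num
lemma k2_zero {y : E2} (h : 1 ≤ ‖y‖) : k2 y = 0 := by
  unfold k2; rw [max_eq_left (by nlinarith)]; norm_num
lemma cont_kk : Continuous kk := by unfold kk; fun_prop
lemma cont_k2 : Continuous k2 := by unfold k2; fun_prop
lemma supp_kk : HasCompactSupport kk :=
  HasCompactSupport.intro (isCompact_closedBall (0:E2) 1) fun y hy => kk_zero (by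
    rw [mem_closedBall_zero_iff] at hy; linarith)
lemma supp_k2 : HasCompactSupport k2 :=
  HasCompactSupport.intro (isCompact_closedBall (0:E2) 1) fun y hy => k2_zero (by
    rw [mem_closedBall_zero_iff] at hy; linarith)

lemma hasFDerivAt_kk (y : E2) : HasFDerivAt kk ((-(6 * k2 y)) • (innerSL ℝ y)) y := by
  have h1 : HasFDerivAt (fun y : E2 => 1 - ‖y‖ ^ 2) (-(2 • (innerSL ℝ y))) y := by
    have := (hasStrictFDerivAt_norm_sq y).hasFDerivAt
    exact this.const_sub 1
  have := (hasDerivAt_mx3 (1 - ‖y‖ ^ 2)).comp_hasFDerivAt y h1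
  refine HasFDerivAt.congr_fderiv this ?_
  ext z
  simp only [k2, smul_apply, neg_apply, smul_eq_mul, nsmul_eq_mul]
  ring_nf

lemma c1_kk : ContDiff ℝ 1 kk := by
  rw [contDiff_one_iff_fderiv]
  refine ⟨fun y => (hasFDerivAt_kk y).differentiableAt, ?_⟩
  have : fderiv ℝ kk = fun y => (-(6 * k2 y)) • (innerSL ℝ y) := by
    ext1 y; exact (hasFDerivAt_kk y).fderiv
  rw [this]
  have := cont_k2
  fun_prop

lemma vol_ball2 (x : E2) {r : ℝ} (hr : 0 ≤ r) : volume.real (ball x r) = π * r ^ 2 := by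
  rw [Measure.real, EuclideanSpace.volume_ball_fin_two, ENNReal.toReal_mul, ENNReal.toReal_pow, ENNReal.toReal_ofReal hr, mul_comm]
  congr 1
  exact ENNReal.toReal_ofReal pi_nonneg

lemma int_k2 : ∫ y, k2 y = π / 3 := by
  have h := integral_fun_norm_addHaar (volume : Measure E2) (fun r : ℝ => (max 0 (1 - r ^ 2)) ^ 2)
  unfold k2
  rw [h, vol_ball2 _ zero_le_one]
  have e : ∫ y in Set.Ioi (0:ℝ), y ^ (Module.finrank ℝ E2 - 1) • (max 0 (1 - y ^ 2)) ^ 2 = 1 / 6 := by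
    have e1 : ∫ y in Set.Ioi (0:ℝ), y ^ (Module.finrank ℝ E2 - 1) • (max 0 (1 - y ^ 2)) ^ 2 =
        ∫ y in Set.Ioc (0:ℝ) 1, y ^ (Module.finrank ℝ E2 - 1) • (max 0 (1 - y ^ 2)) ^ 2 := by
      apply setIntegral_eq_of_subset_of_forall_sdiff_eq_zero measurableSet_Ioi (fun y (hy : y ∈ Set.Ioc (0:ℝ) 1) => hy.1)
      intro y hy
      have : 1 < y := by
        by_contra h; exact hy.2 ⟨hy.1, not_lt.mp h⟩
      rw [max_eq_left (by nlinarith)]; norm_num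
    rw [e1, ← intervalIntegral.integral_of_le zero_le_one]
    have e2 : ∫ y in (0:ℝ)..1, y ^ (Module.finrank ℝ E2 - 1) • (max 0 (1 - y ^ 2)) ^ 2 =
        ∫ y in (0:ℝ)..1, (y - 2 * y ^ 3 + y ^ 5) := by
      apply intervalIntegral.integral_congr
      intro y hy
      rw [Set.uIcc_of_le zero_le_one] at hy
      simp only [finrank_euclideanSpace_fin]
      rw [max_eq_right (by nlinarith [hy.1, hy.2])]
      simp; ring
    rw [e2]
    rw [intervalIntegral.integral_add, intervalIntegral.integral_sub]
    · simp; norm_num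
    all_goals apply Continuous.intervalIntegrable; fun_prop
  rw [e]; simp; ring

lemma int_kk_le : ∫ y, kk y ≤ π := by
  have e : ∫ y, kk y = ∫ y in ball (0:E2) 1, kk y := by
    symm; apply setIntegral_eq_integral_of_forall_compl_eq_zero
    intro y hy; apply kk_zero; simpa using hy
  rw [e]
  have := norm_setIntegral_le_of_norm_le_const (μ := volume) (s := ball (0:E2) 1) (f := kk) (C := 1)
    (measure_ball_lt_top) (fun y _ => by rw [Real.norm_eq_abs, abs_of_nonneg (kk_nonneg y)]; exact kk_le y)
  rw [vol_ball2 _ zero_le_one] at this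
  have h2 := le_abs_self (∫ y in ball (0:E2) 1, kk y)
  rw [← Real.norm_eq_abs] at h2
  linarith

lemma inner_sum2 (L : E2 →L[ℝ] ℝ) (y : E2) : L y = ∑ i : Fin 2, y i * L (bv i) := by
  have hz : y = y 0 • bv 0 + y 1 • bv 1 := by
    ext i; fin_cases i <;> simp [bv]
  conv_lhs => rw [hz]
  simp only [map_add, map_smul, smul_eq_mul, Fin.sum_univ_two]

/-- integration by parts at scale `t`. -/
lemma ibp_kk {W : E2 → ℝ} (hW : ContDiff ℝ 2 W) (x : E2) (t : ℝ) :
    6 * ∫ y, k2 y * fderiv ℝ W (x + t • y) y = t * ∫ y, lap W (x + t • y) * kk y := by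
  have hp : ∀ i : Fin 2, ContDiff ℝ 1 (fun z => fderiv ℝ W z (bv i)) := fun i =>
    (hW.fderiv_right (m := 1) (by norm_num)).clm_apply contDiff_const
  have haff : ContDiff ℝ 1 (fun y : E2 => x + t • y) := by fun_prop
  let X : Fin 2 → E2 → ℝ := fun i y => kk y * fderiv ℝ W (x + t • y) (bv i)
  have hX : ∀ i, ContDiff ℝ 1 (X i) := fun i => c1_kk.mul ((hp i).comp haff)
  have hXs : ∀ i, HasCompactSupport (X i) := fun i => supp_kk.mul_right
  have hder : ∀ i y, fderiv ℝ (X i) y (bv i) =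
      -(6 * k2 y) * y i * fderiv ℝ W (x + t • y) (bv i) +
        t * (kk y * fderiv ℝ (fun z => fderiv ℝ W z (bv i)) (x + t • y) (bv i)) := by
    intro i y
    have d1 : HasFDerivAt (fun y : E2 => x + t • y) (t • ContinuousLinearMap.id ℝ E2) y :=
      ((hasFDerivAt_id y).const_smul t).const_add x
    have d2 := (((hp i).differentiable (by norm_num)) (x + t • y)).hasFDerivAt.comp y d1
    have := (hasFDerivAt_kk y).mul d2
    rw [show X i = kk * ((fun z => fderiv ℝ W z (bv i)) ∘ fun y => x + t • y) from rfl, this.fderiv]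
    have hin : inner ℝ y (bv i) = y i := by
      rw [real_inner_comm]; simp [bv, EuclideanSpace.inner_single_left]
    simp only [add_apply, smul_apply, smul_eq_mul, ContinuousLinearMap.comp_apply, Function.comp, innerSL_apply_apply, hin,
      ContinuousLinearMap.id_apply, map_smul]
    ring
  have iX : ∀ i, Integrable (fun y => fderiv ℝ (X i) y (bv i)) := fun i =>
    Continuous.integrable_of_hasCompactSupport (((hX i).continuous_fderiv (by norm_num)).clm_apply continuous_const)
      ((hXs i).fderiv_apply (𝕜 := ℝ) _)
  have h0 : ∫ y, (fderiv ℝ (X 0) y (bv 0) + fderiv ℝ (X 1) y (bv 1)) = 0 := by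
    rw [integral_add (iX 0) (iX 1), divg_zero0 (hX 0) (hXs 0), divg_zero0 (hX 1) (hXs 1), add_zero]
  have e : ∀ y, fderiv ℝ (X 0) y (bv 0) + fderiv ℝ (X 1) y (bv 1) =
      t * (lap W (x + t • y) * kk y) - 6 * (k2 y * fderiv ℝ W (x + t • y) y) := by
    intro y
    rw [hder, hder, inner_sum2 (fderiv ℝ W (x + t • y)) y]
    simp only [lap, Fin.sum_univ_two]
    ring
  simp_rw [e] at h0
  have hcf : Continuous (fderiv ℝ W) := hW.continuous_fderiv (by norm_num)
  have hcl : Continuous (lap W) := by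
    have := cont_lap isOpen_univ hW.contDiffOn
    rwa [continuousOn_univ] at this
  have c1 := cont_kk
  have c2 := cont_k2
  rw [integral_sub, integral_const_mul, integral_const_mul] at h0
  · linarith
  · apply Integrable.const_mul
    refine Continuous.integrable_of_hasCompactSupport ?_ supp_kk.mul_left
    exact (hcl.comp (by fun_prop)).mul c1
  · apply Integrable.const_mul
    refine Continuous.integrable_of_hasCompactSupport ?_ supp_k2.mul_right
    exact c2.mul ((hcf.comp (by fun_prop)).clm_apply continuous_id)

lemma mean_deriv {W : E2 → ℝ} (hW : ContDiff ℝ 2 W) (hWs : HasCompactSupport W) (x : E2) (t : ℝ) :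
    HasDerivAt (fun t : ℝ => (3 / π) * ∫ y, W (x + t • y) * k2 y)
      (t * ∫ y, lap W (x + t • y) * (kk y / (2 * π))) t := by
  have hcf : Continuous (fderiv ℝ W) := hW.continuous_fderiv (by norm_num)
  have c2 := cont_k2
  have hcW := hW.continuous
  obtain ⟨C, hC⟩ := hcf.bounded_above_of_compact_support (hWs.fderiv (𝕜 := ℝ))
  have hC0 : 0 ≤ C := (norm_nonneg _).trans (hC 0)
  have key := hasDerivAt_integral_of_dominated_loc_of_deriv_le (μ := (volume : Measure E2)) (x₀ := t)
    (F := fun t y => W (x + t • y) * k2 y) (F' := fun t y => k2 y * fderiv ℝ W (x + t • y) y)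
    (bound := fun y => k2 y * (C * ‖y‖)) (s := Set.univ) univ_mem
    (Eventually.of_forall fun t => Continuous.aestronglyMeasurable (by fun_prop))
    (Continuous.integrable_of_hasCompactSupport (by fun_prop) supp_k2.mul_left)
    (Continuous.aestronglyMeasurable (c2.mul ((hcf.comp (by fun_prop)).clm_apply continuous_id)))
    (Eventually.of_forall fun y t _ => by
      rw [norm_mul, Real.norm_eq_abs, abs_of_nonneg (k2_nonneg y)]
      exact mul_le_mul_of_nonneg_left (((fderiv ℝ W (x + t • y)).le_opNorm y).trans
        (mul_le_mul_of_nonneg_right (hC _) (norm_nonneg _))) (k2_nonneg y))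
    (Continuous.integrable_of_hasCompactSupport (by fun_prop) supp_k2.mul_right)
    (Eventually.of_forall fun y t _ => by
      have d1 : HasDerivAt (fun t : ℝ => x + t • y) y t := by
        simpa using ((hasDerivAt_id t).smul_const y).const_add x
      have d2 := ((hW.differentiable (by norm_num)) (x + t • y)).hasFDerivAt.comp_hasDerivAt t d1
      have := d2.mul_const (k2 y)
      rw [mul_comm (k2 y)]
      exact this)
  have k1 := key.2.const_mul (3 / π)
  refine k1.congr_deriv ?_
  have := ibp_kk hW x t
  have e : ∫ y, lap W (x + t • y) * (kk y / (2 * π)) = (∫ y, lap W (x + t • y) * kk y) / (2 * π) := by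
    rw [← integral_div]; congr 1; ext y; ring
  rw [e, ← mul_div_assoc, ← this]; field_simp; ring

lemma cont_inner {W : E2 → ℝ} (hW : ContDiff ℝ 2 W) (x : E2) :
    Continuous (fun t : ℝ => t * ∫ y, lap W (x + t • y) * (kk y / (2 * π))) := by
  have hcl : Continuous (lap W) := by
    have := cont_lap isOpen_univ hW.contDiffOn
    rwa [continuousOn_univ] at this
  have c1 := cont_kk
  apply continuous_id.mul
  have : Continuous (fun q : ℝ × E2 => lap W (x + q.1 • q.2) * (kk q.2 / (2 * π))) :=
    (hcl.comp (by fun_prop)).mul (by fun_prop)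
  have h2 := continuous_parametric_integral_of_continuous (μ := (volume : Measure E2)) (f := fun (t : ℝ) (y : E2) => lap W (x + t • y) * (kk y / (2 * π)))
    this (isCompact_closedBall (0:E2) 1)
  refine h2.congr fun t => ?_
  apply setIntegral_eq_integral_of_forall_compl_eq_zero
  intro y hy
  rw [kk_zero (by rw [mem_closedBall_zero_iff] at hy; linarith)]; simp

lemma mean_global {W : E2 → ℝ} (hW : ContDiff ℝ 2 W) (hWs : HasCompactSupport W) (x : E2) (s : ℝ) :
    W x = (3 / π) * (∫ y, W (x + s • y) * k2 y) +
      ∫ t in (0:ℝ)..s, t * ∫ y, (-lap W (x + t • y)) * (kk y / (2 * π)) := by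
  have hcont := cont_inner hW x
  have h := intervalIntegral.integral_eq_sub_of_hasDerivAt (a := 0) (b := s) (fun t _ => mean_deriv hW hWs x t)
    (hcont.intervalIntegrable _ _)
  have e0 : (3 / π) * ∫ y, W (x + (0:ℝ) • y) * k2 y = W x := by
    simp only [zero_smul, add_zero]
    rw [integral_const_mul, int_k2]; field_simp
  rw [e0] at h
  have e1 : ∫ t in (0:ℝ)..s, t * ∫ y, (-lap W (x + t • y)) * (kk y / (2 * π)) =
      - ∫ t in (0:ℝ)..s, t * ∫ y, lap W (x + t • y) * (kk y / (2 * π)) := by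
    rw [← intervalIntegral.integral_neg]
    congr 1; ext t
    simp only [neg_mul, integral_neg, mul_neg]
  rw [e1, h]; ring

lemma lap_congr {f g : E2 → ℝ} {x : E2} (h : f =ᶠ[𝓝 x] g) : lap f x = lap g x := by
  unfold lap
  refine Finset.sum_congr rfl fun i _ => ?_
  have h2 : (fun y => fderiv ℝ f y (EuclideanSpace.single i 1)) =ᶠ[𝓝 x] fun y => fderiv ℝ g y (EuclideanSpace.single i 1) := by
    filter_upwards [h.fderiv (𝕜 := ℝ)] with y hy
    rw [hy]
  rw [h2.fderiv_eq]

lemma mean_local {O : Set E2} (hO : IsOpen O) {u : E2 → ℝ} (hu : ContDiffOn ℝ 2 u O) {x : E2} {s : ℝ} (hs : 0 < s)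
    (hsub : closedBall x s ⊆ O) :
    u x = (3 / π) * (∫ y, u (x + s • y) * k2 y) +
      (∫ t in (0:ℝ)..s, t * ∫ y, (-lap u (x + t • y)) * (kk y / (2 * π))) ∧
    IntervalIntegrable (fun t : ℝ => t * ∫ y, (-lap u (x + t • y)) * (kk y / (2 * π))) volume 0 s := by
  obtain ⟨d, hd, hd2⟩ := (isCompact_closedBall x s).exists_cthickening_subset_open hO hsub
  rw [cthickening_closedBall hd.le hs.le] at hd2
  let f : ContDiffBump x := ⟨s, d + s, hs, by linarith⟩
  have hX : ContDiffOn ℝ 2 (fun y => f y * u y) O := (f.contDiff (n := 2)).contDiffOn.mul hu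
  obtain ⟨g1, g2, -, -⟩ := ext_c1 hO (isCompact_closedBall x (d + s)) hd2 hX (fun y _ hy => by
    rw [f.zero_of_le_dist, zero_mul]
    simp only [mem_closedBall, not_le] at hy
    exact hy.le)
  set W := O.indicator (fun y => f y * u y) with hW
  have hWu : ∀ y ∈ closedBall x s, W y = u y := by
    intro y hy
    rw [hW, Set.indicator_of_mem (hsub hy)]
    rw [f.one_of_mem_closedBall hy, one_mul]
  have hlap : ∀ y ∈ ball x s, lap W y = lap u y := by
    intro y hy
    apply lap_congr
    filter_upwards [isOpen_ball.mem_nhds hy] with z hz using hWu z (ball_subset_closedBall hz)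
  have h := mean_global g1 g2 x s
  rw [hWu x (mem_closedBall_self hs.le)] at h
  have key : ∀ t ∈ Set.Icc (0:ℝ) s, t * (∫ y, (-lap W (x + t • y)) * (kk y / (2 * π))) =
      t * ∫ y, (-lap u (x + t • y)) * (kk y / (2 * π)) := by
    intro t ht
    congr 2; ext y
    by_cases hy : ‖y‖ < 1
    · rw [hlap]
      rw [mem_ball, dist_self_add_left, norm_smul, Real.norm_eq_abs, abs_of_nonneg ht.1]
      have := norm_nonneg y
      rcases eq_or_lt_of_le ht.1 with h0 | h0
      · rw [← h0]; simpa using hs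
      · nlinarith [ht.2]
    · rw [kk_zero (not_lt.mp hy)]; simp
  refine ⟨?_, ?_⟩
  · rw [h]
    congr 1
    · congr 2; ext y
      by_cases hy : ‖y‖ < 1
      · rw [hWu]
        rw [mem_closedBall, dist_self_add_left, norm_smul, Real.norm_eq_abs, abs_of_pos hs]
        nlinarith
      · rw [k2_zero (not_lt.mp hy)]; simp
    · apply intervalIntegral.integral_congr
      intro t ht
      rw [Set.uIcc_of_le hs.le] at ht
      exact key t ht
  · have c := (cont_inner g1 x).neg
    have ci := c.intervalIntegrable (μ := volume) 0 s
    refine ci.congr ?_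
    intro t ht
    rw [Set.uIoc_of_le hs.le] at ht
    have := key t ⟨ht.1.le, ht.2⟩
    show _ = t * ∫ y, (-lap u (x + t • y)) * (kk y / (2 * π))
    rw [← this]
    simp only [neg_mul, integral_neg, mul_neg]
    rfl

/-- change of variables -/
lemma scale_int (g k : E2 → ℝ) (x : E2) {t : ℝ} (ht : 0 < t) :
    ∫ y, g (x + t • y) * k y = (t ^ 2)⁻¹ * ∫ z, g z * k (t⁻¹ • (z - x)) := by
  have h := Measure.integral_comp_smul (volume : Measure E2) (fun z => g (x + z) * k (t⁻¹ • z)) t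
  simp only [finrank_euclideanSpace_fin] at h
  have e : ∀ y : E2, t⁻¹ • t • y = y := fun y => by rw [smul_smul, inv_mul_cancel₀ ht.ne', one_smul]
  simp only [e] at h
  rw [h, abs_of_pos (by positivity), smul_eq_mul]
  congr 1
  rw [← integral_add_left_eq_self (fun z => g z * k (t⁻¹ • (z - x))) x]
  simp
end

section
/-- data for one sign -/
structure PV (Ω O : Set E2) (u : E2 → ℝ) (p M ε : ℝ) (xn : E2) : Prop where
  H : LES Ω u p 0 M
  Oo : IsOpen O
  OΩ : O ⊆ Ω
  pos : ∀ y ∈ O, 0 < u y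
  hM : u xn = M
  hε : 0 < ε
  hεd : ε ^ 2 * (p * M ^ (p - 1)) = 1
  M1 : 1 ≤ M

variable {Ω O : Set E2} {u : E2 → ℝ} {p M ε : ℝ} {xn : E2}

lemma PV.hp (P : PV Ω O u p M ε xn) : 1 < p := P.H.hp
lemma PV.eM (P : PV Ω O u p M ε xn) : ε ^ 2 * (p * M ^ p) = M := by
  have h := P.hεd
  have hM : 0 < M := by linarith [P.M1]
  rw [Real.rpow_sub_one hM.ne'] at h
  field_simp at h
  linarith
lemma PV.leM (P : PV Ω O u p M ε xn) {y : E2} (hy : y ∈ O) : u y ≤ M := P.H.leM y (P.OΩ hy)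
lemma PV.c2 (P : PV Ω O u p M ε xn) : ContDiffOn ℝ 2 u O := P.H.c2.mono P.OΩ
lemma PV.eqn (P : PV Ω O u p M ε xn) {y : E2} (hy : y ∈ O) : -lap u y = (u y) ^ p :=
  P.H.eqn y (P.OΩ hy) (P.pos y hy)
lemma PV.powle (P : PV Ω O u p M ε xn) {y : E2} (hy : y ∈ O) : (u y) ^ p ≤ M ^ p :=
  Real.rpow_le_rpow (P.pos y hy).le (P.leM hy) (by linarith [P.hp])
lemma PV.cpow (P : PV Ω O u p M ε xn) : ContinuousOn (fun y => (u y) ^ p) O :=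
  P.c2.continuousOn.rpow_const fun y hy => Or.inl (P.pos y hy).ne'

lemma mem_cb {x y : E2} {s t : ℝ} (ht : 0 ≤ t) (hts : t ≤ s) (hy : ‖y‖ ≤ 1) : x + t • y ∈ closedBall x s := by
  rw [mem_closedBall, dist_self_add_left, norm_smul, Real.norm_eq_abs, abs_of_nonneg ht]
  nlinarith [norm_nonneg y]

/-- inner term bound -/
lemma PV.inner_bd (P : PV Ω O u p M ε xn) {x : E2} {s t : ℝ} (hsub : closedBall x s ⊆ O) (ht : 0 ≤ t) (hts : t ≤ s) :
    ∫ y, (-lap u (x + t • y)) * (kk y / (2 * π)) ≤ M ^ p / 2 := by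
  have hM : 0 < M := by linarith [P.M1]
  have h1 : ∫ y, (-lap u (x + t • y)) * (kk y / (2 * π)) ≤ ∫ y, M ^ p / (2 * π) * kk y := by
    apply integral_mono_of_nonneg
    · refine Eventually.of_forall fun y => ?_
      show 0 ≤ (-lap u (x + t • y)) * (kk y / (2 * π))
      by_cases hy : ‖y‖ < 1
      · have hO := hsub (mem_cb ht hts hy.le (x := x))
        rw [P.eqn hO]
        have := kk_nonneg y
        have := Real.rpow_nonneg (P.pos _ hO).le p
        positivity
      · rw [kk_zero (not_lt.mp hy)]; simp
    · exact (cont_kk.integrable_of_hasCompactSupport supp_kk).const_mul _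
    · refine Eventually.of_forall fun y => ?_
      show (-lap u (x + t • y)) * (kk y / (2 * π)) ≤ M ^ p / (2 * π) * kk y
      by_cases hy : ‖y‖ < 1
      · have hO := hsub (mem_cb ht hts hy.le (x := x))
        rw [P.eqn hO, div_mul_eq_mul_div, ← mul_div_assoc]
        have := kk_nonneg y
        have := P.powle hO
        gcongr
      · rw [kk_zero (not_lt.mp hy)]; simp
  rw [integral_const_mul] at h1
  have h2 : M ^ p / (2 * π) * ∫ y, kk y ≤ M ^ p / (2 * π) * π :=
    mul_le_mul_of_nonneg_left int_kk_le (by positivity)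
  have h3 : M ^ p / (2 * π) * π = M ^ p / 2 := by field_simp
  linarith

lemma PV.inner_nn (P : PV Ω O u p M ε xn) {x : E2} {s t : ℝ} (hsub : closedBall x s ⊆ O) (ht : 0 ≤ t) (hts : t ≤ s) :
    0 ≤ ∫ y, (-lap u (x + t • y)) * (kk y / (2 * π)) := by
  apply integral_nonneg
  intro y
  show 0 ≤ (-lap u (x + t • y)) * (kk y / (2 * π))
  by_cases hy : ‖y‖ < 1
  · have hO := hsub (mem_cb ht hts hy.le (x := x))
    rw [P.eqn hO]
    have := kk_nonneg y
    have := Real.rpow_nonneg (P.pos _ hO).le p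
    positivity
  · rw [kk_zero (not_lt.mp hy)]; simp

lemma PV.mean_lower (P : PV Ω O u p M ε xn) {x : E2} {s : ℝ} (hs : 0 < s) (hsub : closedBall x s ⊆ O) :
    u x - s ^ 2 / 4 * M ^ p ≤ (3 / π) * ∫ y, u (x + s • y) * k2 y := by
  obtain ⟨h, hi⟩ := mean_local P.Oo P.c2 hs hsub
  have hb : ∫ t in (0:ℝ)..s, t * ∫ y, (-lap u (x + t • y)) * (kk y / (2 * π)) ≤ ∫ t in (0:ℝ)..s, t * (M ^ p / 2) := by
    apply intervalIntegral.integral_mono_on_of_le_Ioo hs.le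
    · exact hi
    · apply Continuous.intervalIntegrable; fun_prop
    · intro t ht
      exact mul_le_mul_of_nonneg_left (P.inner_bd hsub ht.1.le ht.2.le) ht.1.le
  have e : ∫ t in (0:ℝ)..s, t * (M ^ p / 2) = s ^ 2 / 4 * M ^ p := by
    rw [intervalIntegral.integral_mul_const, integral_id]; ring
  linarith

lemma pow_lower {κ : ℝ} (hκ : 0 ≤ κ) (hp : 0 < p) (h : 2 * κ ≤ p) : Real.exp (-(2 * κ)) ≤ (1 - κ / p) ^ p := by
  set x := κ / p with hx
  have hx0 : 0 ≤ x := by positivity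
  have hx1 : x ≤ 1 / 2 := by rw [hx, div_le_iff₀ hp]; linarith
  have h1 : Real.exp (-(2 * x)) ≤ 1 - x := by
    rw [Real.exp_neg, inv_le_comm₀ (Real.exp_pos _) (by linarith)]
    have := Real.add_one_le_exp (2 * x)
    refine le_trans ?_ this
    rw [inv_le_iff_one_le_mul₀ (by linarith)]
    nlinarith
  have h2 := Real.rpow_le_rpow (Real.exp_pos _).le h1 hp.le
  rw [← Real.exp_mul] at h2
  convert h2 using 2
  rw [hx]; field_simp

/-- the good part of a ball -/
def gset (u : E2 → ℝ) (x : E2) (ε c : ℝ) : Set E2 := ball x ε \ (ball x ε ∩ u ⁻¹' Set.Iio c)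

lemma mem_gset {x z : E2} {c : ℝ} : z ∈ gset u x ε c ↔ z ∈ ball x ε ∧ c ≤ u z := by
  simp only [gset, Set.mem_sdiff, Set.mem_inter_iff, Set.mem_preimage, Set.mem_Iio, not_and, not_lt]
  tauto

lemma meas_gset {x : E2} {c : ℝ} (hu : ContinuousOn u (ball x ε)) : MeasurableSet (gset u x ε c) :=
  measurableSet_ball.diff (hu.isOpen_inter_preimage isOpen_ball isOpen_Iio).measurableSet

lemma PV.area (P : PV Ω O u p M ε xn) {x : E2} (hsub : closedBall x ε ⊆ O) {T : ℝ} (hT : 0 ≤ T)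
    (hx : M * (1 - T / p) ≤ u x) :
    ε ^ 2 * (π / 6) ≤ volume.real (gset u x ε (M * (1 - (2 * T + 1 / 2) / p))) := by
  have hM : 0 < M := by linarith [P.M1]
  have hp := P.hp
  have hε := P.hε
  have hub : ContinuousOn u (closedBall x ε) := P.c2.continuousOn.mono hsub
  set c := M * (1 - (2 * T + 1 / 2) / p) with hc
  set lam := M * (2 * T + 1 / 2) / p with hlam
  have hlam0 : 0 < lam := by positivity
  have hcl : c = M - lam := by rw [hc, hlam]; ring
  have hE := meas_gset (c := c) (hub.mono ball_subset_closedBall)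
  set E := gset u x ε c with hEdef
  have hEb : E ⊆ ball x ε := fun z hz => (mem_gset.mp hz).1
  set k : E2 → ℝ := fun z => k2 (ε⁻¹ • (z - x)) with hk
  have hkc : Continuous k := by have := cont_k2; rw [hk]; fun_prop
  have hk0 : ∀ z, z ∉ ball x ε → k z = 0 := by
    intro z hz
    apply k2_zero
    rw [norm_smul, norm_inv, Real.norm_eq_abs, abs_of_pos hε, ← dist_eq_norm]
    rw [mem_ball, not_lt] at hz
    rw [inv_mul_eq_div, le_div_iff₀ hε]; linarith
  have I1 : ∫ z in ball x ε, k z = ε ^ 2 * (π / 3) := by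
    rw [setIntegral_eq_integral_of_forall_compl_eq_zero hk0]
    have := scale_int (fun _ => 1) k2 x hε
    simp only [one_mul, int_k2] at this
    rw [this, mul_inv_cancel_left₀ (by positivity)]
  have I2 : ∫ z in ball x ε, u z * k z = ε ^ 2 * ∫ y, u (x + ε • y) * k2 y := by
    rw [setIntegral_eq_integral_of_forall_compl_eq_zero (fun z hz => by rw [hk0 z hz, mul_zero])]
    rw [scale_int u k2 x hε, mul_inv_cancel_left₀ (by positivity)]
  have hml := P.mean_lower hε hsub
  have heM : ε ^ 2 / 4 * M ^ p = M / (4 * p) := by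
    have := P.eM; field_simp; linarith
  have I3 : ε ^ 2 * (π / 3) * (M - lam / 2) ≤ ∫ z in ball x ε, u z * k z := by
    rw [I2, mul_assoc]
    apply mul_le_mul_of_nonneg_left _ (by positivity)
    have h1 : M - lam / 2 ≤ (3 / π) * ∫ y, u (x + ε • y) * k2 y := by
      refine le_trans ?_ hml
      rw [heM, hlam]
      have : M * (1 - T / p) - M / (4 * p) = M - M * (2 * T + 1 / 2) / p / 2 := by field_simp; ring
      linarith
    calc π / 3 * (M - lam / 2) ≤ π / 3 * ((3 / π) * ∫ y, u (x + ε • y) * k2 y) :=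
          mul_le_mul_of_nonneg_left h1 (by positivity)
      _ = _ := by field_simp
  have ik : IntegrableOn k (ball x ε) := (hkc.continuousOn.integrableOn_compact (isCompact_closedBall x ε)).mono_set ball_subset_closedBall
  have iuk : IntegrableOn (fun z => u z * k z) (ball x ε) :=
    ((hub.mul hkc.continuousOn).integrableOn_compact (isCompact_closedBall x ε)).mono_set ball_subset_closedBall
  have iE : IntegrableOn (E.indicator (fun _ => (1:ℝ))) (ball x ε) := by
    refine IntegrableOn.indicator ?_ hE
    exact integrableOn_const measure_ball_lt_top.ne
  have I4 : ∫ z in ball x ε, E.indicator (fun _ => (1:ℝ)) z = volume.real E := by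
    rw [integral_indicator_const _ hE, measureReal_restrict_apply hE, Set.inter_eq_left.mpr hEb]; simp
  have main : ∫ z in ball x ε, lam * (k z - E.indicator (fun _ => (1:ℝ)) z) ≤ ∫ z in ball x ε, (M * k z - u z * k z) := by
    refine setIntegral_mono_on ((ik.sub iE).const_mul _) ((ik.const_mul _).sub iuk) measurableSet_ball ?_
    intro z hz
    have hzO := hsub (ball_subset_closedBall hz)
    have h1 := P.leM hzO
    have h2 : 0 ≤ k z := k2_nonneg _
    have h3 : k z ≤ 1 := k2_le _
    by_cases hzE : z ∈ E
    · rw [Set.indicator_of_mem hzE]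
      nlinarith [mul_nonneg (sub_nonneg.mpr h1) h2, mul_nonneg hlam0.le (sub_nonneg.mpr h3)]
    · rw [Set.indicator_of_notMem hzE]
      have : u z < c := by
        by_contra h; exact hzE (mem_gset.mpr ⟨hz, not_lt.mp h⟩)
      nlinarith
  rw [integral_const_mul, integral_sub ik iE, integral_sub (by exact ik.const_mul _) iuk, integral_const_mul, I1, I4] at main
  have : lam * (ε ^ 2 * (π / 6)) ≤ lam * volume.real E := by
    nlinarith
  exact le_of_mul_le_mul_left this hlam0

lemma PV.mass (P : PV Ω O u p M ε xn) {x : E2} (hsub : closedBall x ε ⊆ O) {T : ℝ} (hT : 0 ≤ T)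
    (hx : M * (1 - T / p) ≤ u x) (hTp : 2 * (2 * T + 1 / 2) ≤ p) :
    π / 6 * Real.exp (-(2 * (2 * T + 1 / 2))) * M ≤ p * ∫ z in ball x ε, (u z) ^ p := by
  have hM : 0 < M := by linarith [P.M1]
  have hp := P.hp
  have hε := P.hε
  have ha := P.area hsub hT hx
  set κ := 2 * T + 1 / 2 with hκ
  have hκ0 : 0 ≤ κ := by positivity
  have hpl := pow_lower hκ0 (by linarith) hTp
  have hq0 : 0 ≤ 1 - κ / p := by
    have : κ / p ≤ 1 := by rw [div_le_one (by linarith)]; linarith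
    linarith
  have hub : ContinuousOn u (closedBall x ε) := P.c2.continuousOn.mono hsub
  have hE := meas_gset (c := M * (1 - κ / p)) (hub.mono ball_subset_closedBall)
  have ip : IntegrableOn (fun z => (u z) ^ p) (ball x ε) :=
    ((P.cpow.mono hsub).integrableOn_compact (isCompact_closedBall x ε)).mono_set ball_subset_closedBall
  have hsub' : gset u x ε (M * (1 - κ / p)) ⊆ ball x ε := fun z hz => (mem_gset.mp hz).1
  have h1 : ∫ z in gset u x ε (M * (1 - κ / p)), (u z) ^ p ≤ ∫ z in ball x ε, (u z) ^ p := by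
    apply setIntegral_mono_set ip
    · refine (ae_restrict_mem measurableSet_ball).mono fun z hz => ?_
      exact Real.rpow_nonneg (P.pos z (hsub (ball_subset_closedBall hz))).le p
    · exact Eventually.of_forall hsub'
  have h2 : (M * (1 - κ / p)) ^ p * volume.real (gset u x ε (M * (1 - κ / p))) ≤ ∫ z in gset u x ε (M * (1 - κ / p)), (u z) ^ p := by
    have hfin : volume (gset u x ε (M * (1 - κ / p))) ≠ ⊤ := ((measure_mono hsub').trans_lt measure_ball_lt_top).ne
    have := setIntegral_mono_on (μ := volume) (s := gset u x ε (M * (1 - κ / p))) (f := fun _ => (M * (1 - κ / p)) ^ p) (g := fun z => (u z) ^ p)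
      (integrableOn_const hfin) (ip.mono_set hsub') hE
      (fun z hz => Real.rpow_le_rpow (by positivity) (mem_gset.mp hz).2 (by linarith))
    rw [setIntegral_const, smul_eq_mul, mul_comm] at this
    exact this
  have h3 : Real.exp (-(2 * κ)) * M ^ p * (ε ^ 2 * (π / 6)) ≤ (M * (1 - κ / p)) ^ p * volume.real (gset u x ε (M * (1 - κ / p))) := by
    rw [Real.mul_rpow hM.le hq0]
    apply mul_le_mul _ ha (by positivity) (by positivity)
    rw [mul_comm]
    exact mul_le_mul_of_nonneg_left hpl (by positivity)
  calc π / 6 * Real.exp (-(2 * κ)) * M = p * (Real.exp (-(2 * κ)) * M ^ p * (ε ^ 2 * (π / 6))) := by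
        nth_rewrite 1 [← P.eM]; ring
    _ ≤ _ := mul_le_mul_of_nonneg_left (h3.trans (h2.trans h1)) (by linarith)
end

section
variable {Ω O : Set E2} {u : E2 → ℝ} {p M ε : ℝ} {xn : E2}

lemma PV.int_le_mm (P : PV Ω O u p M ε xn) {S : Set E2} (hS : S ⊆ O) :
    ∫ z in S, (u z) ^ p ≤ mm Ω u p 0 := by
  have hp := P.hp
  apply setIntegral_mono_set (P.H.intpow le_rfl (by linarith))
  · refine (ae_restrict_mem (P.H.isOpen_sl 0).measurableSet).mono fun z hz => ?_
    exact Real.rpow_nonneg hz.2.le p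
  · exact Eventually.of_forall fun z hz => ⟨P.OΩ (hS hz), P.pos z (hS hz)⟩

/-- some sphere is low -/
lemma PV.lowsphere (P : PV Ω O u p M ε xn) {T K : ℝ} (hT : 0 ≤ T) (hTp : 2 * (2 * T + 1 / 2) ≤ p)
    (hK : p * mm Ω u p 0 ≤ K * M) {J : ℕ} (hJ : K < (J + 1) * (π / 6 * Real.exp (-(2 * (2 * T + 1 / 2)))))
    (hsub : closedBall xn ((3 * J + 3) * ε) ⊆ O) :
    ∃ j : ℕ, j ≤ J ∧ ∀ y ∈ sphere xn ((3 * j + 2) * ε), u y < M * (1 - T / p) := by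
  by_contra hcon
  push Not at hcon
  have hM : 0 < M := by linarith [P.M1]
  have hp := P.hp
  have hε := P.hε
  choose! y hy using hcon
  have hin : ∀ j, j ≤ J → ∀ z ∈ closedBall (y j) ε, z ∈ O := by
    intro j hj z hz
    apply hsub
    have h1 := (hy j hj).1
    rw [mem_sphere] at h1
    rw [mem_closedBall] at hz ⊢
    have := dist_triangle z (y j) xn
    have hjJ : (j:ℝ) ≤ J := by exact_mod_cast hj
    nlinarith
  have hmass : ∀ j ∈ Finset.range (J + 1), π / 6 * Real.exp (-(2 * (2 * T + 1 / 2))) * M ≤ p * ∫ z in ball (y j) ε, (u z) ^ p := by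
    intro j hj
    have hj' : j ≤ J := by simpa [Nat.lt_succ_iff] using hj
    exact P.mass (fun z hz => hin j hj' z hz) hT (hy j hj').2 hTp
  have hsum := Finset.sum_le_sum hmass
  rw [Finset.sum_const, Finset.card_range, ← Finset.mul_sum] at hsum
  have hdis : Set.Pairwise (↑(Finset.range (J + 1))) (Function.onFun Disjoint fun j => ball (y j) ε) := by
    intro i hi j hj hij
    have hi' : i ≤ J := by simpa [Nat.lt_succ_iff] using hi
    have hj' : j ≤ J := by simpa [Nat.lt_succ_iff] using hj
    rw [Function.onFun, Set.disjoint_left]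
    intro z hz1 hz2
    have d1 := (hy i hi').1
    have d2 := (hy j hj').1
    rw [mem_sphere] at d1 d2
    rw [mem_ball] at hz1 hz2
    have t1 := abs_dist_sub_le z (y i) xn
    have t2 := abs_dist_sub_le z (y j) xn
    rw [d1] at t1
    rw [d2] at t2
    have b1 := abs_le.mp t1
    have b2 := abs_le.mp t2
    rcases lt_or_gt_of_ne hij with h | h
    · have : (i:ℝ) + 1 ≤ j := by exact_mod_cast h
      nlinarith
    · have : (j:ℝ) + 1 ≤ i := by exact_mod_cast h
      nlinarith
  have hU : ∑ j ∈ Finset.range (J + 1), ∫ z in ball (y j) ε, (u z) ^ p ≤ mm Ω u p 0 := by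
    rw [← integral_biUnion_finset _ (fun j _ => measurableSet_ball) hdis]
    · apply P.int_le_mm
      intro z hz
      simp only [Set.mem_iUnion] at hz
      obtain ⟨j, hj, hz⟩ := hz
      exact hin j (by simpa [Nat.lt_succ_iff] using hj) z (ball_subset_closedBall hz)
    · intro j hj
      exact ((P.cpow.mono (fun z hz => hin j (by simpa [Nat.lt_succ_iff] using hj) z hz)).integrableOn_compact (isCompact_closedBall (y j) ε)).mono_set ball_subset_closedBall
  have h2 := mul_le_mul_of_nonneg_left hU (by linarith : 0 ≤ p)
  rw [nsmul_eq_mul] at hsum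
  push_cast at hsum
  have h3 := mul_lt_mul_of_pos_right hJ hM
  linarith

lemma PV.les_ball (P : PV Ω O u p M ε xn) {R T : ℝ} (hTp : T ≤ p)
    (hsub : closedBall xn R ⊆ O) (hsp : ∀ y ∈ sphere xn R, u y < M * (1 - T / p)) :
    LES (ball xn R) u p (M * (1 - T / p)) M := by
  have hM : 0 < M := by linarith [P.M1]
  have hp := P.hp
  have hbO : ball xn R ⊆ O := ball_subset_closedBall.trans hsub
  have h0 : 0 ≤ M * (1 - T / p) := by
    have : T / p ≤ 1 := by rw [div_le_one (by linarith)]; exact hTp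
    exact mul_nonneg hM.le (by linarith)
  refine ⟨isOpen_ball, isBounded_ball, P.c2.mono hbO, ?_, fun x hx _ => P.eqn (hbO hx), h0, hp, fun x hx => P.leM (hbO hx)⟩
  intro t ht
  have e : {x | x ∈ ball xn R ∧ t ≤ u x} = closedBall xn R ∩ u ⁻¹' Set.Ici t := by
    ext y
    constructor
    · rintro ⟨h1, h2⟩; exact ⟨ball_subset_closedBall h1, h2⟩
    · rintro ⟨h1, h2⟩
      refine ⟨?_, h2⟩
      rw [mem_ball]
      rcases (mem_closedBall.mp h1).lt_or_eq with h | h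
      · exact h
      · have := hsp y h
        have h3 : t ≤ u y := h2
        linarith
  rw [e]
  exact (isCompact_closedBall xn R).of_isClosed_subset
    ((P.c2.continuousOn.mono hsub).preimage_isClosed_of_isClosed isClosed_closedBall isClosed_Ici) Set.inter_subset_left

lemma LES.choose_t {D : Set E2} {t0 t2 : ℝ} (H : LES D u p t0 M) (h2 : t0 < t2) (h2M : t2 ≤ M) :
    ∃ t, t0 < t ∧ t ≤ t2 ∧ (p + 1) * (t2 - t0) * (t ^ p * mu D u t) ≤ ee D u p t0 := by
  by_contra hcon
  push Not at hcon
  have hp := H.hp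
  have h0 := H.t0nn
  have hIntg : ∀ a b : ℝ, IntervalIntegrable (fun τ => τ ^ p * mu D u τ) volume a b := by
    intro a b
    apply IntervalIntegrable.continuousOn_mul
    · exact H.mu_anti.intervalIntegrable
    · exact (Real.continuous_rpow_const (by linarith)).continuousOn
  have hf := H.fub_mu h0 (h2.le.trans h2M)
  have hmu := mu_nonneg (D := D) (u := u) t0
  have h3 : (p + 1) * ∫ τ in t0..M, τ ^ p * mu D u τ ≤ ee D u p t0 := by
    rw [hf]; have := mul_nonneg (Real.rpow_nonneg h0 (p + 1)) hmu; linarith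
  set c := ee D u p t0 / ((p + 1) * (t2 - t0)) with hc
  have hd : 0 < (p + 1) * (t2 - t0) := mul_pos (by linarith) (by linarith)
  have hgt : ∀ t, t0 < t → t ≤ t2 → c < t ^ p * mu D u t := by
    intro t ht ht2
    rw [hc, div_lt_iff₀ hd, mul_comm]; exact hcon t ht ht2
  have h4 : ∫ τ in t0..t2, c < ∫ τ in t0..t2, τ ^ p * mu D u τ := by
    apply intervalIntegral.integral_lt_integral_of_ae_le_of_measure_setOfPred_lt_ne_zero h2.le intervalIntegrable_const (hIntg _ _)
    · refine (ae_restrict_mem measurableSet_Ioc).mono fun τ hτ => (hgt τ hτ.1 hτ.2).le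
    · have : volume (Set.Ioc t0 t2) ≤ (volume.restrict (Set.Ioc t0 t2)) {x | c < x ^ p * mu D u x} := by
        rw [← Measure.restrict_apply_self]
        exact measure_mono fun τ hτ => hgt τ hτ.1 hτ.2
      intro h
      rw [h, Real.volume_Ioc] at this
      simp at this; linarith
  rw [intervalIntegral.integral_const, smul_eq_mul] at h4
  have h5 : ∫ τ in t0..t2, τ ^ p * mu D u τ ≤ ∫ τ in t0..M, τ ^ p * mu D u τ := by
    rw [← intervalIntegral.integral_add_adjacent_intervals (hIntg t0 t2) (hIntg t2 M)]
    have : 0 ≤ ∫ τ in t2..M, τ ^ p * mu D u τ := by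
      apply intervalIntegral.integral_nonneg h2M
      intro τ hτ
      exact mul_nonneg (Real.rpow_nonneg (by linarith [hτ.1]) _) (mu_nonneg _)
    linarith
  have h6 : (p + 1) * ((t2 - t0) * c) = ee D u p t0 := by
    rw [hc, ← mul_assoc, mul_div_cancel₀ _ hd.ne']
  have h7 : (p + 1) * ((t2 - t0) * c) < (p + 1) * ∫ τ in t0..t2, τ ^ p * mu D u τ := mul_lt_mul_of_pos_left h4 (by linarith)
  have h8 := mul_le_mul_of_nonneg_left h5 (by linarith : 0 ≤ p + 1)
  linarith

lemma PV.cpow1 (P : PV Ω O u p M ε xn) : ContinuousOn (fun y => (u y) ^ (p + 1)) O :=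
  P.c2.continuousOn.rpow_const fun y hy => Or.inl (P.pos y hy).ne'

lemma PV.conc (P : PV Ω O u p M ε xn) {R T σ b0 : ℝ} (hT : 1 < T) (hR : ε ≤ R) (hσ0 : 0 < σ) (hσ1 : σ < 1)
    (hb : p * ee Ω u p 0 ≤ b0) (hbT : b0 / (T - 1) ≤ σ * (Real.exp (-1) * (π / 12)))
    (hp1 : 1 - σ ≤ p / (p + 1)) (hp2 : 1 - σ ≤ 1 - T / p)
    (hsub : closedBall xn R ⊆ O) (hsp : ∀ y ∈ sphere xn R, u y < M * (1 - T / p)) :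
    8 * π * (1 - σ) ^ 3 * M ≤ p * ∫ z in ball xn R, (u z) ^ p ∧
    8 * π * (1 - σ) ^ 4 * M ^ 2 ≤ p * ∫ z in ball xn R, (u z) ^ (p + 1) := by
  have hM : 0 < M := by linarith [P.M1]
  have hp := P.hp
  have hε := P.hε
  have hbO : ball xn R ⊆ O := ball_subset_closedBall.trans hsub
  have hTp : T ≤ p := by
    have : 0 < 1 - T / p := by linarith
    have : T / p < 1 := by linarith
    rw [div_lt_one (by linarith)] at this; exact this.le
  have HD := P.les_ball hTp hsub hsp
  set D := ball xn R with hD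
  set κ := 1 - T / p with hκ
  have hκ0 : 0 < κ := by linarith
  have hpp : 0 < p := by linarith
  have h12 : M * κ < M * (1 - 1 / p) := by
    apply mul_lt_mul_of_pos_left _ hM
    have : 1 / p < T / p := by gcongr
    linarith
  obtain ⟨t, ht0, ht2, htmu⟩ := HD.choose_t h12 (by have : 0 < 1 / p := by positivity
                                                    nlinarith)
  have htpos : 0 < t := lt_trans (by positivity) ht0
  have htM : t ≤ M := by
    have : 0 < 1 / p := by positivity
    nlinarith
  -- energies
  have iDp : IntegrableOn (fun z => (u z) ^ p) D :=
    ((P.cpow.mono hsub).integrableOn_compact (isCompact_closedBall xn R)).mono_set ball_subset_closedBall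
  have iDp1 : IntegrableOn (fun z => (u z) ^ (p + 1)) D :=
    ((P.cpow1.mono hsub).integrableOn_compact (isCompact_closedBall xn R)).mono_set ball_subset_closedBall
  have hslD : sl D u t ⊆ D := fun z hz => hz.1
  have mD : mm D u p t ≤ ∫ z in D, (u z) ^ p := by
    apply setIntegral_mono_set iDp
    · refine (ae_restrict_mem measurableSet_ball).mono fun z hz => Real.rpow_nonneg (P.pos z (hbO hz)).le p
    · exact Eventually.of_forall hslD
  have eD : ee D u p t ≤ ∫ z in D, (u z) ^ (p + 1) := by
    apply setIntegral_mono_set iDp1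
    · refine (ae_restrict_mem measurableSet_ball).mono fun z hz => Real.rpow_nonneg (P.pos z (hbO hz)).le _
    · exact Eventually.of_forall hslD
  have eD0 : ee D u p (M * κ) ≤ ee Ω u p 0 := by
    apply setIntegral_mono_set (P.H.intpow le_rfl (by linarith))
    · refine (ae_restrict_mem (P.H.isOpen_sl 0).measurableSet).mono fun z hz => Real.rpow_nonneg hz.2.le _
    · exact Eventually.of_forall fun z hz => ⟨P.OΩ (hbO hz.1), P.pos z (hbO hz.1)⟩
  -- C1
  have c1 := HD.C1 ht0 htM
  have fm := HD.fub_mu htpos.le htM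
  set A := p * mm D u p t with hA
  set B := p * ee D u p t with hB
  -- small term
  have hsmall : p * (t ^ (p + 1) * mu D u t) ≤ b0 / (T - 1) := by
    rw [le_div_iff₀ (by linarith)]
    have e1 : M * (1 - 1 / p) - M * κ = M * (T - 1) / p := by rw [hκ]; field_simp; ring
    rw [e1] at htmu
    have hmn := mu_nonneg (D := D) (u := u) t
    have hx : 0 ≤ t ^ p * mu D u t := mul_nonneg (Real.rpow_nonneg htpos.le _) hmn
    rw [Real.rpow_add_one htpos.ne']
    have h1 : M * (T - 1) * (t ^ p * mu D u t) ≤ ee D u p (M * κ) := by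
      refine le_trans ?_ htmu
      have : M * (T - 1) ≤ (p + 1) * (M * (T - 1) / p) := by
        rw [← mul_div_assoc, le_div_iff₀ hpp]
        have : 0 < M * (T - 1) := mul_pos hM (by linarith)
        nlinarith
      exact mul_le_mul_of_nonneg_right this hx
    have h2 : t * (T - 1) * (t ^ p * mu D u t) ≤ M * (T - 1) * (t ^ p * mu D u t) := by
      apply mul_le_mul_of_nonneg_right _ hx
      apply mul_le_mul_of_nonneg_right htM (by linarith)
    calc p * (t ^ p * t * mu D u t) * (T - 1) = p * (t * (T - 1) * (t ^ p * mu D u t)) := by ring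
      _ ≤ p * ee Ω u p 0 := mul_le_mul_of_nonneg_left (by linarith) hpp.le
      _ ≤ b0 := hb
  -- lower bound for B
  have hBlow : Real.exp (-1) * (π / 12) ≤ B := by
    have hxnO : xn ∈ O := hsub (mem_closedBall_self (by linarith))
    have ha := P.area (x := xn) (T := 0) ((closedBall_subset_closedBall hR).trans hsub) le_rfl (by rw [P.hM]; simp)
    rw [mul_zero, zero_add] at ha
    set q := 1 - 1 / 2 / p with hq
    have hq2 : 1 / 2 ≤ q := by
      have : 1 / 2 / p ≤ 1 / 2 := by rw [div_le_iff₀ hpp]; linarith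
      linarith
    have hpl : Real.exp (-(2 * (1 / 2))) ≤ q ^ p := pow_lower (p := p) (κ := 1 / 2) (by norm_num) hpp (by linarith)
    have hgs : gset u xn ε (M * q) ⊆ sl D u t := by
      intro z hz
      obtain ⟨h1, h2⟩ := mem_gset.mp hz
      refine ⟨ball_subset_ball hR h1, lt_of_lt_of_le (lt_of_le_of_lt ht2 ?_) h2⟩
      apply mul_lt_mul_of_pos_left _ hM
      have : 1 / 2 / p < 1 / p := by gcongr; norm_num
      rw [hq]; linarith
    have hgm : MeasurableSet (gset u xn ε (M * q)) := meas_gset (P.c2.continuousOn.mono ((ball_subset_ball hR).trans hbO))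
    have isl : IntegrableOn (fun z => (u z) ^ (p + 1)) (sl D u t) := iDp1.mono_set hslD
    have h1 : ∫ z in gset u xn ε (M * q), (u z) ^ (p + 1) ≤ ee D u p t := by
      apply setIntegral_mono_set isl
      · refine (ae_restrict_mem (HD.isOpen_sl t).measurableSet).mono fun z hz => Real.rpow_nonneg (htpos.le.trans hz.2.le) _
      · exact Eventually.of_forall hgs
    have h2 : (M * q) ^ (p + 1) * volume.real (gset u xn ε (M * q)) ≤ ∫ z in gset u xn ε (M * q), (u z) ^ (p + 1) := by
      have hfin : volume (gset u xn ε (M * q)) ≠ ⊤ := ((measure_mono hgs).trans_lt (HD.fin_sl t).lt_top).ne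
      have := setIntegral_mono_on (μ := volume) (f := fun _ => (M * q) ^ (p + 1)) (g := fun z => (u z) ^ (p + 1))
        (integrableOn_const hfin) (isl.mono_set hgs) hgm
        (fun z hz => Real.rpow_le_rpow (by positivity) (mem_gset.mp hz).2 (by linarith))
      rw [setIntegral_const, smul_eq_mul, mul_comm] at this
      exact this
    have h3 : M ^ p * M * (Real.exp (-1) * (1 / 2)) * (ε ^ 2 * (π / 6)) ≤ (M * q) ^ (p + 1) * volume.real (gset u xn ε (M * q)) := by
      rw [Real.mul_rpow hM.le (by linarith), Real.rpow_add_one hM.ne', Real.rpow_add_one (by linarith : q ≠ 0)]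
      apply mul_le_mul _ ha (by positivity) (by positivity)
      apply mul_le_mul_of_nonneg_left _ (by positivity)
      apply mul_le_mul _ hq2 (by norm_num) (by positivity)
      rwa [show -(2 * (1 / 2)) = (-1:ℝ) by norm_num] at hpl
    have h4 : Real.exp (-1) * (π / 12) * M ^ 2 ≤ B := by
      calc Real.exp (-1) * (π / 12) * M ^ 2 = p * (M ^ p * M * (Real.exp (-1) * (1 / 2)) * (ε ^ 2 * (π / 6))) := by
            have := P.eM
            calc _ = Real.exp (-1) * (π / 12) * M * M := by ring
              _ = Real.exp (-1) * (π / 12) * M * (ε ^ 2 * (p * M ^ p)) := by rw [this]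
              _ = _ := by ring
        _ ≤ B := mul_le_mul_of_nonneg_left (h3.trans (h2.trans h1)) hpp.le
    refine le_trans ?_ h4
    have : 1 ≤ M ^ 2 := by nlinarith [P.M1]
    exact le_mul_of_one_le_right (by positivity) this
  have hB0 : 0 < B := lt_of_lt_of_le (by positivity) hBlow
  have hA0 : 0 ≤ A := mul_nonneg hpp.le (mm_nonneg HD htpos.le)
  -- (i)
  have hi : 8 * π * (p / (p + 1)) * ((1 - σ) * B) ≤ A ^ 2 := by
    have k1 : 8 * π * (ee D u p t - t ^ (p + 1) * mu D u t) ≤ (p + 1) * (mm D u p t) ^ 2 := by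
      rw [← fm]
      have := mul_le_mul_of_nonneg_left c1 (by linarith : 0 ≤ 2 * (p + 1))
      linarith
    have k2 : 8 * π * (B - p * (t ^ (p + 1) * mu D u t)) * p ≤ (p + 1) * A ^ 2 := by
      have := mul_le_mul_of_nonneg_left k1 (by positivity : 0 ≤ p * p)
      rw [hA, hB]; linarith
    have k3 : (1 - σ) * B ≤ B - p * (t ^ (p + 1) * mu D u t) := by
      have : σ * (Real.exp (-1) * (π / 12)) ≤ σ * B := mul_le_mul_of_nonneg_left hBlow hσ0.le
      linarith
    have k4 : 8 * π * ((1 - σ) * B) * p ≤ (p + 1) * A ^ 2 := by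
      refine le_trans ?_ k2
      gcongr
    have : 8 * π * (p / (p + 1)) * ((1 - σ) * B) = 8 * π * ((1 - σ) * B) * p / (p + 1) := by field_simp
    rw [this, div_le_iff₀ (by linarith)]; linarith
  -- (ii)
  have hii : M * κ * A ≤ B := by
    have : M * κ * mm D u p t ≤ ee D u p t := by
      unfold mm ee
      rw [← integral_const_mul]
      refine setIntegral_mono_on ((iDp.mono_set hslD).const_mul _) (iDp1.mono_set hslD) (HD.isOpen_sl t).measurableSet ?_
      intro z hz
      have hz0 : 0 < u z := htpos.trans hz.2
      rw [Real.rpow_add_one hz0.ne', mul_comm]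
      exact mul_le_mul_of_nonneg_left (ht0.le.trans hz.2.le) (Real.rpow_nonneg hz0.le _)
    have := mul_le_mul_of_nonneg_left this hpp.le
    rw [hA, hB]; linarith
  have s1 : 0 < 1 - σ := by linarith
  have hi' : 8 * π * (1 - σ) * ((1 - σ) * B) ≤ A ^ 2 := by
    refine le_trans ?_ hi
    gcongr
  have hii' : M * (1 - σ) * A ≤ B := by
    refine le_trans ?_ hii
    gcongr
  have hApos : 0 < A := by
    rcases hA0.eq_or_lt with h | h
    · rw [← h] at hi'
      have : 0 < 8 * π * (1 - σ) * ((1 - σ) * B) := by positivity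
      linarith
    · exact h
  have hAf : 8 * π * (1 - σ) ^ 3 * M ≤ A := by
    have : 8 * π * (1 - σ) * ((1 - σ) * (M * (1 - σ) * A)) ≤ A ^ 2 := by
      refine le_trans ?_ hi'
      gcongr
    have h : (8 * π * (1 - σ) ^ 3 * M) * A ≤ A * A := by linarith
    exact le_of_mul_le_mul_right h hApos
  refine ⟨hAf.trans (mul_le_mul_of_nonneg_left mD hpp.le), le_trans ?_ (mul_le_mul_of_nonneg_left eD hpp.le)⟩
  refine le_trans ?_ hii'
  have := mul_le_mul_of_nonneg_left hAf (by positivity : 0 ≤ M * (1 - σ))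
  linarith
end

section
/-- smooth step -/
def stp (t s : ℝ) : ℝ := Real.smoothTransition ((s - t) / t)
/-- its primitive -/
def stpI (t s : ℝ) : ℝ := ∫ r in t..s, stp t r

lemma stp_cd (t : ℝ) : ContDiff ℝ 1 (stp t) := by
  unfold stp
  exact (Real.smoothTransition.contDiff (n := 1)).comp (by fun_prop)
lemma stp_nn (t s : ℝ) : 0 ≤ stp t s := Real.smoothTransition.nonneg _
lemma stp_le (t s : ℝ) : stp t s ≤ 1 := Real.smoothTransition.le_one _
lemma stp_left {t s : ℝ} (ht : 0 < t) (hs : s ≤ t) : stp t s = 0 :=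
  Real.smoothTransition.zero_of_nonpos (div_nonpos_of_nonpos_of_nonneg (by linarith) ht.le)
lemma stp_right {t s : ℝ} (ht : 0 < t) (hs : 2 * t ≤ s) : stp t s = 1 :=
  Real.smoothTransition.one_of_one_le (by rw [le_div_iff₀ ht]; linarith)
lemma stp_deriv_nn {t : ℝ} (ht : 0 < t) (s : ℝ) : 0 ≤ deriv (stp t) s := by
  have : Monotone (stp t) := fun a b hab => Real.smoothTransition.monotone (by gcongr)
  exact this.deriv_nonneg
lemma stpI_deriv (t s : ℝ) : HasDerivAt (stpI t) (stp t s) s :=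
  intervalIntegral.integral_hasDerivAt_right ((stp_cd t).continuous.intervalIntegrable _ _)
    (stp_cd t).continuous.stronglyMeasurable.stronglyMeasurableAtFilter (stp_cd t).continuous.continuousAt
lemma stpI_cd (t : ℝ) : ContDiff ℝ 1 (stpI t) := by
  rw [contDiff_one_iff_deriv]
  refine ⟨fun s => (stpI_deriv t s).differentiableAt, ?_⟩
  have : deriv (stpI t) = stp t := by ext s; exact (stpI_deriv t s).deriv
  rw [this]; exact (stp_cd t).continuous
lemma stpI_left {t s : ℝ} (ht : 0 < t) (hs : s ≤ t) : stpI t s = 0 := by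
  unfold stpI
  rw [intervalIntegral.integral_congr (g := fun _ => (0:ℝ))]
  · simp
  · intro r hr
    rw [Set.uIcc_of_ge hs] at hr
    exact stp_left ht hr.2
lemma stpI_nn {t s : ℝ} (ht : 0 < t) : 0 ≤ stpI t s := by
  rcases le_total s t with h | h
  · rw [stpI_left ht h]
  · exact intervalIntegral.integral_nonneg h fun r _ => stp_nn t r
lemma stpI_ge {t s : ℝ} (ht : 0 < t) : s ≤ stpI t s + 2 * t := by
  rcases le_total s (2 * t) with h | h
  · have := stpI_nn (s := s) ht; linarith
  · have ii : ∀ a b, IntervalIntegrable (stp t) volume a b := fun a b => (stp_cd t).continuous.intervalIntegrable _ _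
    have e : stpI t s = (∫ r in t..(2 * t), stp t r) + ∫ r in (2 * t)..s, stp t r :=
      (intervalIntegral.integral_add_adjacent_intervals (ii _ _) (ii _ _)).symm
    have e1 : 0 ≤ ∫ r in t..(2 * t), stp t r := intervalIntegral.integral_nonneg (by linarith) fun r _ => stp_nn t r
    have e2 : ∫ r in (2 * t)..s, stp t r = s - 2 * t := by
      rw [intervalIntegral.integral_congr (g := fun _ => (1:ℝ))]
      · simp
      · intro r hr
        rw [Set.uIcc_of_le h] at hr
        exact stp_right ht hr.1
    linarith

lemma LES.l1 {Ω : Set E2} {u : E2 → ℝ} {p M : ℝ} (H : LES Ω u p 0 M) {Rb : ℝ} (hRb : 0 ≤ Rb) (hΩ : Ω ⊆ closedBall 0 Rb) :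
    ∫ x in sl Ω u 0, u x ≤ Rb ^ 2 / 4 * mm Ω u p 0 + 2 / p * volume.real Ω := by
  have hp := H.hp
  set t : ℝ := 1 / p with ht
  have ht0 : 0 < t := by positivity
  have hD := H.op
  have hu := H.c2
  have hK := H.cpt t ht0
  set K := {x | x ∈ Ω ∧ t ≤ u x} with hKdef
  have hKD : K ⊆ Ω := fun x hx => hx.1
  have hoff : ∀ x ∈ Ω, x ∉ K → u x < t := by
    intro x hx hxK; by_contra h; exact hxK ⟨hx, not_lt.mp h⟩
  let ψ : E2 → ℝ := fun x => (Rb ^ 2 - ‖x‖ ^ 2) / 4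
  have dψ : ∀ x, HasFDerivAt ψ ((-(1 / 2) : ℝ) • (innerSL ℝ x)) x := by
    intro x
    have h1 : HasFDerivAt (fun y : E2 => Rb ^ 2 - ‖y‖ ^ 2) (-(2 • (innerSL ℝ x))) x :=
      ((hasStrictFDerivAt_norm_sq x).hasFDerivAt).const_sub _
    have h2 := h1.mul_const (1 / 4)
    refine (h2.congr_fderiv ?_).congr_of_eventuallyEq (Eventually.of_forall fun y => by simp [ψ]; ring)
    ext z
    simp
    ring
  have cψ : ContDiff ℝ 1 ψ := by
    have : ContDiff ℝ 1 (fun x : E2 => ‖x‖ ^ 2) := contDiff_norm_sq ℝ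
    exact (contDiff_const.sub this).div_const 4
  have hinn : ∀ (x : E2) i, fderiv ℝ ψ x (bv i) = -(x i) / 2 := by
    intro x i
    have hin : inner ℝ x (bv i) = x i := by
      rw [real_inner_comm]; simp [bv, EuclideanSpace.inner_single_left]
    rw [(dψ x).fderiv]
    simp only [smul_apply, innerSL_apply_apply, hin, smul_eq_mul]; ring
  have hg := green hD hu hK (stp_cd t) (fun s hs => stp_left ht0 hs) cψ
  have hcu : ContinuousOn u Ω := hu.continuousOn
  have cI : ContinuousOn (fun x => stpI t (u x)) Ω := (stpI_cd t).continuous.comp_continuousOn hcu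
  have iI : IntegrableOn (fun x => stpI t (u x)) Ω :=
    intOn_of_supp hD hK hKD cI (fun x hx hxK => stpI_left ht0 (hoff x hx hxK).le)
  -- second identity
  let X : Fin 2 → E2 → ℝ := fun i x => stpI t (u x) * (-(x i) / 2)
  have hlin : ∀ i, ContDiff ℝ 1 (fun x : E2 => -(x i) / 2) := fun i => by fun_prop
  have hX : ∀ i, ContDiffOn ℝ 1 (X i) Ω := fun i =>
    ((stpI_cd t).comp_contDiffOn (hu.of_le (by norm_num))).mul (hlin i).contDiffOn
  have hX0 : ∀ i, ∀ x ∈ Ω, x ∉ K → X i x = 0 := by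
    intro i x hx hxK; simp [X, stpI_left ht0 (hoff x hx hxK).le]
  have hder : ∀ i, ∀ x ∈ Ω, fderiv ℝ (X i) x (bv i) =
      stp t (u x) * (fderiv ℝ u x (bv i) * fderiv ℝ ψ x (bv i)) - stpI t (u x) * (1 / 2) := by
    intro i x hx
    have d1 : HasFDerivAt u (fderiv ℝ u x) x :=
      ((hu.differentiableOn (by norm_num)).differentiableAt (hD.mem_nhds hx)).hasFDerivAt
    have d2 : HasFDerivAt (fun x : E2 => -(x i) / 2) ((-(1 / 2) : ℝ) • (EuclideanSpace.proj i : E2 →L[ℝ] ℝ)) x := by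
      have := ((EuclideanSpace.proj i : E2 →L[ℝ] ℝ).hasFDerivAt (x := x)).const_mul (-(1 / 2))
      refine this.congr_of_eventuallyEq (Eventually.of_forall fun y => by simp; ring)
    have d5 := (stpI_deriv t (u x)).comp_hasFDerivAt x d1
    have := d5.mul d2
    rw [show X i = (stpI t ∘ u) * (fun x : E2 => -(x i) / 2) from rfl, this.fderiv, hinn]
    simp [bv]
    ring
  have hcu' : ∀ i, ContinuousOn (fun x => fderiv ℝ u x (bv i)) Ω := fun i => (c1_partial hD hu (bv i)).continuousOn
  have hcψ' : ∀ i, ContinuousOn (fun x => fderiv ℝ ψ x (bv i)) Ω := fun i =>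
    ((cψ.continuous_fderiv (by norm_num)).clm_apply continuous_const).continuousOn
  have hcχ : ContinuousOn (fun x => stp t (u x)) Ω := (stp_cd t).continuous.comp_continuousOn hcu
  have i3 : IntegrableOn (fun x => stp t (u x) * (∑ i : Fin 2, fderiv ℝ u x (bv i) * fderiv ℝ ψ x (bv i))) Ω :=
    intOn_of_supp hD hK hKD (hcχ.mul (continuousOn_finsetSum _ fun i _ => (hcu' i).mul (hcψ' i)))
      (by intro x hx hxK; simp [stp_left ht0 (hoff x hx hxK).le])
  have iX : ∀ i, IntegrableOn (fun x => fderiv ℝ (X i) x (bv i)) Ω := fun i => by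
    refine intOn_of_supp hD hK hKD
      (((hX i).continuousOn_fderiv_of_isOpen hD (by norm_num)).clm_apply continuousOn_const) ?_
    intro x hx hxK
    rw [hder i x hx]; simp [stp_left ht0 (hoff x hx hxK).le, stpI_left ht0 (hoff x hx hxK).le]
  have hsum : ∫ x in Ω, stp t (u x) * (∑ i : Fin 2, fderiv ℝ u x (bv i) * fderiv ℝ ψ x (bv i)) - stpI t (u x) = 0 := by
    have e : ∀ x ∈ Ω, stp t (u x) * (∑ i : Fin 2, fderiv ℝ u x (bv i) * fderiv ℝ ψ x (bv i)) - stpI t (u x)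
      = fderiv ℝ (X 0) x (bv 0) + fderiv ℝ (X 1) x (bv 1) := by
      intro x hx
      rw [hder 0 x hx, hder 1 x hx]
      simp only [Fin.sum_univ_two]
      ring
    rw [setIntegral_congr_fun hD.measurableSet e, integral_add (iX 0) (iX 1),
      divg_zero hD hK hKD (hX 0) (hX0 0), divg_zero hD hK hKD (hX 1) (hX0 1), add_zero]
  rw [integral_sub i3 iI] at hsum
  have hψ0 : ∀ x ∈ Ω, 0 ≤ ψ x := by
    intro x hx
    have := hΩ hx
    rw [mem_closedBall_zero_iff] at this
    have := norm_nonneg x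
    show 0 ≤ (Rb ^ 2 - ‖x‖ ^ 2) / 4
    nlinarith
  have hψ1 : ∀ x, ψ x ≤ Rb ^ 2 / 4 := by
    intro x
    show (Rb ^ 2 - ‖x‖ ^ 2) / 4 ≤ _
    nlinarith [sq_nonneg ‖x‖]
  have h1 : 0 ≤ ∫ x in Ω, deriv (stp t) (u x) * gsq u x * ψ x := by
    apply setIntegral_nonneg hD.measurableSet
    intro x hx
    have h1 := stp_deriv_nn ht0 (u x)
    have h2 := hψ0 x hx
    have h3 : 0 ≤ gsq u x := by unfold gsq; positivity
    positivity
  have ipow : IntegrableOn (fun x => (u x) ^ p) (sl Ω u 0) := H.intpow le_rfl (by linarith)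
  have hms := (H.isOpen_sl 0).measurableSet
  have h2 : ∫ x in Ω, stp t (u x) * ψ x * (-lap u x) ≤ Rb ^ 2 / 4 * mm Ω u p 0 := by
    have i1 : IntegrableOn (fun x => stp t (u x) * ψ x * (-lap u x)) Ω :=
      intOn_of_supp hD hK hKD ((hcχ.mul cψ.continuous.continuousOn).mul (cont_lap hD hu).neg)
        (by intro x hx hxK; simp [stp_left ht0 (hoff x hx hxK).le])
    unfold mm
    rw [← integral_const_mul, ← integral_indicator hD.measurableSet, ← integral_indicator hms]
    have i2 : IntegrableOn (fun x => Rb ^ 2 / 4 * (u x) ^ p) (sl Ω u 0) := ipow.const_mul _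
    refine integral_mono (i1.integrable_indicator hD.measurableSet) (i2.integrable_indicator hms) ?_
    intro x
    by_cases hx : x ∈ Ω
    · rw [Set.indicator_of_mem hx]
      by_cases hx0 : x ∈ sl Ω u 0
      · rw [Set.indicator_of_mem hx0, H.eqn x hx hx0.2]
        apply mul_le_mul_of_nonneg_right _ (Real.rpow_nonneg hx0.2.le _)
        calc stp t (u x) * ψ x ≤ 1 * ψ x := mul_le_mul_of_nonneg_right (stp_le _ _) (hψ0 x hx)
          _ ≤ _ := by rw [one_mul]; exact hψ1 x
      · rw [Set.indicator_of_notMem hx0, stp_left ht0]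
        · simp
        · by_contra h; exact hx0 ⟨hx, by linarith⟩
    · have hx0 : x ∉ sl Ω u 0 := fun h => hx h.1
      rw [Set.indicator_of_notMem hx, Set.indicator_of_notMem hx0]
  have hfin : volume Ω ≠ ⊤ := H.bdd.measure_lt_top.ne
  have h3 : ∫ x in sl Ω u 0, u x ≤ ∫ x in Ω, (stpI t (u x) + 2 * t) := by
    have iu : IntegrableOn u (sl Ω u 0) := by
      have := H.intpow le_rfl (q := 1) zero_le_one
      simpa using this
    have i2 : IntegrableOn (fun x => stpI t (u x) + 2 * t) Ω := iI.add (integrableOn_const hfin)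
    rw [← integral_indicator hD.measurableSet, ← integral_indicator hms]
    refine integral_mono (iu.integrable_indicator hms) (i2.integrable_indicator hD.measurableSet) ?_
    intro x
    by_cases hx : x ∈ Ω
    · rw [Set.indicator_of_mem hx]
      by_cases hx0 : x ∈ sl Ω u 0
      · rw [Set.indicator_of_mem hx0]; exact stpI_ge ht0
      · rw [Set.indicator_of_notMem hx0]
        have := stpI_nn (s := u x) ht0
        positivity
    · have hx0 : x ∉ sl Ω u 0 := fun h => hx h.1
      rw [Set.indicator_of_notMem hx, Set.indicator_of_notMem hx0]
  rw [integral_add iI (integrableOn_const hfin), setIntegral_const, smul_eq_mul] at h3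
  have h4 : 2 / p * volume.real Ω = volume.real Ω * (2 * t) := by rw [ht]; ring
  linarith
end

section
variable {Ω O D : Set E2} {u : E2 → ℝ} {p M ε : ℝ} {xn : E2}

lemma LES.pe_ineq (H : LES D u p 0 M) {B : Set E2} (hB : MeasurableSet B) :
    ∫ x in sl D u 0 \ B, (u x) ^ p ≤ 2 * (∫ x in sl D u 0 \ B, (u x) ^ (p + 1)) + (1 / 2) ^ p * volume.real D := by
  have hp := H.hp
  have hms := (H.isOpen_sl 0).measurableSet
  have i1 : IntegrableOn (fun x => (u x) ^ p) (sl D u 0 \ B) := (H.intpow le_rfl (by linarith)).mono_set Set.sdiff_subset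
  have i2 : IntegrableOn (fun x => (u x) ^ (p + 1)) (sl D u 0 \ B) := (H.intpow le_rfl (by linarith)).mono_set Set.sdiff_subset
  have hfin : volume (sl D u 0 \ B) ≠ ⊤ := ne_top_of_le_ne_top (H.fin_sl 0) (measure_mono Set.sdiff_subset)
  have i3 : IntegrableOn (fun _ : E2 => ((1:ℝ) / 2) ^ p) (sl D u 0 \ B) := integrableOn_const hfin
  have i4 : IntegrableOn (fun x => 2 * (u x) ^ (p + 1)) (sl D u 0 \ B) := i2.const_mul 2
  have h1 : ∫ x in sl D u 0 \ B, (u x) ^ p ≤ ∫ x in sl D u 0 \ B, (2 * (u x) ^ (p + 1) + (1 / 2) ^ p) := by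
    apply setIntegral_mono_on i1 (i4.add i3) (hms.diff hB)
    intro x hx
    have hx0 : 0 < u x := hx.1.2
    have a1 : 0 < (u x) ^ p := Real.rpow_pos_of_pos hx0 p
    have a2 : (0:ℝ) < (1 / 2) ^ p := by positivity
    show (u x) ^ p ≤ 2 * (u x) ^ (p + 1) + (1 / 2) ^ p
    rw [Real.rpow_add_one hx0.ne']
    by_cases h : 1 / 2 ≤ u x
    · nlinarith
    · have := Real.rpow_le_rpow hx0.le (not_le.mp h).le (by linarith : (0:ℝ) ≤ p)
      nlinarith [mul_pos a1 hx0]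
  rw [integral_add i4 i3, integral_const_mul, setIntegral_const, smul_eq_mul] at h1
  have h2 : volume.real (sl D u 0 \ B) ≤ volume.real D :=
    measureReal_mono (fun x hx => hx.1.1) H.bdd.measure_lt_top.ne
  have a2 : (0:ℝ) < (1 / 2) ^ p := by positivity
  nlinarith

lemma LES.mm_le (H : LES D u p 0 M) : mm D u p 0 ≤ 2 * ee D u p 0 + (1 / 2) ^ p * volume.real D := by
  have := H.pe_ineq MeasurableSet.empty
  simpa [mm, ee] using this

lemma PV.sub_sl (P : PV Ω O u p M ε xn) : O ⊆ sl Ω u 0 := fun y hy => ⟨P.OΩ hy, P.pos y hy⟩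

lemma PV.rest (P : PV Ω O u p M ε xn) {B : Set E2} (hB : MeasurableSet B) (hBO : B ⊆ O) :
    p * ∫ x in sl Ω u 0 \ B, (u x) ^ p ≤ 2 * (p * ee Ω u p 0 - p * ∫ x in B, (u x) ^ (p + 1)) + p * (1 / 2) ^ p * volume.real Ω := by
  have h := P.H.pe_ineq hB
  have hp := P.hp
  have e : ∫ x in sl Ω u 0 \ B, (u x) ^ (p + 1) = ee Ω u p 0 - ∫ x in B, (u x) ^ (p + 1) := by
    unfold ee
    rw [setIntegral_sdiff hB (P.H.intpow le_rfl (by linarith)) (hBO.trans P.sub_sl)]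
  rw [e] at h
  nlinarith

/-- the quantitative concentration package -/
structure CC (Ω O : Set E2) (u : E2 → ℝ) (p M ε : ℝ) (xn : E2) (R η K L : ℝ) : Prop where
  P : PV Ω O u p M ε xn
  R1 : 1 ≤ R
  η0 : 0 < η
  η1 : η < 1
  mass : (8 * π - η) * M ≤ p * ∫ x in ball xn (R * ε), (u x) ^ p
  rest : p * ∫ x in sl Ω u 0 \ ball xn (R * ε), (u x) ^ p ≤ η * M
  tot : p * mm Ω u p 0 ≤ K * M
  l1 : p * ∫ x in sl Ω u 0, u x ≤ L * M
  sub : closedBall xn (R * ε) ⊆ O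
end

section
variable {Ω O D : Set E2} {u : E2 → ℝ} {p M ε : ℝ} {xn : E2} {R η K L : ℝ}

lemma aux_lip {r s : ℝ} (hr : 0 ≤ r) (hs : 0 ≤ s) (hrs : r ≤ s) :
    max 0 (1 - s ^ 2) ≤ max 0 (1 - r ^ 2) ∧ max 0 (1 - r ^ 2) - max 0 (1 - s ^ 2) ≤ 2 * (s - r) := by
  constructor
  · apply max_le_max le_rfl; nlinarith
  · rcases le_total s 1 with h | h
    · rw [max_eq_right (by nlinarith), max_eq_right (by nlinarith)]
      nlinarith
    · rw [max_eq_left (by nlinarith : 1 - s ^ 2 ≤ 0)]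
      rcases le_total r 1 with h' | h'
      · rw [max_eq_right (by nlinarith)]; nlinarith
      · rw [max_eq_left (by nlinarith)]; linarith

lemma kk_lip0 {x y : E2} (h : ‖x‖ ≤ ‖y‖) : kk y ≤ kk x ∧ kk x - kk y ≤ 6 * (‖y‖ - ‖x‖) := by
  obtain ⟨h1, h2⟩ := aux_lip (norm_nonneg x) (norm_nonneg y) h
  have a1 : max 0 (1 - ‖x‖ ^ 2) ≤ 1 := max_le zero_le_one (by nlinarith [sq_nonneg ‖x‖])
  have a0 : 0 ≤ max 0 (1 - ‖y‖ ^ 2) := le_max_left _ _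
  unfold kk
  set a := max 0 (1 - ‖x‖ ^ 2)
  set b := max 0 (1 - ‖y‖ ^ 2)
  constructor
  · gcongr
  · have e : a ^ 3 - b ^ 3 = (a - b) * (a ^ 2 + a * b + b ^ 2) := by ring
    have h3 : a ^ 2 + a * b + b ^ 2 ≤ 3 := by nlinarith
    nlinarith

lemma kk_lip (x y : E2) : kk x - kk y ≤ 6 * ‖x - y‖ := by
  rcases le_total ‖x‖ ‖y‖ with h | h
  · have := (kk_lip0 h).2
    have := norm_sub_norm_le y x
    rw [norm_sub_rev] at this
    linarith
  · have := (kk_lip0 h).1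
    have := norm_nonneg (x - y)
    linarith

lemma kk_lower {y : E2} (h : ‖y‖ ≤ 1) : 1 - 3 * ‖y‖ ^ 2 ≤ kk y := by
  unfold kk
  have h0 := norm_nonneg y
  rw [max_eq_right (by nlinarith)]
  set a := ‖y‖ ^ 2 with ha
  have h1 : a ≤ 1 := by rw [ha]; nlinarith
  have h2 : 0 ≤ a := by positivity
  nlinarith [mul_nonneg (mul_nonneg h2 h2) (by linarith : 0 ≤ 1 - a), mul_nonneg h2 h2]

lemma intk {g k : E2 → ℝ} {S : Set E2} (hg : IntegrableOn g S) (hk : Continuous k) (h0 : ∀ y, 0 ≤ k y) (h1 : ∀ y, k y ≤ 1) (x : E2) (t : ℝ) :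
    IntegrableOn (fun z => g z * k (t⁻¹ • (z - x))) S := by
  have hc : Continuous fun z => k (t⁻¹ • (z - x)) := by fun_prop
  refine Integrable.mono' hg.norm (hg.aestronglyMeasurable.mul hc.aestronglyMeasurable) ?_
  refine Eventually.of_forall fun z => ?_
  rw [norm_mul, Real.norm_eq_abs (k _), abs_of_nonneg (h0 _)]
  nlinarith [norm_nonneg (g z), h1 (t⁻¹ • (z - x))]

lemma loc_int {f g k : E2 → ℝ} {S : Set E2} (hS : MeasurableSet S) (hk : ∀ y, 1 ≤ ‖y‖ → k y = 0) {x : E2} {t : ℝ} (ht : 0 < t)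
    (hsub : closedBall x t ⊆ S) (hfg : ∀ z ∈ closedBall x t, f z = g z) :
    ∫ z, f z * k (t⁻¹ • (z - x)) = ∫ z in S, g z * k (t⁻¹ • (z - x)) := by
  rw [← integral_indicator hS]
  congr 1
  ext z
  by_cases hz : z ∈ closedBall x t
  · rw [Set.indicator_of_mem (hsub hz), hfg z hz]
  · have : k (t⁻¹ • (z - x)) = 0 := by
      apply hk
      rw [mem_closedBall, not_le, dist_eq_norm] at hz
      rw [norm_smul, norm_inv, Real.norm_eq_abs, abs_of_pos ht, ← div_eq_inv_mul, le_div_iff₀ ht]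
      linarith
    by_cases hzS : z ∈ S
    · rw [Set.indicator_of_mem hzS, this]; simp
    · rw [Set.indicator_of_notMem hzS, this]; simp

/-- scaled mass -/
def AA (Ω : Set E2) (u : E2 → ℝ) (p : ℝ) (x : E2) (t : ℝ) : ℝ := ∫ z in sl Ω u 0, (u z) ^ p * kk (t⁻¹ • (z - x))

/-- radial density -/
def GG (u : E2 → ℝ) (p M : ℝ) (x : E2) (t : ℝ) : ℝ := p / M * (t * ∫ y, (-lap u (x + t • y)) * (kk y / (2 * π)))

lemma PV.GG_eq (P : PV Ω O u p M ε xn) {x : E2} {t : ℝ} (ht : 0 < t) (hsub : closedBall x t ⊆ O) :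
    GG u p M x t = p / M * AA Ω u p x t / (2 * π) * t⁻¹ := by
  unfold GG AA
  have h1 := scale_int (fun z => -lap u z) (fun y => kk y / (2 * π)) x ht
  have h2 := loc_int (f := fun z => -lap u z) (g := fun z => (u z) ^ p) (k := fun y => kk y / (2 * π)) (S := sl Ω u 0)
    (P.H.isOpen_sl 0).measurableSet (fun y hy => by simp [kk_zero hy]) ht (hsub.trans P.sub_sl) (fun z hz => P.eqn (hsub hz))
  rw [h1, h2]
  have h3 : ∫ z in sl Ω u 0, (u z) ^ p * (kk (t⁻¹ • (z - x)) / (2 * π)) = (∫ z in sl Ω u 0, (u z) ^ p * kk (t⁻¹ • (z - x))) / (2 * π) := by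
    rw [← integral_div]; congr 1; ext z; ring
  rw [h3]
  field_simp

lemma PV.GG_nn (P : PV Ω O u p M ε xn) {x : E2} {t : ℝ} (ht : 0 ≤ t) (hsub : closedBall x t ⊆ O) : 0 ≤ GG u p M x t := by
  have hp := P.hp
  have := P.M1
  have h := P.inner_nn hsub ht le_rfl
  unfold GG
  positivity

lemma PV.GG_1 (P : PV Ω O u p M ε xn) {x : E2} {t : ℝ} (ht : 0 ≤ t) (hsub : closedBall x t ⊆ O) : GG u p M x t ≤ (2 * ε ^ 2)⁻¹ * t := by
  have hp := P.hp
  have := P.M1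
  have hε := P.hε
  have h := P.inner_bd hsub ht le_rfl
  have e := P.eM
  unfold GG
  calc _ ≤ p / M * (t * (M ^ p / 2)) := by gcongr
    _ = _ := by
      have : p * M ^ p = M / ε ^ 2 := by field_simp; linarith
      have e2 : p / M * (t * (M ^ p / 2)) = p * M ^ p * t / (2 * M) := by field_simp
      rw [e2, this]; field_simp

lemma PV.AA_int (P : PV Ω O u p M ε xn) (x : E2) (t : ℝ) : IntegrableOn (fun z => (u z) ^ p * kk (t⁻¹ • (z - x))) (sl Ω u 0) :=
  intk (P.H.intpow le_rfl (by linarith [P.hp])) cont_kk kk_nonneg kk_le x t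

lemma CC.AA_3 (Q : CC Ω O u p M ε xn R η K L) (x : E2) (t : ℝ) : p / M * AA Ω u p x t ≤ K := by
  have hp := Q.P.hp
  have hM : 0 < M := by linarith [Q.P.M1]
  have h1 : AA Ω u p x t ≤ mm Ω u p 0 := by
    apply setIntegral_mono_on (Q.P.AA_int x t) (Q.P.H.intpow le_rfl (by linarith)) (Q.P.H.isOpen_sl 0).measurableSet
    intro z hz
    have := Real.rpow_pos_of_pos hz.2 p
    nlinarith [kk_le (t⁻¹ • (z - x))]
  rw [div_mul_eq_mul_div, div_le_iff₀ hM]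
  have := Q.tot
  nlinarith

lemma CC.AA_2 (Q : CC Ω O u p M ε xn R η K L) {x : E2} {t : ℝ} (ht : 0 < t) (hd : t + R * ε ≤ dist x xn) : p / M * AA Ω u p x t ≤ η := by
  have hp := Q.P.hp
  have hM : 0 < M := by linarith [Q.P.M1]
  have hms := (Q.P.H.isOpen_sl 0).measurableSet
  have ii : IntegrableOn (fun z => (u z) ^ p) (sl Ω u 0 \ ball xn (R * ε)) := (Q.P.H.intpow le_rfl (by linarith)).mono_set Set.sdiff_subset
  have h1 : AA Ω u p x t ≤ ∫ z in sl Ω u 0 \ ball xn (R * ε), (u z) ^ p := by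
    unfold AA
    rw [← integral_indicator hms, ← integral_indicator (hms.diff measurableSet_ball)]
    apply integral_mono ((Q.P.AA_int x t).integrable_indicator hms) (ii.integrable_indicator (hms.diff measurableSet_ball))
    intro z
    show (sl Ω u 0).indicator (fun z => (u z) ^ p * kk (t⁻¹ • (z - x))) z ≤ (sl Ω u 0 \ ball xn (R * ε)).indicator (fun z => (u z) ^ p) z
    by_cases hz : z ∈ sl Ω u 0
    · rw [Set.indicator_of_mem hz]
      by_cases hb : z ∈ ball xn (R * ε)
      · rw [Set.indicator_of_notMem (fun h => h.2 hb), kk_zero]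
        · simp
        · rw [norm_smul, norm_inv, Real.norm_eq_abs, abs_of_pos ht, ← div_eq_inv_mul, le_div_iff₀ ht, ← dist_eq_norm, one_mul]
          rw [mem_ball] at hb
          have := dist_triangle x z xn
          rw [dist_comm x z] at this
          linarith
      · rw [Set.indicator_of_mem (show z ∈ sl Ω u 0 \ ball xn (R * ε) from ⟨hz, hb⟩)]
        have := Real.rpow_pos_of_pos hz.2 p
        nlinarith [kk_le (t⁻¹ • (z - x))]
    · rw [Set.indicator_of_notMem hz, Set.indicator_of_notMem (fun h => hz h.1)]
  rw [div_mul_eq_mul_div, div_le_iff₀ hM]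
  have := Q.rest
  nlinarith

lemma CC.AA_4 (Q : CC Ω O u p M ε xn R η K L) {x : E2} {t : ℝ} (ht : 0 < t) :
    p / M * AA Ω u p x t ≤ p / M * AA Ω u p xn t + 6 * K * dist x xn * t⁻¹ := by
  have hp := Q.P.hp
  have hM : 0 < M := by linarith [Q.P.M1]
  have ii : IntegrableOn (fun z => (u z) ^ p) (sl Ω u 0) := Q.P.H.intpow le_rfl (by linarith)
  have i2 : IntegrableOn (fun z => 6 * dist x xn * t⁻¹ * (u z) ^ p) (sl Ω u 0) := ii.const_mul _
  have h1 : AA Ω u p x t ≤ ∫ z in sl Ω u 0, ((u z) ^ p * kk (t⁻¹ • (z - xn)) + 6 * dist x xn * t⁻¹ * (u z) ^ p) := by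
    apply setIntegral_mono_on (Q.P.AA_int x t) ((Q.P.AA_int xn t).add i2) (Q.P.H.isOpen_sl 0).measurableSet
    intro z hz
    show (u z) ^ p * kk (t⁻¹ • (z - x)) ≤ (u z) ^ p * kk (t⁻¹ • (z - xn)) + 6 * dist x xn * t⁻¹ * (u z) ^ p
    have h0 := Real.rpow_pos_of_pos hz.2 p
    have h2 := kk_lip (t⁻¹ • (z - x)) (t⁻¹ • (z - xn))
    have e : ‖t⁻¹ • (z - x) - t⁻¹ • (z - xn)‖ = t⁻¹ * dist x xn := by
      rw [← smul_sub, norm_smul, norm_inv, Real.norm_eq_abs, abs_of_pos ht, dist_eq_norm, norm_sub_rev x xn]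
      congr 2; abel
    rw [e] at h2
    nlinarith
  rw [integral_add (Q.P.AA_int xn t) i2, integral_const_mul] at h1
  change AA Ω u p x t ≤ AA Ω u p xn t + 6 * dist x xn * t⁻¹ * mm Ω u p 0 at h1
  have h2 : p / M * mm Ω u p 0 ≤ K := by
    rw [div_mul_eq_mul_div, div_le_iff₀ hM]; exact Q.tot
  have h3 : 0 < p / M := by positivity
  have h4 : 0 ≤ 6 * dist x xn * t⁻¹ := by positivity
  calc _ ≤ p / M * (AA Ω u p xn t + 6 * dist x xn * t⁻¹ * mm Ω u p 0) := by gcongr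
    _ = p / M * AA Ω u p xn t + 6 * dist x xn * t⁻¹ * (p / M * mm Ω u p 0) := by ring
    _ ≤ p / M * AA Ω u p xn t + 6 * dist x xn * t⁻¹ * K := by gcongr
    _ = _ := by ring

lemma CC.AA_5 (Q : CC Ω O u p M ε xn R η K L) {t : ℝ} (ht : R * ε ≤ t) :
    (8 * π - η) * (1 - 3 * (R * ε) ^ 2 * (t ^ 2)⁻¹) ≤ p / M * AA Ω u p xn t := by
  have hp := Q.P.hp
  have hM : 0 < M := by linarith [Q.P.M1]
  have hRε : 0 < R * ε := mul_pos (by linarith [Q.R1]) Q.P.hε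
  have ht0 : 0 < t := by linarith
  have hη : 0 < 8 * π - η := by nlinarith [Real.pi_gt_three, Q.η1]
  have hm := Q.mass
  have hAn : 0 ≤ AA Ω u p xn t := by
    apply setIntegral_nonneg (Q.P.H.isOpen_sl 0).measurableSet
    intro z hz
    exact mul_nonneg (Real.rpow_nonneg hz.2.le _) (kk_nonneg _)
  set c := 1 - 3 * (R * ε) ^ 2 * (t ^ 2)⁻¹ with hc
  rcases le_total c 0 with h | h
  · have : 0 ≤ p / M * AA Ω u p xn t := by positivity
    nlinarith
  have hbs : ball xn (R * ε) ⊆ sl Ω u 0 := (ball_subset_closedBall.trans Q.sub).trans Q.P.sub_sl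
  have ii : IntegrableOn (fun z => (u z) ^ p) (ball xn (R * ε)) := (Q.P.H.intpow le_rfl (by linarith)).mono_set hbs
  have i1 : IntegrableOn (fun z => c * (u z) ^ p) (ball xn (R * ε)) := ii.const_mul c
  have h1 : ∫ z in ball xn (R * ε), c * (u z) ^ p ≤ AA Ω u p xn t := by
    unfold AA
    calc _ ≤ ∫ z in ball xn (R * ε), (u z) ^ p * kk (t⁻¹ • (z - xn)) := by
          apply setIntegral_mono_on i1 ((Q.P.AA_int xn t).mono_set hbs) measurableSet_ball
          intro z hz
          have h0 := Real.rpow_pos_of_pos (hbs hz).2 p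
          rw [mem_ball, dist_eq_norm] at hz
          have e : ‖t⁻¹ • (z - xn)‖ = t⁻¹ * ‖z - xn‖ := by
            rw [norm_smul, norm_inv, Real.norm_eq_abs, abs_of_pos ht0]
          have h2 : ‖t⁻¹ • (z - xn)‖ ≤ 1 := by
            rw [e, ← div_eq_inv_mul, div_le_one ht0]; linarith
          have h3 := kk_lower h2
          have h4 : ‖t⁻¹ • (z - xn)‖ ^ 2 ≤ (R * ε) ^ 2 * (t ^ 2)⁻¹ := by
            rw [e, mul_pow, inv_pow, mul_comm]; gcongr
          have h5 : c ≤ kk (t⁻¹ • (z - xn)) := by rw [hc]; linarith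
          nlinarith
      _ ≤ _ := by
          apply setIntegral_mono_set (Q.P.AA_int xn t)
          · refine (ae_restrict_mem (Q.P.H.isOpen_sl 0).measurableSet).mono fun z hz => ?_
            exact mul_nonneg (Real.rpow_nonneg hz.2.le _) (kk_nonneg _)
          · exact hbs.eventuallyLE
  rw [integral_const_mul] at h1
  calc (8 * π - η) * c ≤ (p * (∫ z in ball xn (R * ε), (u z) ^ p) / M) * c := by
        gcongr; rw [le_div_iff₀ hM]; exact hm
    _ = p / M * (c * ∫ z in ball xn (R * ε), (u z) ^ p) := by ring
    _ ≤ _ := by gcongr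
end

section
variable {Ω O D : Set E2} {u : E2 → ℝ} {p M ε : ℝ} {xn : E2} {R η K L : ℝ}

lemma int_t2 {a b : ℝ} (ha : 0 < a) (hab : a ≤ b) : IntervalIntegrable (fun t : ℝ => (t ^ 2)⁻¹) volume a b ∧ ∫ t in a..b, (t ^ 2)⁻¹ ≤ a⁻¹ := by
  have h0 : ∀ t ∈ Set.uIcc a b, 0 < t := by
    intro t ht; rw [Set.uIcc_of_le hab] at ht; linarith [ht.1]
  have hi : IntervalIntegrable (fun t : ℝ => (t ^ 2)⁻¹) volume a b := by
    apply ContinuousOn.intervalIntegrable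
    intro t ht
    have := h0 t ht
    exact (ContinuousAt.inv₀ (by fun_prop) (by positivity)).continuousWithinAt
  refine ⟨hi, ?_⟩
  have h := intervalIntegral.integral_eq_sub_of_hasDerivAt (f := fun t : ℝ => -t⁻¹) (f' := fun t => (t ^ 2)⁻¹) (a := a) (b := b) (by
    intro t ht
    have := h0 t ht
    exact (hasDerivAt_inv this.ne').neg.congr_deriv (by simp)) hi
  rw [h]
  have : 0 < b⁻¹ := by have : 0 < b := by linarith
                       positivity
  linarith

lemma int_t3 {a b : ℝ} (ha : 0 < a) (hab : a ≤ b) : IntervalIntegrable (fun t : ℝ => (t ^ 3)⁻¹) volume a b ∧ ∫ t in a..b, (t ^ 3)⁻¹ ≤ (a ^ 2)⁻¹ / 2 := by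
  have h0 : ∀ t ∈ Set.uIcc a b, 0 < t := by
    intro t ht; rw [Set.uIcc_of_le hab] at ht; linarith [ht.1]
  have hi : IntervalIntegrable (fun t : ℝ => (t ^ 3)⁻¹) volume a b := by
    apply ContinuousOn.intervalIntegrable
    intro t ht
    have := h0 t ht
    exact (ContinuousAt.inv₀ (by fun_prop) (by positivity)).continuousWithinAt
  refine ⟨hi, ?_⟩
  have h := intervalIntegral.integral_eq_sub_of_hasDerivAt (f := fun t : ℝ => -((t ^ 2)⁻¹ / 2)) (f' := fun t => (t ^ 3)⁻¹) (a := a) (b := b) (by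
    intro t ht
    have := h0 t ht
    have h1 : HasDerivAt (fun t : ℝ => t ^ 2) (2 * t) t := (hasDerivAt_pow 2 t).congr_deriv (by simp)
    have h2 := ((h1.inv (by positivity)).div_const 2).neg
    exact h2.congr_deriv (by field_simp)) hi
  rw [h]
  have : 0 < (b ^ 2)⁻¹ := by have : 0 < b := by linarith
                             positivity
  linarith

lemma int_t1 {a b : ℝ} (ha : 0 < a) (hab : a ≤ b) : IntervalIntegrable (fun t : ℝ => t⁻¹) volume a b ∧ ∫ t in a..b, t⁻¹ = Real.log (b / a) := by
  refine ⟨?_, integral_inv_of_pos ha (by linarith)⟩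
  apply ContinuousOn.intervalIntegrable
  intro t ht
  rw [Set.uIcc_of_le hab] at ht
  have : 0 < t := by linarith [ht.1]
  exact (ContinuousAt.inv₀ (by fun_prop) (by positivity)).continuousWithinAt

lemma PV.GG_int (P : PV Ω O u p M ε xn) {x : E2} {s : ℝ} (hs : 0 < s) (hsub : closedBall x s ⊆ O) :
    IntervalIntegrable (GG u p M x) volume 0 s ∧
    p / M * u x = p / M * ((3 / π) * ∫ y, u (x + s • y) * k2 y) + ∫ t in (0:ℝ)..s, GG u p M x t := by
  obtain ⟨h1, h2⟩ := mean_local P.Oo P.c2 hs hsub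
  refine ⟨h2.const_mul _, ?_⟩
  unfold GG
  rw [intervalIntegral.integral_const_mul]
  nth_rw 1 [h1]
  rw [mul_add]

lemma PV.NN_nn (P : PV Ω O u p M ε xn) {x : E2} {s : ℝ} (hs : 0 < s) (hsub : closedBall x s ⊆ O) :
    0 ≤ p / M * ((3 / π) * ∫ y, u (x + s • y) * k2 y) := by
  have hp := P.hp
  have := P.M1
  have : 0 ≤ ∫ y, u (x + s • y) * k2 y := by
    apply integral_nonneg
    intro y
    show 0 ≤ u (x + s • y) * k2 y
    by_cases hy : ‖y‖ < 1
    · exact mul_nonneg (P.pos _ (hsub (mem_cb hs.le le_rfl hy.le))).le (k2_nonneg y)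
    · rw [k2_zero (not_lt.mp hy)]; simp
  positivity

lemma CC.NN_le (Q : CC Ω O u p M ε xn R η K L) {x : E2} {s : ℝ} (hs : 0 < s) (hsub : closedBall x s ⊆ O) :
    p / M * ((3 / π) * ∫ y, u (x + s • y) * k2 y) ≤ 3 * L / (π * s ^ 2) := by
  have P := Q.P
  have hp := P.hp
  have hM : 0 < M := by linarith [P.M1]
  have hms := (P.H.isOpen_sl 0).measurableSet
  have iu : IntegrableOn u (sl Ω u 0) := by
    have := P.H.intpow le_rfl (q := 1) zero_le_one
    simpa using this
  rw [scale_int u k2 x hs, loc_int (g := u) hms (fun y hy => k2_zero hy) hs (hsub.trans P.sub_sl) (fun _ _ => rfl)]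
  have h1 : ∫ z in sl Ω u 0, u z * k2 (s⁻¹ • (z - x)) ≤ ∫ z in sl Ω u 0, u z := by
    apply setIntegral_mono_on (intk iu cont_k2 k2_nonneg k2_le x s) iu hms
    intro z hz
    have := hz.2
    nlinarith [k2_le (s⁻¹ • (z - x))]
  have h2 : p / M * ∫ z in sl Ω u 0, u z ≤ L := by
    rw [div_mul_eq_mul_div, div_le_iff₀ hM]; exact Q.l1
  calc _ ≤ p / M * (3 / π * ((s ^ 2)⁻¹ * ∫ z in sl Ω u 0, u z)) := by gcongr
    _ = (3 / π * (s ^ 2)⁻¹) * (p / M * ∫ z in sl Ω u 0, u z) := by ring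
    _ ≤ (3 / π * (s ^ 2)⁻¹) * L := by gcongr
    _ = _ := by field_simp

lemma CC.up (Q : CC Ω O u p M ε xn R η K L) {x : E2} {s ρ : ℝ} (hsub : closedBall x s ⊆ O)
    (hρs : ρ ≤ s) (hρd : ρ ≤ dist x xn) (hρ : 2 * (R * ε) ≤ ρ) (hi : IntervalIntegrable (GG u p M x) volume 0 s) :
    ∫ t in (0:ℝ)..ρ, GG u p M x t ≤ 1 / 4 + η / (2 * π) * Real.log (ρ / ε) + K / (2 * π) * Real.log 2 := by
  have P := Q.P
  have hε := P.hε
  have hR := Q.R1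
  have hη := Q.η0
  have hεR : ε ≤ R * ε := by nlinarith
  have hρ0 : 0 < ρ := by linarith
  have sub : ∀ t, t ≤ s → closedBall x t ⊆ O := fun t ht => (closedBall_subset_closedBall ht).trans hsub
  have im : ∀ a b : ℝ, 0 ≤ a → a ≤ b → b ≤ s → IntervalIntegrable (GG u p M x) volume a b := by
    intro a b ha hab hb
    apply hi.mono_set
    rw [Set.uIcc_of_le hab, Set.uIcc_of_le (by linarith)]
    exact Set.Icc_subset_Icc ha hb
  have j1 := im 0 ε le_rfl hε.le (by linarith)
  have j2 := im ε (ρ / 2) hε.le (by linarith) (by linarith)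
  have j3 := im (ρ / 2) ρ (by linarith) (by linarith) hρs
  rw [← intervalIntegral.integral_add_adjacent_intervals (j1.trans j2) j3, ← intervalIntegral.integral_add_adjacent_intervals j1 j2]
  have b1 : ∫ t in (0:ℝ)..ε, GG u p M x t ≤ 1 / 4 := by
    calc _ ≤ ∫ t in (0:ℝ)..ε, (2 * ε ^ 2)⁻¹ * t := by
          apply intervalIntegral.integral_mono_on hε.le j1 (by apply Continuous.intervalIntegrable; fun_prop)
          intro t ht
          exact P.GG_1 ht.1 (sub t (by linarith [ht.2]))
      _ = 1 / 4 := by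
          rw [intervalIntegral.integral_const_mul, integral_id]; field_simp; ring
  have hpi := Real.pi_pos
  have b2 : ∫ t in ε..(ρ/2), GG u p M x t ≤ η / (2 * π) * Real.log (ρ / ε) := by
    obtain ⟨k1, k2⟩ := int_t1 hε (by linarith : ε ≤ ρ / 2)
    calc _ ≤ ∫ t in ε..(ρ/2), η / (2 * π) * t⁻¹ := by
          apply intervalIntegral.integral_mono_on (by linarith) j2 (k1.const_mul _)
          intro t ht
          have ht0 : 0 < t := by linarith [ht.1]
          rw [P.GG_eq ht0 (sub t (by linarith [ht.2]))]
          have := Q.AA_2 ht0 (x := x) (by linarith [ht.2])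
          gcongr
      _ = η / (2 * π) * Real.log (ρ / 2 / ε) := by
          rw [intervalIntegral.integral_const_mul, k2]
      _ ≤ _ := by
          have : Real.log (ρ / 2 / ε) ≤ Real.log (ρ / ε) := by
            apply Real.log_le_log (by positivity)
            gcongr; linarith
          gcongr
  have b3 : ∫ t in (ρ/2)..ρ, GG u p M x t ≤ K / (2 * π) * Real.log 2 := by
    obtain ⟨k1, k2⟩ := int_t1 (by linarith : 0 < ρ / 2) (by linarith : ρ / 2 ≤ ρ)
    calc _ ≤ ∫ t in (ρ/2)..ρ, K / (2 * π) * t⁻¹ := by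
          apply intervalIntegral.integral_mono_on (by linarith) j3 (k1.const_mul _)
          intro t ht
          have ht0 : 0 < t := by linarith [ht.1]
          rw [P.GG_eq ht0 (sub t (by linarith [ht.2]))]
          have := Q.AA_3 x t
          gcongr
      _ = K / (2 * π) * Real.log 2 := by
          rw [intervalIntegral.integral_const_mul, k2]
          congr 2; field_simp
  linarith

lemma CC.down (Q : CC Ω O u p M ε xn R η K L) {s ρ : ℝ} (hsub : closedBall xn s ⊆ O)
    (hρs : ρ ≤ s) (hρ : 2 * (R * ε) ≤ ρ) (hi : IntervalIntegrable (GG u p M xn) volume 0 s) :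
    (8 * π - η) / (2 * π) * (Real.log (ρ / (R * ε)) - 3 / 2) ≤ ∫ t in (0:ℝ)..ρ, GG u p M xn t := by
  have P := Q.P
  have hε := P.hε
  have hR := Q.R1
  have hη := Q.η0
  have hpi := Real.pi_pos
  have hη1 : 0 < 8 * π - η := by nlinarith [Real.pi_gt_three, Q.η1]
  have hRε : 0 < R * ε := by positivity
  have sub : ∀ t, t ≤ s → closedBall xn t ⊆ O := fun t ht => (closedBall_subset_closedBall ht).trans hsub
  have im : ∀ a b : ℝ, 0 ≤ a → a ≤ b → b ≤ s → IntervalIntegrable (GG u p M xn) volume a b := by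
    intro a b ha hab hb
    apply hi.mono_set
    rw [Set.uIcc_of_le hab, Set.uIcc_of_le (by linarith)]
    exact Set.Icc_subset_Icc ha hb
  have j1 := im 0 (R * ε) le_rfl hRε.le (by linarith)
  have j2 := im (R * ε) ρ hRε.le (by linarith) (by linarith)
  rw [← intervalIntegral.integral_add_adjacent_intervals j1 j2]
  have b1 : 0 ≤ ∫ t in (0:ℝ)..(R * ε), GG u p M xn t := by
    apply intervalIntegral.integral_nonneg hRε.le
    intro t ht
    exact P.GG_nn ht.1 (sub t (by linarith [ht.2]))
  have b2 : (8 * π - η) / (2 * π) * (Real.log (ρ / (R * ε)) - 3 / 2) ≤ ∫ t in (R * ε)..ρ, GG u p M xn t := by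
    obtain ⟨k1, k2⟩ := int_t1 hRε (by linarith : R * ε ≤ ρ)
    obtain ⟨k3, k4⟩ := int_t3 hRε (by linarith : R * ε ≤ ρ)
    calc _ ≤ (8 * π - η) / (2 * π) * (Real.log (ρ / (R * ε)) - 3 * (R * ε) ^ 2 * ∫ t in (R * ε)..ρ, (t ^ 3)⁻¹) := by
          have : 3 * (R * ε) ^ 2 * (∫ t in (R * ε)..ρ, (t ^ 3)⁻¹) ≤ 3 * (R * ε) ^ 2 * (((R * ε) ^ 2)⁻¹ / 2) := by gcongr
          have e : 3 * (R * ε) ^ 2 * (((R * ε) ^ 2)⁻¹ / 2) = 3 / 2 := by field_simp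
          gcongr
          linarith
      _ = ∫ t in (R * ε)..ρ, (8 * π - η) / (2 * π) * (t⁻¹ - 3 * (R * ε) ^ 2 * (t ^ 3)⁻¹) := by
          rw [intervalIntegral.integral_const_mul, intervalIntegral.integral_sub k1 (k3.const_mul _), intervalIntegral.integral_const_mul, k2]
      _ ≤ _ := by
          apply intervalIntegral.integral_mono_on (by linarith) ((k1.sub (k3.const_mul _)).const_mul _) j2
          intro t ht
          have ht0 : 0 < t := by linarith [ht.1]
          rw [P.GG_eq ht0 (sub t (by linarith [ht.2]))]
          have h5 := Q.AA_5 ht.1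
          calc _ = ((8 * π - η) * (1 - 3 * (R * ε) ^ 2 * (t ^ 2)⁻¹)) / (2 * π) * t⁻¹ := by field_simp
            _ ≤ _ := by gcongr
  linarith

lemma CC.Knn (Q : CC Ω O u p M ε xn R η K L) : 0 ≤ K := by
  have hM : 0 < M := by linarith [Q.P.M1]
  have h := mm_nonneg Q.P.H (le_refl (0:ℝ))
  have := Q.tot
  have hp := Q.P.hp
  by_contra hK
  have : 0 ≤ p * mm Ω u p 0 := by positivity
  nlinarith

lemma CC.far (Q : CC Ω O u p M ε xn R η K L) {x : E2} {s ρ : ℝ} (hsub : closedBall x s ⊆ O) (hsubn : closedBall xn s ⊆ O)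
    (hρ : 0 < ρ) (hρd : ρ = min (dist x xn) s)
    (hi : IntervalIntegrable (GG u p M x) volume 0 s) (hin : IntervalIntegrable (GG u p M xn) volume 0 s) :
    ∫ t in ρ..s, GG u p M x t ≤ (∫ t in ρ..s, GG u p M xn t) + 6 * K / (2 * π) := by
  have P := Q.P
  have hK := Q.Knn
  have hpi := Real.pi_pos
  rcases le_total s (dist x xn) with h | h
  · rw [min_eq_right h] at hρd
    subst hρd
    simp only [intervalIntegral.integral_same, zero_add]
    positivity
  · rw [min_eq_left h] at hρd
    have hs : ρ ≤ s := by linarith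
    have sub : ∀ t, t ≤ s → closedBall x t ⊆ O := fun t ht => (closedBall_subset_closedBall ht).trans hsub
    have subn : ∀ t, t ≤ s → closedBall xn t ⊆ O := fun t ht => (closedBall_subset_closedBall ht).trans hsubn
    have hss : Set.uIcc ρ s ⊆ Set.uIcc 0 s := by
      rw [Set.uIcc_of_le hs, Set.uIcc_of_le (by linarith)]
      exact Set.Icc_subset_Icc hρ.le le_rfl
    have j1 := hi.mono_set hss
    have j2 := hin.mono_set hss
    obtain ⟨k1, k2⟩ := int_t2 hρ hs
    calc _ ≤ ∫ t in ρ..s, (GG u p M xn t + 6 * K * ρ / (2 * π) * (t ^ 2)⁻¹) := by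
          apply intervalIntegral.integral_mono_on hs j1 (j2.add (k1.const_mul _))
          intro t ht
          have ht0 : 0 < t := by linarith [ht.1]
          show GG u p M x t ≤ GG u p M xn t + 6 * K * ρ / (2 * π) * (t ^ 2)⁻¹
          rw [P.GG_eq ht0 (sub t ht.2), P.GG_eq ht0 (subn t ht.2)]
          have h4 := Q.AA_4 ht0 (x := x)
          rw [← hρd] at h4
          calc _ ≤ (p / M * AA Ω u p xn t + 6 * K * ρ * t⁻¹) / (2 * π) * t⁻¹ := by gcongr
            _ = _ := by field_simp
      _ = (∫ t in ρ..s, GG u p M xn t) + 6 * K * ρ / (2 * π) * ∫ t in ρ..s, (t ^ 2)⁻¹ := by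
          rw [intervalIntegral.integral_add j2 (k1.const_mul _), intervalIntegral.integral_const_mul]
      _ ≤ (∫ t in ρ..s, GG u p M xn t) + 6 * K * ρ / (2 * π) * ρ⁻¹ := by gcongr
      _ = _ := by field_simp

lemma CC.decay (Q : CC Ω O u p M ε xn R η K L) {x : E2} {s : ℝ} (hsub : closedBall x s ⊆ O) (hsubn : closedBall xn s ⊆ O)
    (hs : 2 * (R * ε) ≤ s) (hd : 2 * (R * ε) ≤ dist x xn) (hds : dist x xn ≤ 2 * s) :
    p * (u x / M - 1) ≤ (3 * L / (π * s ^ 2) + 1 / 4 + K * Real.log 2 / (2 * π) + 6 * K / (2 * π)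
      + 4 * (Real.log 2 + Real.log R + 3 / 2)) - (4 - η / π) * Real.log (dist x xn / ε) := by
  have P := Q.P
  have hε := P.hε
  have hR := Q.R1
  have hη := Q.η0
  have hpi := Real.pi_pos
  have hM : 0 < M := by linarith [P.M1]
  have hRε : 0 < R * ε := by positivity
  have hs0 : 0 < s := by linarith
  set d := dist x xn with hdd
  set ρ := min d s with hρ
  have hρ1 : 2 * (R * ε) ≤ ρ := le_min hd hs
  have hρ0 : 0 < ρ := by linarith
  obtain ⟨i1, e1⟩ := P.GG_int hs0 hsub
  obtain ⟨i2, e2⟩ := P.GG_int hs0 hsubn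
  have hρs : ρ ≤ s := min_le_right _ _
  have hρd : ρ ≤ d := min_le_left _ _
  have a1 := Q.up hsub hρs hρd hρ1 i1
  have a2 := Q.down hsubn hρs hρ1 i2
  have a3 := Q.far hsub hsubn hρ0 hρ i1 i2
  have n1 := Q.NN_le hs0 hsub
  have n2 := P.NN_nn hs0 hsubn
  have split : ∀ f : ℝ → ℝ, IntervalIntegrable f volume 0 s → ∫ t in (0:ℝ)..s, f t = (∫ t in (0:ℝ)..ρ, f t) + ∫ t in ρ..s, f t := by
    intro f hf
    rw [intervalIntegral.integral_add_adjacent_intervals]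
    · apply hf.mono_set
      rw [Set.uIcc_of_le hρ0.le, Set.uIcc_of_le hs0.le]
      exact Set.Icc_subset_Icc le_rfl hρs
    · apply hf.mono_set
      rw [Set.uIcc_of_le hρs, Set.uIcc_of_le hs0.le]
      exact Set.Icc_subset_Icc hρ0.le le_rfl
  rw [split _ i1] at e1
  rw [split _ i2, P.hM] at e2
  have e3 : p / M * M = p := by field_simp
  rw [e3] at e2
  have e4 : p * (u x / M - 1) = p / M * u x - p := by field_simp
  -- logs
  have l1 : Real.log (ρ / ε) ≤ Real.log (d / ε) := Real.log_le_log (by positivity) (by gcongr)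
  have l2 : Real.log (d / ε) - Real.log 2 - Real.log R ≤ Real.log (ρ / (R * ε)) := by
    have hd0 : 0 < d := by linarith
    have : d / 2 ≤ ρ := le_min (by linarith) (by linarith)
    rw [← Real.log_div (by positivity) (by norm_num), ← Real.log_div (by positivity) (by positivity)]
    apply Real.log_le_log (by positivity)
    rw [div_div, div_div, div_le_div_iff₀ (by positivity) (by positivity)]
    have : 0 < R * ε := hRε
    nlinarith
  have l3 : 0 ≤ Real.log 2 + Real.log R + 3 / 2 := by
    have := Real.log_nonneg hR
    have := Real.log_nonneg (by norm_num : (1:ℝ) ≤ 2)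
    linarith
  have c1 : (8 * π - η) / (2 * π) = 4 - η / (2 * π) := by field_simp; ring
  have c2 : η / π = 2 * (η / (2 * π)) := by field_simp
  have c3 : 0 < 4 - η / (2 * π) := by
    rw [← c1]
    have : 0 < 8 * π - η := by nlinarith [Real.pi_gt_three, Q.η1]
    positivity
  have c4 : 0 < η / (2 * π) := by positivity
  rw [c1] at a2
  rw [e4, c2]
  have m1 := mul_le_mul_of_nonneg_left l1 c4.le
  have m2 := mul_le_mul_of_nonneg_left l2 c3.le
  have m3 := mul_nonneg c4.le l3
  have m4 : K / (2 * π) * Real.log 2 = K * Real.log 2 / (2 * π) := by ring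
  nlinarith
end

section
variable {Ω O D : Set E2} {u : E2 → ℝ} {p M ε : ℝ} {xn : E2}

set_option maxHeartbeats 1000000 in
lemma PV.mkCC (P : PV Ω O u p M ε xn) {σ η T K L Rb : ℝ} {J : ℕ} (hη1 : η < 1) (hσ0 : 0 < σ)
    (hση : (112 * π * Real.exp 1 + 1) * σ ≤ η) (hMl : Real.exp (1 / 2) * (1 - σ) ≤ M)
    (hb : p * ee Ω u p 0 ≤ 8 * π * Real.exp 1 * (1 + σ)) (h2 : p * (1 / 2) ^ p * volume.real Ω ≤ σ)
    (hT : 1 < T) (hbT : 8 * π * Real.exp 1 * 2 / (T - 1) ≤ σ * (Real.exp (-1) * (π / 12)))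
    (hp1 : 1 - σ ≤ p / (p + 1)) (hp2 : 1 - σ ≤ 1 - T / p) (hTp : 2 * (2 * T + 1 / 2) ≤ p)
    (hK : K = 2 * (8 * π * Real.exp 1 * 2) + 1)
    (hJ : K < (J + 1) * (π / 6 * Real.exp (-(2 * (2 * T + 1 / 2)))))
    (hRb : 0 ≤ Rb) (hΩ : Ω ⊆ closedBall 0 Rb) (hL : L = Rb ^ 2 / 4 * K + 2 * volume.real Ω)
    (hsub : closedBall xn ((3 * J + 3) * ε) ⊆ O) : CC Ω O u p M ε xn (3 * J + 3) η K L := by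
  have hpi := Real.pi_gt_three
  have he : 1 ≤ Real.exp 1 := by linarith [Real.add_one_le_exp (1:ℝ)]
  have hp := P.hp
  have hM1 := P.M1
  have hε := P.hε
  have hA : 1 ≤ π * Real.exp 1 := by nlinarith
  have hσ1 : σ < 1 / 113 := by nlinarith
  have hη0 : 0 < η := by nlinarith
  have hb2 : p * ee Ω u p 0 ≤ 8 * π * Real.exp 1 * 2 := by nlinarith
  have hKm : p * mm Ω u p 0 ≤ K * M := by
    have := P.H.mm_le
    have h3 : p * mm Ω u p 0 ≤ K := by rw [hK]; nlinarith
    have : 0 ≤ K := by rw [hK]; positivity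
    nlinarith
  have hJ0 : (0:ℝ) ≤ J := Nat.cast_nonneg J
  obtain ⟨j, hj, hsp⟩ := P.lowsphere (by linarith) hTp hKm hJ hsub
  have hjJ : (j:ℝ) ≤ J := by exact_mod_cast hj
  have hj0 : (0:ℝ) ≤ j := Nat.cast_nonneg j
  have hsub' : closedBall xn ((3 * j + 2) * ε) ⊆ O :=
    (closedBall_subset_closedBall (by nlinarith)).trans hsub
  obtain ⟨c1, c2⟩ := P.conc hT (by nlinarith) hσ0 (by linarith) hb2 hbT hp1 hp2 hsub' hsp
  have hbb : ball xn ((3 * j + 2) * ε) ⊆ ball xn ((3 * J + 3) * ε) := ball_subset_ball (by nlinarith)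
  have hbO : ball xn ((3 * J + 3) * ε) ⊆ O := ball_subset_closedBall.trans hsub
  have mono : ∀ q : ℝ, 0 ≤ q → ∫ z in ball xn ((3 * j + 2) * ε), (u z) ^ q ≤ ∫ z in ball xn ((3 * J + 3) * ε), (u z) ^ q := by
    intro q hq
    apply setIntegral_mono_set ((P.H.intpow le_rfl hq).mono_set (hbO.trans P.sub_sl))
    · refine (ae_restrict_mem measurableSet_ball).mono fun z hz => ?_
      exact Real.rpow_nonneg (P.pos z (hbO hz)).le _
    · exact hbb.eventuallyLE
  have m1 := mul_le_mul_of_nonneg_left (mono p (by linarith)) (by linarith : 0 ≤ p)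
  have m2 := mul_le_mul_of_nonneg_left (mono (p + 1) (by linarith)) (by linarith : 0 ≤ p)
  have q3 : 1 - 3 * σ ≤ (1 - σ) ^ 3 := by nlinarith [mul_pos hσ0 hσ0]
  have q6 : 1 - 6 * σ ≤ (1 - σ) ^ 6 := by
    have := one_add_mul_le_pow (a := -σ) (by linarith) 6
    norm_num at this
    rw [sub_eq_add_neg (1:ℝ) σ]
    linarith
  have hMM : Real.exp 1 * (1 - σ) ^ 2 ≤ M ^ 2 := by
    have h0 : 0 ≤ Real.exp (1 / 2) * (1 - σ) := mul_nonneg (Real.exp_pos _).le (by linarith)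
    have h1 : (Real.exp (1 / 2) * (1 - σ)) ^ 2 ≤ M ^ 2 := by gcongr
    have h3 : Real.exp (1 / 2) ^ 2 = Real.exp 1 := by rw [← Real.exp_nat_mul]; norm_num
    rw [mul_pow, h3] at h1
    exact h1
  refine ⟨P, by linarith, hη0, hη1, ?_, ?_, hKm, ?_, hsub⟩
  · refine le_trans ?_ (c1.trans m1)
    apply mul_le_mul_of_nonneg_right _ (by linarith)
    nlinarith
  · have hr := P.rest measurableSet_ball hbO
    have h3 : 8 * π * (Real.exp 1 * (1 - 6 * σ)) ≤ p * ∫ z in ball xn ((3 * J + 3) * ε), (u z) ^ (p + 1) := by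
      refine le_trans ?_ (c2.trans m2)
      calc _ ≤ 8 * π * (Real.exp 1 * (1 - σ) ^ 6) := by gcongr
        _ = 8 * π * (1 - σ) ^ 4 * (Real.exp 1 * (1 - σ) ^ 2) := by ring
        _ ≤ _ := by gcongr
    have : η ≤ η * M := by nlinarith
    nlinarith
  · have h := P.H.l1 hRb hΩ
    have h3 : p * (∫ x in sl Ω u 0, u x) ≤ Rb ^ 2 / 4 * (p * mm Ω u p 0) + 2 * volume.real Ω := by
      calc _ ≤ p * (Rb ^ 2 / 4 * mm Ω u p 0 + 2 / p * volume.real Ω) := by gcongr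
        _ = _ := by field_simp
    have hv : 0 ≤ volume.real Ω := measureReal_nonneg
    have h4 : Rb ^ 2 / 4 * (p * mm Ω u p 0) ≤ Rb ^ 2 / 4 * (K * M) := by gcongr
    rw [hL]
    nlinarith

/-- final pointwise estimate for one index -/
lemma CC.final {R η K L s C δ : ℝ} (Q : CC Ω O u p M ε xn R η K L) {z : E2}
    (hsub : closedBall (xn + ε • z) s ⊆ O) (hsubn : closedBall xn s ⊆ O)
    (hs : 2 * (R * ε) ≤ s) (hz : ε * ‖z‖ ≤ 2 * s) (hδ0 : 0 < δ) (hδ1 : δ < 1) (hη : η ≤ δ) (hs0 : 0 < s)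
    (hC : C = (3 * L / (π * s ^ 2) + 1 / 4 + K * Real.log 2 / (2 * π) + 6 * K / (2 * π)
      + 4 * (Real.log 2 + Real.log R + 3 / 2))) :
    (u (xn + ε • z) / M) ^ p ≤ (1 + (2 * R) ^ (4 - δ) + 2 * Real.exp C) / (1 + ‖z‖ ^ (4 - δ)) := by
  have P := Q.P
  have hM : 0 < M := by linarith [P.M1]
  have hε := P.hε
  have hR := Q.R1
  have hp := P.hp
  have hxO : xn + ε • z ∈ O := hsub (mem_closedBall_self hs0.le)
  have hpos := P.pos _ hxO
  have hle := P.leM hxO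
  have hz0 := norm_nonneg z
  have hden : 0 < 1 + ‖z‖ ^ (4 - δ) := by
    have := Real.rpow_nonneg hz0 (4 - δ)
    linarith
  set θ := u (xn + ε • z) / M with hθ
  have hθ0 : 0 < θ := by positivity
  have hθ1 : θ ≤ 1 := by rw [hθ, div_le_one hM]; exact hle
  rw [le_div_iff₀ hden]
  rcases lt_or_ge ‖z‖ (2 * R) with h | h
  · have h1 : θ ^ p ≤ 1 := Real.rpow_le_one hθ0.le hθ1 (by linarith)
    have h2 : ‖z‖ ^ (4 - δ) ≤ (2 * R) ^ (4 - δ) := Real.rpow_le_rpow hz0 h.le (by linarith)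
    have := Real.exp_pos C
    nlinarith
  · have hd : dist (xn + ε • z) xn = ε * ‖z‖ := by
      rw [dist_self_add_left, norm_smul, Real.norm_eq_abs, abs_of_pos hε]
    have hdec := Q.decay hsub hsubn hs (by rw [hd]; nlinarith) (by rw [hd]; exact hz)
    rw [← hC, hd, mul_div_cancel_left₀ _ hε.ne', ← hθ] at hdec
    have hz1 : 1 ≤ ‖z‖ := by linarith
    have hzp : 0 < ‖z‖ := by linarith
    have hlog := Real.log_nonneg hz1
    have hηpi : η / π ≤ δ := by
      rw [div_le_iff₀ Real.pi_pos]
      nlinarith [Real.pi_gt_three]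
    have h1 : θ ^ p ≤ Real.exp (C - (4 - δ) * Real.log ‖z‖) := by
      rw [Real.rpow_def_of_pos hθ0]
      apply Real.exp_le_exp.mpr
      have := Real.log_le_sub_one_of_pos hθ0
      nlinarith
    have h2 : Real.exp (C - (4 - δ) * Real.log ‖z‖) * ‖z‖ ^ (4 - δ) = Real.exp C := by
      rw [Real.rpow_def_of_pos hzp, ← Real.exp_add]; congr 1; ring
    have h3 : 1 ≤ ‖z‖ ^ (4 - δ) := Real.one_le_rpow hz1 (by linarith)
    have h4 : 0 < Real.exp (C - (4 - δ) * Real.log ‖z‖) := Real.exp_pos _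
    have h5 : 0 ≤ (2 * R) ^ (4 - δ) := Real.rpow_nonneg (by linarith) _
    have h6 := Real.rpow_nonneg hθ0.le p
    calc θ ^ p * (1 + ‖z‖ ^ (4 - δ)) ≤ Real.exp (C - (4 - δ) * Real.log ‖z‖) * (1 + ‖z‖ ^ (4 - δ)) := by gcongr
      _ ≤ Real.exp (C - (4 - δ) * Real.log ‖z‖) * (‖z‖ ^ (4 - δ) + ‖z‖ ^ (4 - δ)) := by gcongr
      _ = 2 * Real.exp C := by rw [← h2]; ring
      _ ≤ _ := by linarith
end

section
lemma ball_subΩ {Ω : Set E2} (hΩo : IsOpen Ω) {x0 : E2} (hx0 : x0 ∈ Ω) {r : ℝ} (hr : 0 < r) (hf : ∀ y ∈ ball x0 r, y ∉ frontier Ω) : ball x0 r ⊆ Ω := by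
  have hpc : IsPreconnected (ball x0 r) := (convex_ball x0 r).isPreconnected
  by_contra hcon
  obtain ⟨y, hy, hyn⟩ := Set.not_subset.mp hcon
  obtain ⟨z, hz, hz1, hz2⟩ := hpc Ω (closure Ω)ᶜ hΩo isClosed_closure.isOpen_compl
    (by
      intro z hz
      by_cases hzc : z ∈ closure Ω
      · left
        by_contra hzn
        exact hf z hz (by rw [hΩo.frontier_eq]; exact ⟨hzc, hzn⟩)
      · right; exact hzc)
    ⟨x0, mem_ball_self hr, hx0⟩
    ⟨y, hy, fun hyc => hf y hy (by rw [hΩo.frontier_eq]; exact ⟨hyc, hyn⟩)⟩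
  exact hz2 (subset_closure hz1)

set_option maxHeartbeats 1000000 in
lemma one_sign (Ω : Set E2) (hΩo : IsOpen Ω) (hΩb : IsBounded Ω)
    (p : ℕ → ℝ) (hp1 : ∀ n, 1 < p n) (hptop : Tendsto p atTop atTop)
    (u : ℕ → E2 → ℝ) (hsol : ∀ n, IsSolution Ω (p n) (u n))
    (hpos : ∀ n, ∃ x ∈ Ω, 0 < u n x)
    (hlow : Tendsto (fun n => p n * ee Ω (u n) (p n) 0) atTop (𝓝 (8 * π * Real.exp 1)))
    (xl : ℕ → E2) (hmax : ∀ n, ∀ y ∈ closure Ω, u n y ≤ u n (xl n))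
    (x0 : E2) (hx : x0 ∈ Ω) (hxconv : Tendsto xl atTop (𝓝 x0))
    (ε : ℕ → ℝ) (hεpos : ∀ n, 0 < ε n)
    (hεdef : ∀ n, (ε n) ^ 2 * (p n * (u n (xl n)) ^ (p n - 1)) = 1)
    (ϱ : ℝ) (hϱ : 0 < ϱ) (N0 : ℕ)
    (hsign : ∀ n ≥ N0, ∀ y ∈ ball x0 (2 * ϱ), 1 / p n ≤ u n y)
    (δ : ℝ) (hδ0 : 0 < δ) (hδ1 : δ < 1) :
    ∃ C > (0:ℝ), ∀ᶠ n in atTop, ∀ z : E2, ‖z‖ ≤ ϱ / ε n →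
      0 < u n (xl n + ε n • z) / u n (xl n) ∧
      (u n (xl n + ε n • z) / u n (xl n)) ^ (p n) ≤ C / (1 + ‖z‖ ^ ((4:ℝ) - δ)) := by
  have hpi := Real.pi_gt_three
  have he : 1 ≤ Real.exp 1 := by linarith [Real.add_one_le_exp (1:ℝ)]
  have hA : 1 ≤ π * Real.exp 1 := by nlinarith
  have hA2 : 0 < 112 * π * Real.exp 1 + 1 := by nlinarith
  set σ := δ / (112 * π * Real.exp 1 + 1) with hσ
  have hσ0 : 0 < σ := by positivity
  have hση : (112 * π * Real.exp 1 + 1) * σ ≤ δ := by rw [hσ]; field_simp; exact le_refl _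
  have hσ1 : σ < 1 / 113 := by nlinarith
  obtain ⟨T, hT1, hbT⟩ : ∃ T : ℝ, 1 < T ∧ 8 * π * Real.exp 1 * 2 / (T - 1) ≤ σ * (Real.exp (-1) * (π / 12)) := by
    have hc : 0 < σ * (Real.exp (-1) * (π / 12)) := by positivity
    refine ⟨1 + 8 * π * Real.exp 1 * 2 / (σ * (Real.exp (-1) * (π / 12))), ?_, ?_⟩
    · have : 0 < 8 * π * Real.exp 1 * 2 / (σ * (Real.exp (-1) * (π / 12))) := by positivity
      linarith
    · rw [add_sub_cancel_left, div_div_cancel₀ (by positivity)]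
  obtain ⟨K, hK⟩ : ∃ K : ℝ, K = 2 * (8 * π * Real.exp 1 * 2) + 1 := ⟨_, rfl⟩
  obtain ⟨J, hJ⟩ : ∃ J : ℕ, K < (J + 1) * (π / 6 * Real.exp (-(2 * (2 * T + 1 / 2)))) := by
    have hc : 0 < π / 6 * Real.exp (-(2 * (2 * T + 1 / 2))) := by positivity
    obtain ⟨J, hJ⟩ := exists_nat_gt (K / (π / 6 * Real.exp (-(2 * (2 * T + 1 / 2)))))
    refine ⟨J, ?_⟩
    rw [div_lt_iff₀ hc] at hJ
    nlinarith
  obtain ⟨Rb0, hRb0⟩ := hΩb.subset_closedBall (0 : E2)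
  obtain ⟨Rb, hRbd⟩ : ∃ Rb : ℝ, Rb = max Rb0 0 := ⟨_, rfl⟩
  have hRb : 0 ≤ Rb := by rw [hRbd]; exact le_max_right _ _
  have hΩR : Ω ⊆ closedBall 0 Rb := hRb0.trans (closedBall_subset_closedBall (by rw [hRbd]; exact le_max_left _ _))
  obtain ⟨L, hL⟩ : ∃ L : ℝ, L = Rb ^ 2 / 4 * K + 2 * volume.real Ω := ⟨_, rfl⟩
  obtain ⟨R, hR⟩ : ∃ R : ℝ, R = 3 * J + 3 := ⟨_, rfl⟩
  have hR3 : 3 ≤ R := by rw [hR]; have : (0:ℝ) ≤ J := Nat.cast_nonneg J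
                         linarith
  obtain ⟨C, hC⟩ : ∃ C : ℝ, C = (3 * L / (π * (ϱ / 2) ^ 2) + 1 / 4 + K * Real.log 2 / (2 * π) + 6 * K / (2 * π)
      + 4 * (Real.log 2 + Real.log R + 3 / 2)) := ⟨_, rfl⟩
  refine ⟨1 + (2 * R) ^ (4 - δ) + 2 * Real.exp C, by positivity, ?_⟩
  have v0 : 0 ≤ volume.real Ω := measureReal_nonneg
  -- eventual facts
  have f1 := hlow.eventually (ge_mem_nhds (show 8 * π * Real.exp 1 < 8 * π * Real.exp 1 * (1 + σ ^ 2 / 2) by nlinarith [pow_pos hσ0 2]))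
  have f2 := hptop.eventually (decay_q (Real.exp_pos (-(σ ^ 2 / 4))) (Real.exp_lt_one_iff.mpr (by nlinarith [pow_pos hσ0 2])) (volume.real Ω))
  have f3 := hptop.eventually (decay_q (q := 1 / 2) (by norm_num) (by norm_num) (8 * π * volume.real Ω / σ))
  have f4 := hptop.eventually (eventually_ge_atTop (2 * (2 * T + 1 / 2)))
  have f5 := hptop.eventually (eventually_ge_atTop (T / σ))
  have f5' := hptop.eventually (eventually_ge_atTop (1 / σ))
  have hc : 0 < ϱ / (4 * R) := by positivity
  have f6 := hptop.eventually (eventually_ge_atTop ((ϱ / (4 * R)) ^ 2)⁻¹)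
  have f7 := hxconv.eventually (ball_mem_nhds x0 (show 0 < ϱ / 2 by linarith))
  filter_upwards [f1, f2, f3, f4, f5, f5', f6, f7, eventually_ge_atTop N0] with n g1 g2 g3 g4 g5 g5' g6 g7 gN z hz
  have hp := hp1 n
  obtain ⟨xx, hxx, hux⟩ := hpos n
  have H : LES Ω (u n) (p n) 0 (u n (xl n)) := les_of_sol hΩo hΩb hp (hsol n) (hmax n)
  have hMl := H.low2 hxx hux hσ0 g2 g1
  have hM1 : 1 ≤ u n (xl n) := by
    have := Real.add_one_le_exp (1 / 2 : ℝ)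
    nlinarith
  have hε := hεpos n
  have hεsmall : ε n ≤ ϱ / (4 * R) := by
    have h1 : 1 ≤ (u n (xl n)) ^ (p n - 1) := Real.one_le_rpow hM1 (by linarith)
    have h2 : (ε n) ^ 2 * p n ≤ 1 := by
      rw [← hεdef n]
      have : 0 < (ε n) ^ 2 * p n := by positivity
      nlinarith
    have h3 : (ε n) ^ 2 ≤ (ϱ / (4 * R)) ^ 2 := by
      have h4 : (ε n) ^ 2 * ((ϱ / (4 * R)) ^ 2)⁻¹ ≤ 1 := by
        have : 0 < (ε n) ^ 2 := by positivity
        nlinarith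
      rw [← div_eq_mul_inv, div_le_one (by positivity)] at h4
      exact h4
    exact le_of_sq_le_sq h3 hc.le
  have hRε : R * ε n ≤ ϱ / 4 := by
    rw [le_div_iff₀ (by positivity)] at hεsmall
    linarith
  have hOpos : ∀ y ∈ ball x0 (2 * ϱ), 0 < u n y := fun y hy => by
    have := hsign n gN y hy
    have : 0 < 1 / p n := by positivity
    linarith
  have hOΩ : ball x0 (2 * ϱ) ⊆ Ω := ball_subΩ hΩo hx (by linarith) fun y hy hyf => by
    have := (hsol n).2.2.2 y hyf
    have := hOpos y hy
    linarith
  have P : PV Ω (ball x0 (2 * ϱ)) (u n) (p n) (u n (xl n)) (ε n) (xl n) :=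
    ⟨H, isOpen_ball, hOΩ, hOpos, rfl, hε, hεdef n, hM1⟩
  have sub : ∀ y r, dist y (xl n) + r ≤ 3 * ϱ / 2 → closedBall y r ⊆ ball x0 (2 * ϱ) := by
    intro y r h w hw
    rw [mem_closedBall] at hw
    rw [mem_ball]
    have := dist_triangle4 w y (xl n) x0
    linarith
  have Q : CC Ω (ball x0 (2 * ϱ)) (u n) (p n) (u n (xl n)) (ε n) (xl n) (3 * J + 3) δ K L := by
    refine P.mkCC hδ1 hσ0 hση hMl ?_ ?_ hT1 hbT ?_ ?_ g4 hK hJ hRb hΩR hL ?_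
    · refine g1.trans ?_
      have : σ ^ 2 / 2 ≤ σ := by nlinarith
      gcongr
    · have e : p n * (p n + 1) * (8 * π * volume.real Ω / σ) / (8 * π) * (1 / 2) ^ (p n - 1)
          = (p n * (1 / 2) ^ (p n) * volume.real Ω) * (2 * (p n + 1)) / σ := by
        rw [Real.rpow_sub_one (by norm_num)]; field_simp
      rw [e, div_lt_one hσ0] at g3
      have : 0 ≤ p n * (1 / 2) ^ (p n) * volume.real Ω := by positivity
      nlinarith
    · rw [le_div_iff₀ (by linarith)]
      rw [div_le_iff₀ hσ0] at g5'
      nlinarith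
    · rw [div_le_iff₀ hσ0] at g5
      have : T / p n ≤ σ := by rw [div_le_iff₀ (by linarith)]; linarith
      linarith
    · apply sub
      rw [dist_self, ← hR]; linarith
  rw [← hR] at Q
  rw [le_div_iff₀ hε] at hz
  have hd : dist (xl n + ε n • z) (xl n) = ε n * ‖z‖ := by
    rw [dist_self_add_left, norm_smul, Real.norm_eq_abs, abs_of_pos hε]
  refine ⟨?_, Q.final (s := ϱ / 2) ?_ ?_ ?_ ?_ hδ0 hδ1 le_rfl (by linarith) hC⟩
  · have : 0 < u n (xl n + ε n • z) := hOpos _ (sub _ 0 (by rw [hd]; linarith) (mem_closedBall_self le_rfl))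
    positivity
  · exact sub _ _ (by rw [hd]; linarith)
  · exact sub _ _ (by rw [dist_self]; linarith)
  · linarith
  · linarith
end

section
lemma lim_split {a b : ℕ → ℝ} {A : ℝ} (ha : ∀ c < A, ∀ᶠ n in atTop, c ≤ a n) (hb : ∀ c < A, ∀ᶠ n in atTop, c ≤ b n)
    (h : Tendsto (fun n => a n + b n) atTop (𝓝 (2 * A))) : Tendsto a atTop (𝓝 A) := by
  rw [tendsto_order]
  constructor
  · intro c hc
    filter_upwards [ha ((c + A) / 2) (by linarith)] with n hn
    linarith
  · intro c hc
    filter_upwards [hb (A - (c - A) / 2) (by linarith), h.eventually (gt_mem_nhds (show 2 * A < 2 * A + (c - A) / 2 by linarith))] with n h1 h2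
    linarith

lemma low_ev {Ω : Set E2} {p : ℕ → ℝ} (hptop : Tendsto p atTop atTop) {u : ℕ → E2 → ℝ} {M : ℕ → ℝ}
    (H : ∀ n, LES Ω (u n) (p n) 0 (M n)) (hpos : ∀ n, ∃ x ∈ Ω, 0 < u n x) :
    ∀ c < 8 * π * Real.exp 1, ∀ᶠ n in atTop, c ≤ p n * ee Ω (u n) (p n) 0 := by
  intro c hc
  have ht : Tendsto (fun q : ℝ => 8 * π * Real.exp 1 * q ^ 2) (𝓝[<] 1) (𝓝 (8 * π * Real.exp 1)) := by
    have : Continuous fun q : ℝ => 8 * π * Real.exp 1 * q ^ 2 := by fun_prop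
    have h := this.tendsto 1
    simp only [one_pow, mul_one] at h
    exact h.mono_left nhdsWithin_le_nhds
  have e1 := ht.eventually (lt_mem_nhds hc)
  have e2 : ∀ᶠ q : ℝ in 𝓝[<] 1, q ∈ Set.Ioo (0:ℝ) 1 := Ioo_mem_nhdsLT zero_lt_one
  obtain ⟨q, h1, h2⟩ := (e1.and e2).exists
  filter_upwards [hptop.eventually (decay_q h2.1 h2.2 (volume.real Ω))] with n hn
  obtain ⟨x, hx, hux⟩ := hpos n
  exact h1.le.trans ((H n).low1 hx hux h2.1 hn)


end

/-- Corollary 3.5: polynomial decay of `|1 + v_{i,p}/p|^p`. -/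
theorem rescaled_polynomial_decay
    (Ω : Set E2) (hΩo : IsOpen Ω) (hΩb : IsBounded Ω) (hΩne : Ω.Nonempty)
    (p : ℕ → ℝ) (hp1 : ∀ n, 1 < p n) (hptop : Tendsto p atTop atTop)
    (u : ℕ → E2 → ℝ)
    (hsol : ∀ n, IsSolution Ω (p n) (u n))
    (hnod : ∀ n, IsNodal Ω (u n))
    (hlow : Tendsto (fun n => p n * ∫ x in Ω, |u n x| ^ (p n + 1)) atTop
      (𝓝 (16 * π * Real.exp 1)))
    (xl : Fin 2 → ℕ → E2)
    (hmax : ∀ n, xl 0 n ∈ Ω ∧ ∀ y ∈ closure Ω, u n y ≤ u n (xl 0 n))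
    (hmin : ∀ n, xl 1 n ∈ Ω ∧ ∀ y ∈ closure Ω, u n (xl 1 n) ≤ u n y)
    (x : Fin 2 → E2) (hx : ∀ i, x i ∈ Ω) (hxne : x 0 ≠ x 1)
    (hxconv : ∀ i, Tendsto (fun n => xl i n) atTop (𝓝 (x i)))
    (ε : Fin 2 → ℕ → ℝ) (hεpos : ∀ i n, 0 < ε i n)
    (hεdef : ∀ i n, (ε i n) ^ 2 * (p n * |u n (xl i n)| ^ (p n - 1)) = 1)
    (v : Fin 2 → ℕ → E2 → ℝ)
    (hv : ∀ i n z, v i n z =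
      (p n / u n (xl i n)) * (u n (xl i n + ε i n • z) - u n (xl i n)))
    (r0 : ℝ) (hr0 : 0 < r0)
    (hdisj : Disjoint (ball (x 0) (2 * r0)) (ball (x 1) (2 * r0)))
    (ϱ0 : ℝ) (hϱ0 : ϱ0 ∈ Set.Ioo (0:ℝ) (r0 / 2)) (N0 : ℕ)
    (hsign : ∀ n ≥ N0,
      (∀ y ∈ ball (x 0) (2 * ϱ0), 1 / p n ≤ u n y) ∧
      (∀ y ∈ ball (x 1) (2 * ϱ0), u n y ≤ -(1 / p n)))
    :
    ∀ δ ∈ Set.Ioo (0:ℝ) 1, ∃ N ≥ N0, ∃ C > (0:ℝ),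
      ∀ n ≥ N, ∀ i : Fin 2, ∀ z : E2,
        ‖z‖ ≤ ϱ0 / ε i n →
          |1 + v i n z / p n| ^ (p n) ≤ C / (1 + ‖z‖ ^ ((4:ℝ) - δ)) := by
  intro δ hδ
  have hP : ∀ n, ∃ y ∈ Ω, 0 < u n y := fun n => (hnod n).1
  have hN : ∀ n, ∃ y ∈ Ω, 0 < (fun y => -u n y) y := fun n => by
    obtain ⟨y, hy, h⟩ := (hnod n).2
    exact ⟨y, hy, by simpa using h⟩
  have hmaxN : ∀ n, ∀ y ∈ closure Ω, (fun y => -u n y) y ≤ (fun y => -u n y) (xl 1 n) := fun n y hy => by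
    have := (hmin n).2 y hy
    simpa using this
  have HP : ∀ n, LES Ω (u n) (p n) 0 (u n (xl 0 n)) := fun n => les_of_sol hΩo hΩb (hp1 n) (hsol n) (hmax n).2
  have HN : ∀ n, LES Ω (fun y => -u n y) (p n) 0 (-u n (xl 1 n)) := fun n =>
    les_of_sol hΩo hΩb (hp1 n) (sol_neg (hsol n)) (hmaxN n)
  have hposP : ∀ n, 0 < u n (xl 0 n) := fun n => by
    obtain ⟨y, hy, h⟩ := hP n
    exact lt_of_lt_of_le h ((hmax n).2 y (subset_closure hy))
  have hposN : ∀ n, 0 < -u n (xl 1 n) := fun n => by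
    obtain ⟨y, hy, h⟩ := hN n
    exact lt_of_lt_of_le h (hmaxN n y (subset_closure hy))
  have hsum : Tendsto (fun n => p n * ee Ω (u n) (p n) 0 + p n * ee Ω (fun y => -u n y) (p n) 0) atTop (𝓝 (2 * (8 * π * Real.exp 1))) := by
    have e : 2 * (8 * π * Real.exp 1) = 16 * π * Real.exp 1 := by ring
    rw [e]
    refine hlow.congr fun n => ?_
    rw [energy_split (HP n) (HN n), mul_add]
  have lowP := low_ev hptop HP hP
  have lowN := low_ev hptop HN hN
  have limP := lim_split lowP lowN hsum
  have limN := lim_split lowN lowP (by simpa [add_comm] using hsum)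
  obtain ⟨C1, hC1, E1⟩ := one_sign Ω hΩo hΩb p hp1 hptop u hsol hP limP (xl 0) (fun n => (hmax n).2) (x 0) (hx 0) (hxconv 0)
    (ε 0) (hεpos 0) (fun n => by have := hεdef 0 n; rwa [abs_of_pos (hposP n)] at this) ϱ0 hϱ0.1 N0 (fun n hn => (hsign n hn).1) δ hδ.1 hδ.2
  obtain ⟨C2, hC2, EE2⟩ := one_sign Ω hΩo hΩb p hp1 hptop (fun n y => -u n y) (fun n => sol_neg (hsol n)) hN limN (xl 1) hmaxN (x 1) (hx 1) (hxconv 1)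
    (ε 1) (hεpos 1) (fun n => by
      have := hεdef 1 n
      rwa [abs_of_neg (by linarith [hposN n])] at this) ϱ0 hϱ0.1 N0 (fun n hn y hy => by
      have := (hsign n hn).2 y hy
      show 1 / p n ≤ -u n y
      linarith) δ hδ.1 hδ.2
  obtain ⟨N, hNN⟩ := eventually_atTop.mp (E1.and EE2)
  refine ⟨max N N0, le_max_right _ _, C1 + C2, by linarith, ?_⟩
  intro n hn i z hz
  obtain ⟨h1, h2⟩ := hNN n (le_trans (le_max_left _ _) hn)
  have hp : 0 < p n := by linarith [hp1 n]
  have hθ : ∀ i, u n (xl i n) ≠ 0 → 1 + v i n z / p n = u n (xl i n + ε i n • z) / u n (xl i n) := by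
    intro i hi
    rw [hv]; field_simp; ring
  have hden : 0 < 1 + ‖z‖ ^ ((4:ℝ) - δ) := by
    have := Real.rpow_nonneg (norm_nonneg z) (4 - δ)
    linarith
  fin_cases i
  · obtain ⟨k1, k2⟩ := h1 z hz
    have := hθ 0 (hposP n).ne'
    change |1 + v 0 n z / p n| ^ (p n) ≤ _
    rw [this, abs_of_pos k1]
    refine k2.trans ?_
    gcongr
    linarith
  · obtain ⟨k1, k2⟩ := h2 z hz
    rw [neg_div_neg_eq] at k1 k2
    have := hθ 1 (by have := hposN n; intro h; rw [h] at this; simp at this)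
    change |1 + v 1 n z / p n| ^ (p n) ≤ _
    rw [this, abs_of_pos k1]
    refine k2.trans ?_
    gcongr
    linarith

end
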